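/- Let B be the open unit ball in ℝ^n, b ≥ 0 a constant, α ∈ (0,1) and M > 0. There exists C > 0, depending only on n, b, α and M, such that every smooth convex function h : B → ℝ satisfying Δh + b·det(D²h) = 1 on B and ‖h‖_{C^{1,α}(B)} ≤ M satisfies ‖h‖_{C^{2,α}(B_{1/2})} ≤ C, where B_{1/2} is the concentric ball of radius 1/2. -/

import Mathlib

/-- The Hessian matrix `D²f(x)` of `f : ℝⁿ → ℝ` at `x`, with entries `∂_i ∂_j f(x)`. -/
noncomputable def Hess (n : ℕ) (f : EuclideanSpace ℝ (Fin n) → ℝ)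
    (x : EuclideanSpace ℝ (Fin n)) : Matrix (Fin n) (Fin n) ℝ :=
  Matrix.of fun i j =>
    iteratedFDeriv ℝ 2 f x ![EuclideanSpace.single i 1, EuclideanSpace.single j 1]

open Set Filter Topology MeasureTheory Metric

namespace EK

/-- Euclidean space. -/
abbrev E (n : ℕ) := EuclideanSpace ℝ (Fin n)

/-- basis vector -/
noncomputable def e {n : ℕ} (i : Fin n) : E n := EuclideanSpace.single i 1

/-- partial derivative -/
noncomputable def pd {n : ℕ} (i : Fin n) (f : E n → ℝ) (x : E n) : ℝ := fderiv ℝ f x (e i)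

/-- bilinear form on covectors -/
noncomputable def bf {n : ℕ} (c : Matrix (Fin n) (Fin n) ℝ) (ξ η : E n →L[ℝ] ℝ) : ℝ :=
  ∑ i, ∑ j, c i j * ξ (e i) * η (e j)

section bf
variable {n : ℕ} (c : Matrix (Fin n) (Fin n) ℝ) (ξ ξ' η η' : E n →L[ℝ] ℝ) (t : ℝ)

lemma bf_add_left : bf c (ξ + ξ') η = bf c ξ η + bf c ξ' η := by
  simp only [bf, add_apply, ← Finset.sum_add_distrib]
  refine Finset.sum_congr rfl fun i _ => Finset.sum_congr rfl fun j _ => by ring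
lemma bf_add_right : bf c ξ (η + η') = bf c ξ η + bf c ξ η' := by
  simp only [bf, add_apply, ← Finset.sum_add_distrib]
  refine Finset.sum_congr rfl fun i _ => Finset.sum_congr rfl fun j _ => by ring
lemma bf_smul_left : bf c (t • ξ) η = t * bf c ξ η := by
  simp only [bf, smul_apply, Finset.mul_sum, smul_eq_mul]
  refine Finset.sum_congr rfl fun i _ => Finset.sum_congr rfl fun j _ => by ring
lemma bf_smul_right : bf c ξ (t • η) = t * bf c ξ η := by
  simp only [bf, smul_apply, Finset.mul_sum, smul_eq_mul]
  refine Finset.sum_congr rfl fun i _ => Finset.sum_congr rfl fun j _ => by ring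
lemma bf_neg_left : bf c (-ξ) η = - bf c ξ η := by
  simp [bf]
lemma bf_zero_right : bf c ξ 0 = 0 := by
  simp [bf]
lemma bf_zero_left : bf c 0 η = 0 := by
  simp [bf]
end bf

lemma dual_apply_eq {n : ℕ} (ξ : E n →L[ℝ] ℝ) (v : E n) : ξ v = ∑ i, v i * ξ (e i) := by
  have : v = ∑ i, v i • (e i : E n) := by
    ext j
    simp [e, PiLp.single_apply, Finset.sum_apply, Pi.single_apply]
  conv_lhs => rw [this]
  simp

lemma norm_sq_dual {n : ℕ} (ξ : E n →L[ℝ] ℝ) : ‖ξ‖ ^ 2 = ∑ i, (ξ (e i)) ^ 2 := by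
  have h1 : ‖(InnerProductSpace.toDual ℝ (E n)).symm ξ‖ = ‖ξ‖ := by simp
  rw [← h1, EuclideanSpace.norm_sq_eq]
  refine Finset.sum_congr rfl fun i _ => ?_
  have : ξ (e i) = (InnerProductSpace.toDual ℝ (E n)).symm ξ i := by
    have h2 := InnerProductSpace.toDual_symm_apply (𝕜 := ℝ) (x := e i) (y := ξ)
    rw [← h2, e, EuclideanSpace.inner_single_right]
    simp only [one_mul, conj_trivial]
  rw [this]; simp

/-- Uniform ellipticity on the unit ball. -/
structure Ell {n : ℕ} (Λ : ℝ) (a : E n → Matrix (Fin n) (Fin n) ℝ) : Prop where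
  cont : ∀ i j, Continuous fun x => a x i j
  lower : ∀ x ∈ ball (0 : E n) 1, ∀ ξ, ‖ξ‖ ^ 2 ≤ bf (a x) ξ ξ
  upper : ∀ x ∈ ball (0 : E n) 1, ∀ ξ η, |bf (a x) ξ η| ≤ Λ * ‖ξ‖ * ‖η‖

/-- weak subsolution on the unit ball -/
def WSub {n : ℕ} (a : E n → Matrix (Fin n) (Fin n) ℝ) (w : E n → ℝ) : Prop :=
  ∀ φ : E n → ℝ, ContDiff ℝ 1 φ → HasCompactSupport φ → tsupport φ ⊆ ball 0 1 →
    (∀ x, 0 ≤ φ x) → ∫ x, bf (a x) (fderiv ℝ w x) (fderiv ℝ φ x) ≤ 0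

lemma continuous_bf {n : ℕ} {X : Type*} [TopologicalSpace X] {a : X → Matrix (Fin n) (Fin n) ℝ}
    (ha : ∀ i j, Continuous fun x => a x i j) {f g : X → (E n →L[ℝ] ℝ)} (hf : Continuous f)
    (hg : Continuous g) : Continuous fun x => bf (a x) (f x) (g x) := by
  unfold bf
  refine continuous_finsetSum _ fun i _ => continuous_finsetSum _ fun j _ => ?_
  have := ha i j
  fun_prop

lemma integrable_bf {n : ℕ} {a : E n → Matrix (Fin n) (Fin n) ℝ}
    (ha : ∀ i j, Continuous fun x => a x i j) {w φ : E n → ℝ} (hw : ContDiff ℝ 1 w)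
    (hφ : ContDiff ℝ 1 φ) (hc : HasCompactSupport φ) :
    Integrable fun x => bf (a x) (fderiv ℝ w x) (fderiv ℝ φ x) := by
  refine (continuous_bf ha (hw.continuous_fderiv one_ne_zero) (hφ.continuous_fderiv one_ne_zero)).integrable_of_hasCompactSupport ?_
  refine (hc.fderiv ℝ).mono ?_
  intro x hx
  simp only [Function.mem_support] at hx ⊢
  contrapose! hx
  rw [hx, bf_zero_right]

/-- composition with convex increasing functions -/
lemma WSub.comp {n : ℕ} {Λ : ℝ} {a : E n → Matrix (Fin n) (Fin n) ℝ} (ha : Ell Λ a) {w : E n → ℝ}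
    (hw : ContDiff ℝ 1 w) (h : WSub a w) {ψ ψ' ψ'' : ℝ → ℝ}
    (h1 : ∀ x, HasDerivAt ψ (ψ' (w x)) (w x)) (h2 : ∀ x, HasDerivAt ψ' (ψ'' (w x)) (w x))
    (hc : Continuous fun x => ψ'' (w x)) (hp1 : ∀ x, 0 ≤ ψ' (w x)) (hp2 : ∀ x, 0 ≤ ψ'' (w x)) :
    WSub a (fun x => ψ (w x)) := by
  intro φ hφ hφc hφs hφ0
  have hwd : Differentiable ℝ w := hw.differentiable one_ne_zero
  have d1 : ∀ x, HasFDerivAt (fun x => ψ (w x)) (ψ' (w x) • fderiv ℝ w x) x := fun x =>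
    (h1 x).comp_hasFDerivAt x (hwd x).hasFDerivAt
  have d2 : ∀ x, HasFDerivAt (fun x => ψ' (w x)) (ψ'' (w x) • fderiv ℝ w x) x := fun x =>
    (h2 x).comp_hasFDerivAt x (hwd x).hasFDerivAt
  have c2 : ContDiff ℝ 1 (fun x => ψ' (w x)) := by
    rw [contDiff_one_iff_fderiv]
    refine ⟨fun x => (d2 x).differentiableAt, ?_⟩
    have : fderiv ℝ (fun x => ψ' (w x)) = fun x => ψ'' (w x) • fderiv ℝ w x := by
      ext1 x; exact (d2 x).fderiv
    rw [this]
    exact hc.smul (hw.continuous_fderiv one_ne_zero)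
  have key := h (fun x => φ x * ψ' (w x)) (hφ.mul c2) hφc.mul_right
    ((tsupport_mul_subset_left).trans hφs) (fun x => mul_nonneg (hφ0 x) (hp1 x))
  have e1 : ∀ x, bf (a x) (fderiv ℝ w x) (fderiv ℝ (fun x => φ x * ψ' (w x)) x)
      = bf (a x) (fderiv ℝ (fun x => ψ (w x)) x) (fderiv ℝ φ x)
        + φ x * ψ'' (w x) * bf (a x) (fderiv ℝ w x) (fderiv ℝ w x) := by
    intro x
    rw [((hφ.differentiable one_ne_zero x).hasFDerivAt.fun_mul (d2 x)).fderiv, (d1 x).fderiv]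
    simp only [bf_add_right, bf_smul_right, bf_smul_left]
    ring
  have c1 : ContDiff ℝ 1 (fun x => ψ (w x)) := by
    rw [contDiff_one_iff_fderiv]
    refine ⟨fun x => (d1 x).differentiableAt, ?_⟩
    have : fderiv ℝ (fun x => ψ (w x)) = fun x => ψ' (w x) • fderiv ℝ w x := by
      ext1 x; exact (d1 x).fderiv
    rw [this]
    exact c2.continuous.smul (hw.continuous_fderiv one_ne_zero)
  refine le_trans (integral_mono (integrable_bf ha.cont c1 hφ hφc)
    (integrable_bf ha.cont hw (hφ.mul c2) hφc.mul_right) fun x => ?_) key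
  simp only [e1]
  by_cases hx : x ∈ ball (0 : E n) 1
  · have := ha.lower x hx (fderiv ℝ w x)
    have h3 : 0 ≤ bf (a x) (fderiv ℝ w x) (fderiv ℝ w x) := (sq_nonneg _).trans this
    have := mul_nonneg (mul_nonneg (hφ0 x) (hp2 x)) h3
    linarith
  · have : φ x = 0 := image_eq_zero_of_notMem_tsupport fun h => hx (hφs h)
    simp [this]

end EK


namespace EK

lemma exists_deriv_bound_sT : ∃ K : ℝ, 0 < K ∧ ∀ t, |deriv Real.smoothTransition t| ≤ K := by
  have hc : Continuous (deriv Real.smoothTransition) :=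
    (Real.smoothTransition.contDiff (n := 1)).continuous_deriv le_rfl
  obtain ⟨K, hK⟩ := (isCompact_Icc (a := (0:ℝ)) (b := 1)).exists_bound_of_continuousOn
    (f := deriv Real.smoothTransition) hc.continuousOn
  refine ⟨max K 1, by positivity, fun t => ?_⟩
  by_cases ht : t ∈ Icc (0:ℝ) 1
  · exact (hK t ht).trans (le_max_left _ _)
  · have : deriv Real.smoothTransition t = 0 := by
      rw [mem_Icc, not_and_or, not_le, not_le] at ht
      rcases ht with ht | ht
      · have : Real.smoothTransition =ᶠ[𝓝 t] fun _ => 0 := by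
          filter_upwards [Iio_mem_nhds ht] with y hy
          exact Real.smoothTransition.zero_of_nonpos (le_of_lt hy)
        rw [this.deriv_eq]; simp
      · have : Real.smoothTransition =ᶠ[𝓝 t] fun _ => 1 := by
          filter_upwards [Ioi_mem_nhds ht] with y hy
          exact Real.smoothTransition.one_of_one_le (le_of_lt hy)
        rw [this.deriv_eq]; simp
    rw [this]; simp

/-- cutoff functions with gradient bound -/
lemma exists_cutoff (n : ℕ) : ∃ C₀ : ℝ, 0 < C₀ ∧ ∀ r' r : ℝ, 0 < r' → r' < r →
    ∃ η : E n → ℝ, ContDiff ℝ (⊤ : ℕ∞) η ∧ HasCompactSupport η ∧ tsupport η ⊆ ball 0 r ∧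
      (∀ x, 0 ≤ η x) ∧ (∀ x, η x ≤ 1) ∧ (∀ x ∈ closedBall (0 : E n) r', η x = 1) ∧
      ∀ x, ‖fderiv ℝ η x‖ ≤ C₀ / (r - r') := by
  obtain ⟨K, hK0, hK⟩ := exists_deriv_bound_sT
  refine ⟨4 * K, by positivity, fun r' r h0 hr => ?_⟩
  set s := (r + r') / 2 with hs
  have hs1 : r' < s := by simp only [hs]; linarith
  have hs2 : s < r := by simp only [hs]; linarith
  have hd : 0 < s ^ 2 - r' ^ 2 := by nlinarith
  set g : E n → ℝ := fun x => (s ^ 2 - ‖x‖ ^ 2) / (s ^ 2 - r' ^ 2) with hg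
  have hgc : ContDiff ℝ (⊤ : ℕ∞) g := by
    have : ContDiff ℝ (⊤ : ℕ∞) (fun x : E n => ‖x‖ ^ 2) := contDiff_norm_sq ℝ
    exact (contDiff_const.sub this).div_const _
  set η : E n → ℝ := fun x => Real.smoothTransition (g x) with hη
  have hηc : ContDiff ℝ (⊤ : ℕ∞) η := Real.smoothTransition.contDiff.comp hgc
  have hsupp : Function.support η ⊆ closedBall 0 s := by
    intro x hx
    rw [Function.mem_support] at hx
    by_contra hx2
    apply hx
    apply Real.smoothTransition.zero_of_nonpos
    rw [mem_closedBall_zero_iff, not_le] at hx2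
    apply div_nonpos_of_nonpos_of_nonneg _ hd.le
    nlinarith
  have hts : tsupport η ⊆ closedBall 0 s := closure_minimal hsupp isClosed_closedBall
  refine ⟨η, hηc, HasCompactSupport.of_support_subset_isCompact (isCompact_closedBall 0 s) hsupp,
    hts.trans (closedBall_subset_ball hs2), fun x => Real.smoothTransition.nonneg _,
    fun x => Real.smoothTransition.le_one _, ?_, ?_⟩
  · intro x hx
    apply Real.smoothTransition.one_of_one_le
    rw [mem_closedBall_zero_iff] at hx
    rw [hg]
    simp only
    rw [le_div_iff₀ hd]
    nlinarith [norm_nonneg x]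
  · intro x
    by_cases hx : x ∈ closedBall (0 : E n) s
    · have h1 : HasFDerivAt (fun x : E n => ‖x‖ ^ 2) (2 • (innerSL ℝ x)) x :=
        (hasStrictFDerivAt_norm_sq x).hasFDerivAt
      have h2 : HasFDerivAt g ((s ^ 2 - r' ^ 2)⁻¹ • (-(2 • (innerSL ℝ x)) : E n →L[ℝ] ℝ)) x := by
        have := (h1.const_sub (s ^ 2)).mul_const ((s ^ 2 - r' ^ 2)⁻¹)
        exact this
      have h3 : HasDerivAt Real.smoothTransition (deriv Real.smoothTransition (g x)) (g x) :=
        ((Real.smoothTransition.contDiff (n := 1)).differentiable one_ne_zero _).hasDerivAt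
      have h4 := h3.comp_hasFDerivAt x h2
      have h5 : fderiv ℝ η x = _ := h4.fderiv
      rw [h5, norm_smul, norm_smul, norm_neg, Real.norm_eq_abs, Real.norm_eq_abs,
        abs_of_pos (inv_pos.mpr hd)]
      have h6 : ‖(2 • (innerSL ℝ x) : E n →L[ℝ] ℝ)‖ ≤ 2 * s := by
        refine (norm_nsmul_le).trans ?_
        rw [innerSL_apply_norm]
        rw [mem_closedBall_zero_iff] at hx
        push_cast
        linarith
      have h7 : (s ^ 2 - r' ^ 2)⁻¹ * (2 * s) ≤ 4 / (r - r') := by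
        rw [inv_mul_eq_div, div_le_div_iff₀ hd (by linarith)]
        have : r - r' = 2 * (s - r') := by simp only [hs]; ring
        rw [this]
        nlinarith
      have h8 : (s ^ 2 - r' ^ 2)⁻¹ * ‖(2 • (innerSL ℝ x) : E n →L[ℝ] ℝ)‖ ≤ 4 / (r - r') :=
        le_trans (mul_le_mul_of_nonneg_left h6 (inv_pos.mpr hd).le) h7
      calc _ ≤ K * (4 / (r - r')) := by
            apply mul_le_mul (hK _) h8 (by positivity) hK0.le
        _ = _ := by ring
    · have : fderiv ℝ η x = 0 := by
        by_contra h
        exact hx (hts (support_fderiv_subset ℝ h))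
      rw [this, norm_zero]
      have : 0 < r - r' := by linarith
      positivity

/-- core of Caccioppoli -/
lemma cacc_aux {n : ℕ} {Λ : ℝ} {a : E n → Matrix (Fin n) (Fin n) ℝ} (ha : Ell Λ a)
    {ξ : E n → (E n →L[ℝ] ℝ)} {m η : E n → ℝ} (hξ : Continuous ξ) (hm : Continuous m)
    (hη : ContDiff ℝ 1 η) (hc : HasCompactSupport η) (hs : tsupport η ⊆ ball 0 1)
    (h : ∫ x, (η x ^ 2 * bf (a x) (ξ x) (ξ x) + 2 * η x * m x * bf (a x) (ξ x) (fderiv ℝ η x)) ≤ 0) :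
    ∫ x, η x ^ 2 * ‖ξ x‖ ^ 2 ≤ 4 * Λ ^ 2 * ∫ x, m x ^ 2 * ‖fderiv ℝ η x‖ ^ 2 := by
  have hηc := hη.continuous
  have hηd := hη.continuous_fderiv one_ne_zero
  have hcd := hc.fderiv ℝ
  have i1 : Integrable fun x => η x ^ 2 * ‖ξ x‖ ^ 2 := by
    refine Continuous.integrable_of_hasCompactSupport (by fun_prop) ?_
    exact hc.mono (by intro x hx; simp only [Function.mem_support] at hx ⊢; contrapose! hx; simp [hx])
  have i2 : Integrable fun x => m x ^ 2 * ‖fderiv ℝ η x‖ ^ 2 := by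
    refine Continuous.integrable_of_hasCompactSupport (by fun_prop) ?_
    exact hcd.mono (by intro x hx; simp only [Function.mem_support] at hx ⊢; contrapose! hx; simp [hx])
  have i3 : Integrable fun x => (η x ^ 2 * bf (a x) (ξ x) (ξ x) + 2 * η x * m x * bf (a x) (ξ x) (fderiv ℝ η x)) := by
    have c1 := continuous_bf ha.cont hξ hξ
    have c2 := continuous_bf ha.cont hξ hηd
    refine Continuous.integrable_of_hasCompactSupport (by fun_prop) ?_
    exact hc.mono (by intro x hx; simp only [Function.mem_support] at hx ⊢; contrapose! hx; simp [hx])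
  have key : ∫ x, ((1/2) * (η x ^ 2 * ‖ξ x‖ ^ 2) - 2 * Λ ^ 2 * (m x ^ 2 * ‖fderiv ℝ η x‖ ^ 2)) ≤ 0 := by
    refine le_trans (integral_mono ((i1.const_mul _).sub (i2.const_mul _)) i3 fun x => ?_) h
    by_cases hx : x ∈ ball (0 : E n) 1
    · have h1 := ha.lower x hx (ξ x)
      have h2 := ha.upper x hx (ξ x) (fderiv ℝ η x)
      set p := ‖ξ x‖
      set q := ‖fderiv ℝ η x‖
      have h3 : -(2 * |η x| * |m x| * (Λ * p * q)) ≤ 2 * η x * m x * bf (a x) (ξ x) (fderiv ℝ η x) := by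
        have : |2 * η x * m x * bf (a x) (ξ x) (fderiv ℝ η x)| ≤ 2 * |η x| * |m x| * (Λ * p * q) := by
          rw [abs_mul, abs_mul, abs_mul, abs_two]
          exact mul_le_mul_of_nonneg_left h2 (by positivity)
        exact (abs_le.mp this).1
      have h4 : η x ^ 2 * p ^ 2 ≤ η x ^ 2 * bf (a x) (ξ x) (ξ x) :=
        mul_le_mul_of_nonneg_left h1 (sq_nonneg _)
      have h5 := sq_nonneg (|η x| * p - 2 * Λ * |m x| * q)
      have h6 : (|η x| * p - 2 * Λ * |m x| * q) ^ 2 = η x ^ 2 * p ^ 2 - 4 * Λ * |η x| * p * |m x| * q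
         + 4 * Λ ^ 2 * (m x ^ 2 * q ^ 2) := by
        rw [← sq_abs (η x), ← sq_abs (m x)]; ring
      nlinarith
    · have h1 : η x = 0 := image_eq_zero_of_notMem_tsupport fun h => hx (hs h)
      have h2 : fderiv ℝ η x = 0 := by
        by_contra h
        exact hx (hs (support_fderiv_subset ℝ h))
      simp [h1, h2]
  rw [integral_sub (i1.const_mul _) (i2.const_mul _), integral_const_mul, integral_const_mul] at key
  linarith

lemma hasFDerivAt_sq {n : ℕ} {η : E n → ℝ} {x : E n} (h : DifferentiableAt ℝ η x) :
    HasFDerivAt (fun x => η x ^ 2) ((2 * η x) • fderiv ℝ η x) x := by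
  have := (hasDerivAt_pow 2 (η x)).comp_hasFDerivAt x h.hasFDerivAt
  have h2 : ((2:ℕ):ℝ) * η x ^ (2-1) = 2 * η x := by norm_num
  rw [h2] at this
  exact this

lemma caccioppoli {n : ℕ} {Λ : ℝ} {a : E n → Matrix (Fin n) (Fin n) ℝ} (ha : Ell Λ a)
    {w η : E n → ℝ} (hw : ContDiff ℝ 1 w)
    (hη : ContDiff ℝ 1 η) (hc : HasCompactSupport η) (hs : tsupport η ⊆ ball 0 1)
    (h : ∫ x, bf (a x) (fderiv ℝ w x) (fderiv ℝ (fun x => η x ^ 2 * w x) x) ≤ 0) :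
    ∫ x, η x ^ 2 * ‖fderiv ℝ w x‖ ^ 2 ≤ 4 * Λ ^ 2 * ∫ x, w x ^ 2 * ‖fderiv ℝ η x‖ ^ 2 := by
  refine cacc_aux ha (hw.continuous_fderiv one_ne_zero) hw.continuous hη hc hs (le_of_eq_of_le ?_ h)
  congr 1; ext1 x
  have h1 := (hasFDerivAt_sq (hη.differentiable one_ne_zero x)).fun_mul
    (hw.differentiable one_ne_zero x).hasFDerivAt
  rw [h1.fderiv]
  simp only [bf_add_right, bf_smul_right]
  ring

lemma WSub.caccioppoli {n : ℕ} {Λ : ℝ} {a : E n → Matrix (Fin n) (Fin n) ℝ} (ha : Ell Λ a)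
    {w η : E n → ℝ} (hw : ContDiff ℝ 1 w) (hw0 : ∀ x, 0 ≤ w x) (h : WSub a w)
    (hη : ContDiff ℝ 1 η) (hc : HasCompactSupport η) (hs : tsupport η ⊆ ball 0 1) :
    ∫ x, η x ^ 2 * ‖fderiv ℝ w x‖ ^ 2 ≤ 4 * Λ ^ 2 * ∫ x, w x ^ 2 * ‖fderiv ℝ η x‖ ^ 2 := by
  have hsub : Function.support (fun x => η x ^ 2 * w x) ⊆ Function.support η := by
    intro x hx; simp only [Function.mem_support] at hx ⊢; contrapose! hx; simp [hx]
  refine EK.caccioppoli ha hw hη hc hs (h _ ((hη.pow 2).mul hw) (hc.mono hsub)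
    ((closure_mono hsub).trans hs) fun x => mul_nonneg (sq_nonneg _) (hw0 x))

lemma WSub.log_caccioppoli {n : ℕ} {Λ : ℝ} {a : E n → Matrix (Fin n) (Fin n) ℝ} (ha : Ell Λ a)
    {v η : E n → ℝ} (hv : ContDiff ℝ 1 v) (hv0 : ∀ x, 0 < v x) (h : WSub a (fun x => - v x))
    (hη : ContDiff ℝ 1 η) (hc : HasCompactSupport η) (hs : tsupport η ⊆ ball 0 1) :
    ∫ x, η x ^ 2 * ‖fderiv ℝ (fun x => - Real.log (v x)) x‖ ^ 2
      ≤ 4 * Λ ^ 2 * ∫ x, ‖fderiv ℝ η x‖ ^ 2 := by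
  have hsub : Function.support (fun x => η x ^ 2 * (v x)⁻¹) ⊆ Function.support η := by
    intro x hx; simp only [Function.mem_support] at hx ⊢; contrapose! hx; simp [hx]
  have hl : ContDiff ℝ 1 (fun x => - Real.log (v x)) := (hv.log fun x => (hv0 x).ne').neg
  have key := cacc_aux (m := fun _ => 1) ha (hl.continuous_fderiv one_ne_zero) continuous_const hη hc hs
    (le_of_eq_of_le ?_ (h (fun x => η x ^ 2 * (v x)⁻¹) ((hη.pow 2).mul (hv.inv fun x => (hv0 x).ne'))
    (hc.mono hsub)
    ((closure_mono hsub).trans hs) fun x => mul_nonneg (sq_nonneg _) (inv_nonneg.mpr (hv0 x).le)))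
  · simpa using key
  · congr 1; ext1 x
    have hvd := (hv.differentiable one_ne_zero x).hasFDerivAt
    have h0 := (hv0 x).ne'
    have h2 : HasFDerivAt (fun x => (v x)⁻¹) ((-(v x ^ 2)⁻¹) • fderiv ℝ v x) x :=
      (hasDerivAt_inv h0).comp_hasFDerivAt x hvd
    have h1 := (hasFDerivAt_sq (hη.differentiable one_ne_zero x)).fun_mul h2
    have h3 := (hvd.log h0).neg
    have h3' : fderiv ℝ (fun x => - Real.log (v x)) x = _ := h3.fderiv
    have h4 := hvd.neg
    have h4' : fderiv ℝ (fun x => - v x) x = _ := h4.fderiv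
    rw [h1.fderiv, h3', h4']
    simp only [bf_add_right, bf_smul_right, bf_neg_left, bf_smul_left, ← smul_neg]
    have : bf (a x) (fderiv ℝ v x) (-fderiv ℝ v x) = - bf (a x) (fderiv ℝ v x) (fderiv ℝ v x) := by
      rw [← neg_one_smul ℝ, bf_smul_right]; ring
    rw [this]
    field_simp

end EK


namespace EK

/-- Gagliardo-Nirenberg-Sobolev, real version -/
lemma gns (n : ℕ) (hn : 2 ≤ n) : ∃ C : ℝ, 1 ≤ C ∧ ∀ f : E n → ℝ, ContDiff ℝ 1 f → HasCompactSupport f →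
    (∀ x, 0 ≤ f x) → ∫ x, f x ^ ((n:ℝ) / (n - 1)) ≤ C * (∫ x, ‖fderiv ℝ f x‖) ^ ((n:ℝ) / (n - 1)) := by
  have hn1 : (1:ℝ) < n := by exact_mod_cast hn
  set p : ℝ := (n:ℝ) / (n - 1) with hp
  have hp0 : 0 < p := by rw [hp]; apply div_pos <;> linarith
  have hpc : Real.HolderConjugate (Module.finrank ℝ (E n)) p := by
    rw [finrank_euclideanSpace_fin]
    exact Real.HolderConjugate.conjExponent hn1
  set K := lintegralPowLePowLIntegralFDerivConst (volume : Measure (E n)) p with hK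
  refine ⟨max K 1, le_max_right _ _, fun f hf hfc hf0 => ?_⟩
  have h := lintegral_pow_le_pow_lintegral_fderiv (volume : Measure (E n)) hf hfc hpc
  have i1 : Integrable fun x => ‖fderiv ℝ f x‖ :=
    ((hf.continuous_fderiv one_ne_zero).norm).integrable_of_hasCompactSupport (hfc.fderiv ℝ).norm
  have e1 : ∫⁻ x, ‖fderiv ℝ f x‖ₑ = ENNReal.ofReal (∫ x, ‖fderiv ℝ f x‖) := by
    rw [ofReal_integral_eq_lintegral_ofReal i1 (Eventually.of_forall fun x => norm_nonneg _)]
    simp only [ofReal_norm]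
  have e2 : ∫ x, f x ^ p = (∫⁻ x, ‖f x‖ₑ ^ p).toReal := by
    rw [integral_eq_lintegral_of_nonneg_ae (Eventually.of_forall fun x => Real.rpow_nonneg (hf0 x) _)]
    · congr 1
      refine lintegral_congr fun x => ?_
      rw [← ENNReal.ofReal_rpow_of_nonneg (hf0 x) hp0.le, Real.enorm_of_nonneg (hf0 x)]
    · exact (hf.continuous.rpow_const fun x => Or.inr hp0.le).aestronglyMeasurable
  rw [e2]
  rw [e1, ENNReal.ofReal_rpow_of_nonneg (integral_nonneg fun x => norm_nonneg _) hp0.le] at h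
  have h2 := ENNReal.toReal_mono (by finiteness) h
  rw [ENNReal.toReal_mul, ENNReal.toReal_ofReal (by positivity), ENNReal.coe_toReal] at h2
  refine h2.trans ?_
  gcongr
  exact le_max_left _ _

/-- One step of Moser iteration -/
lemma moser_step (n : ℕ) (hn : 2 ≤ n) (Λ : ℝ) : ∃ C : ℝ, 1 ≤ C ∧ ∀ a : E n → Matrix (Fin n) (Fin n) ℝ,
    Ell Λ a → ∀ z : E n → ℝ, ContDiff ℝ 1 z → (∀ x, 0 ≤ z x) → WSub a z → ∀ r' r : ℝ, 0 < r' → r' < r →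
    r ≤ 1 → ∫ x in ball 0 r', (z x ^ 2) ^ ((n:ℝ) / (n - 1)) ≤
      (C / (r - r') * ∫ x in ball 0 r, z x ^ 2) ^ ((n:ℝ) / (n - 1)) := by
  obtain ⟨G, hG1, hG⟩ := gns n hn
  obtain ⟨C₀, hC0, hcut⟩ := exists_cutoff n
  have hn1 : (1:ℝ) < n := by exact_mod_cast hn
  set p : ℝ := (n:ℝ) / (n - 1) with hp
  have hp1 : 1 ≤ p := by rw [hp, le_div_iff₀ (by linarith)]; linarith
  have hp0 : 0 < p := by linarith
  refine ⟨max 1 (G * ((3 + 4 * Λ ^ 2) * C₀)), le_max_left _ _, fun a ha z hz hz0 hsub r' r h0 hr h1 => ?_⟩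
  obtain ⟨η, hη, hηc, hηs, hη0, hη1, hηeq, hηd⟩ := hcut r' r h0 hr
  have hη' : ContDiff ℝ 1 η := hη.of_le (by exact_mod_cast le_top)
  set D := C₀ / (r - r') with hD
  have hD0 : 0 < D := div_pos hC0 (by linarith)
  set I := ∫ x in ball 0 r, z x ^ 2 with hI
  have hzc := hz.continuous
  have hηcc := hη'.continuous
  have hzd := hz.continuous_fderiv one_ne_zero
  have hηdc := hη'.continuous_fderiv one_ne_zero
  have iI : IntegrableOn (fun x => z x ^ 2) (ball 0 r) :=
    ((hzc.pow 2).continuousOn.integrableOn_compact (isCompact_closedBall (0:E n) r)).mono_set ball_subset_closedBall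
  have hcacc := hsub.caccioppoli ha hz hz0 hη' hηc (hηs.trans (ball_subset_ball h1))
  have i2 : Integrable fun x => z x ^ 2 * ‖fderiv ℝ η x‖ ^ 2 := by
    refine Continuous.integrable_of_hasCompactSupport (by fun_prop) ?_
    exact (hηc.fderiv ℝ).mono (by intro x hx; simp only [Function.mem_support] at hx ⊢; contrapose! hx; simp [hx])
  have hsuppd : ∀ x, x ∉ ball (0 : E n) r → fderiv ℝ η x = 0 := fun x hx => by
    by_contra h
    exact hx (hηs (support_fderiv_subset ℝ h))
  have hsupp : ∀ x, x ∉ ball (0 : E n) r → η x = 0 := fun x hx =>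
    image_eq_zero_of_notMem_tsupport fun h => hx (hηs h)
  have b2 : ∫ x, z x ^ 2 * ‖fderiv ℝ η x‖ ^ 2 ≤ D ^ 2 * I := by
    rw [hI, ← integral_indicator measurableSet_ball, ← integral_const_mul]
    refine integral_mono i2 ((iI.integrable_indicator measurableSet_ball).const_mul _) fun x => ?_
    by_cases hx : x ∈ ball (0 : E n) r
    · simp only [indicator_of_mem hx]
      rw [mul_comm]
      gcongr
      exact hηd x
    · simp [indicator_of_notMem hx, hsuppd x hx]
  have i1 : Integrable fun x => η x ^ 2 * ‖fderiv ℝ z x‖ ^ 2 := by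
    refine Continuous.integrable_of_hasCompactSupport (by fun_prop) ?_
    exact hηc.mono (by intro x hx; simp only [Function.mem_support] at hx ⊢; contrapose! hx; simp [hx])
  set f : E n → ℝ := fun x => η x ^ 2 * z x ^ 2 with hf
  have hfc : ContDiff ℝ 1 f := (hη'.pow 2).mul (hz.pow 2)
  have hfs : HasCompactSupport f :=
    hηc.mono (by intro x hx; simp only [Function.mem_support, hf] at hx ⊢; contrapose! hx; simp [hx])
  have hgns := hG f hfc hfs fun x => by positivity
  have b3 : ∫ x, ‖fderiv ℝ f x‖ ≤ (3 + 4 * Λ ^ 2) * D * I := by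
    have : ∫ x, ‖fderiv ℝ f x‖ ≤ ∫ x, (3 * D * indicator (ball 0 r) (fun x => z x ^ 2) x + D⁻¹ * (η x ^ 2 * ‖fderiv ℝ z x‖ ^ 2)) := by
      refine integral_mono ((hfc.continuous_fderiv one_ne_zero).norm.integrable_of_hasCompactSupport (hfs.fderiv ℝ).norm)
        (((iI.integrable_indicator measurableSet_ball).const_mul _).add (i1.const_mul _)) fun x => ?_
      have hfd := (hasFDerivAt_sq (hη'.differentiable one_ne_zero x)).fun_mul
        (hasFDerivAt_sq (hz.differentiable one_ne_zero x))
      simp only [hf]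
      rw [hfd.fderiv]
      by_cases hx : x ∈ ball (0 : E n) r
      · simp only [indicator_of_mem hx]
        refine (norm_add_le _ _).trans ?_
        simp only [smul_smul, norm_smul, Real.norm_eq_abs]
        have hη0x := hη0 x
        have hη1x := hη1 x
        have hz0x := hz0 x
        rw [abs_of_nonneg (by positivity), abs_of_nonneg (by positivity)]
        have t1 : z x ^ 2 * (2 * η x) * ‖fderiv ℝ η x‖ ≤ 2 * D * z x ^ 2 := by
          calc _ ≤ z x ^ 2 * (2 * 1) * D := by gcongr; exact hηd x
            _ = _ := by ring
        have t2 : η x ^ 2 * (2 * z x) * ‖fderiv ℝ z x‖ ≤ D * z x ^ 2 + D⁻¹ * (η x ^ 2 * ‖fderiv ℝ z x‖ ^ 2) := by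
          set q := ‖fderiv ℝ z x‖
          have hq : 0 ≤ q := norm_nonneg _
          have s1 : η x ^ 2 * (2 * z x) * q ≤ 2 * (z x) * (η x * q) := by
            have : η x ^ 2 ≤ η x := by nlinarith
            nlinarith [mul_nonneg hz0x hq]
          refine s1.trans ?_
          have s2 : 0 ≤ D⁻¹ * (D * z x - η x * q) ^ 2 := by positivity
          have s3 : D⁻¹ * (D * z x - η x * q) ^ 2 = D * z x ^ 2 - 2 * z x * (η x * q) + D⁻¹ * (η x ^ 2 * q ^ 2) := by
            field_simp
            ring
          linarith
        linarith
      · simp [indicator_of_notMem hx, hsupp x hx]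
    rw [integral_add ((iI.integrable_indicator measurableSet_ball).const_mul _) (i1.const_mul _),
      integral_const_mul, integral_const_mul, integral_indicator measurableSet_ball, ← hI] at this
    have b4 : D⁻¹ * ∫ x, η x ^ 2 * ‖fderiv ℝ z x‖ ^ 2 ≤ 4 * Λ ^ 2 * D * I := by
      calc _ ≤ D⁻¹ * (4 * Λ ^ 2 * (D ^ 2 * I)) := by
            gcongr
            exact hcacc.trans (mul_le_mul_of_nonneg_left b2 (by positivity))
        _ = _ := by field_simp
    linarith
  have hI0 : 0 ≤ I := integral_nonneg fun x => sq_nonneg _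
  have ifp : Integrable fun x => f x ^ p := by
    refine Continuous.integrable_of_hasCompactSupport (hfc.continuous.rpow_const fun x => Or.inr hp0.le) ?_
    exact hfs.mono (by intro x hx; simp only [Function.mem_support] at hx ⊢; contrapose! hx; simp [hx, hp0.ne'])
  calc ∫ x in ball 0 r', (z x ^ 2) ^ p = ∫ x in ball 0 r', f x ^ p := by
        refine setIntegral_congr_fun measurableSet_ball fun x hx => ?_
        simp [hf, hηeq x (ball_subset_closedBall hx)]
    _ ≤ ∫ x, f x ^ p := setIntegral_le_integral ifp (Eventually.of_forall fun x => by
        simp only [Pi.zero_apply]; positivity)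
    _ ≤ G * (∫ x, ‖fderiv ℝ f x‖) ^ p := hgns
    _ ≤ G ^ p * (∫ x, ‖fderiv ℝ f x‖) ^ p := by
        gcongr
        exact Real.self_le_rpow_of_one_le hG1 hp1
    _ = (G * (∫ x, ‖fderiv ℝ f x‖)) ^ p := by
        rw [Real.mul_rpow (by linarith) (by positivity)]
    _ ≤ _ := by
        apply Real.rpow_le_rpow (by positivity) _ hp0.le
        calc _ ≤ G * ((3 + 4 * Λ ^ 2) * D * I) := by gcongr
          _ = (G * ((3 + 4 * Λ ^ 2) * C₀)) / (r - r') * I := by rw [hD]; ring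
          _ ≤ _ := by
            have : 0 < r - r' := by linarith
            gcongr
            exact le_max_right _ _

end EK


namespace EK

lemma WSub.rpow {n : ℕ} {Λ : ℝ} {a : E n → Matrix (Fin n) (Fin n) ℝ} (ha : Ell Λ a) {w : E n → ℝ}
    (hw : ContDiff ℝ 1 w) (hw0 : ∀ x, 0 < w x) (h : WSub a w) {q : ℝ} (hq : 1 ≤ q) :
    WSub a (fun x => w x ^ q) := by
  refine h.comp ha hw (ψ := fun s => s ^ q) (ψ' := fun s => q * s ^ (q - 1))
    (ψ'' := fun s => q * ((q - 1) * s ^ (q - 1 - 1))) ?_ ?_ ?_ ?_ ?_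
  · intro x; exact Real.hasDerivAt_rpow_const (Or.inl (hw0 x).ne')
  · intro x; exact (Real.hasDerivAt_rpow_const (Or.inl (hw0 x).ne')).const_mul q
  · exact continuous_const.mul (continuous_const.mul (hw.continuous.rpow_const fun x => Or.inl (hw0 x).ne'))
  · intro x; have := hw0 x; positivity
  · intro x; have := hw0 x; have : 0 ≤ q - 1 := by linarith
    positivity

/-- Local boundedness of positive subsolutions -/
lemma moser (n : ℕ) (hn : 2 ≤ n) (Λ : ℝ) : ∃ C : ℝ, 0 < C ∧ ∀ a : E n → Matrix (Fin n) (Fin n) ℝ,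
    Ell Λ a → ∀ w : E n → ℝ, ContDiff ℝ 1 w → (∀ x, 0 < w x) → WSub a w →
    ∀ x ∈ ball (0 : E n) (1/4), w x ≤ C * (∫ x in ball 0 (1/2), w x ^ 2) ^ (1/2 : ℝ) := by
  obtain ⟨C, hC1, hstep⟩ := moser_step n hn Λ
  have hn1 : (1:ℝ) < n := by exact_mod_cast hn
  set χ : ℝ := (n:ℝ) / (n - 1) with hχ
  have hχ1 : 1 < χ := by rw [hχ, lt_div_iff₀ (by linarith)]; linarith
  have hχ0 : 0 < χ := by linarith
  set p : ℕ → ℝ := fun k => 2 * χ ^ k with hp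
  have hp0 : ∀ k, 0 < p k := fun k => by positivity
  set r : ℕ → ℝ := fun k => 1/4 + (1/2) ^ k / 4 with hr
  have hr0 : ∀ k, 0 < r k := fun k => by positivity
  have hr1 : ∀ k, r k ≤ 1 := fun k => by
    have : (1/2 : ℝ) ^ k ≤ 1 := pow_le_one₀ (by norm_num) (by norm_num)
    simp only [hr]; linarith
  have hrd : ∀ k, r k - r (k+1) = (1/2) ^ k / 8 := fun k => by simp only [hr, pow_succ]; ring
  set c : ℕ → ℝ := fun k => Real.log (C * 8 * 2 ^ k) / p k with hc
  have hc0 : ∀ k, 0 ≤ c k := fun k => by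
    apply div_nonneg _ (hp0 k).le
    apply Real.log_nonneg
    have : (1:ℝ) ≤ 2 ^ k := one_le_pow₀ (by norm_num)
    nlinarith
  have hcs : Summable c := by
    have hx : ‖χ⁻¹‖ < 1 := by
      rw [Real.norm_eq_abs, abs_of_pos (by positivity)]; exact inv_lt_one_of_one_lt₀ hχ1
    have h1 : Summable fun k : ℕ => (χ⁻¹) ^ k := summable_geometric_of_norm_lt_one hx
    have h2 := summable_pow_mul_geometric_of_norm_lt_one 1 hx
    have h3 := (h1.mul_left (Real.log (C * 8) / 2)).add (h2.mul_left (Real.log 2 / 2))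
    refine h3.congr fun k => ?_
    simp only [hc, hp]
    rw [Real.log_mul (x := C * 8) (y := 2 ^ k) (by positivity) (by positivity), Real.log_pow]
    rw [inv_pow]
    field_simp
  set S := ∑' k, c k with hS
  refine ⟨Real.exp S, Real.exp_pos _, fun a ha w hw hw0 hsub => ?_⟩
  set I : ℕ → ℝ := fun k => ∫ x in ball 0 (r k), w x ^ (p k) with hI
  have hI0 : ∀ k, 0 ≤ I k := fun k => integral_nonneg fun x => Real.rpow_nonneg (hw0 x).le _
  have hIs : ∀ k, I (k+1) ≤ (C * 8 * 2 ^ k * I k) ^ χ := fun k => by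
    have hq : 1 ≤ χ ^ k := one_le_pow₀ hχ1.le
    have hz : ContDiff ℝ 1 (fun x => w x ^ (χ ^ k)) := hw.rpow_const_of_ne fun x => (hw0 x).ne'
    have h := hstep a ha (fun x => w x ^ (χ ^ k)) hz (fun x => Real.rpow_nonneg (hw0 x).le _)
      (hsub.rpow ha hw hw0 hq) (r (k+1)) (r k) (hr0 _) (by
        have := hrd k
        have : (0:ℝ) < (1/2) ^ k / 8 := by positivity
        linarith) (hr1 k)
    have e1 : ∀ x, ((w x ^ (χ ^ k)) ^ 2) = w x ^ (p k) := fun x => by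
      rw [← Real.rpow_natCast, ← Real.rpow_mul (hw0 x).le]; congr 1; simp only [hp]; push_cast; ring
    have e2 : ∀ x, (w x ^ (p k)) ^ χ = w x ^ (p (k+1)) := fun x => by
      rw [← Real.rpow_mul (hw0 x).le]; congr 1; simp only [hp, pow_succ]; ring
    simp only [e1, e2] at h
    refine h.trans (le_of_eq ?_)
    congr 2
    rw [hrd k]
    rw [one_div, inv_pow]
    field_simp
  set N : ℕ → ℝ := fun k => I k ^ (1 / p k) with hN
  have hNs : ∀ k, N (k+1) ≤ Real.exp (c k) * N k := fun k => by
    have h2 : (0:ℝ) < C * 8 * 2 ^ k := by positivity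
    have h1 : N (k+1) ≤ ((C * 8 * 2 ^ k * I k) ^ χ) ^ (1 / p (k+1)) :=
      Real.rpow_le_rpow (hI0 _) (hIs k) (by have := hp0 (k+1); positivity)
    refine h1.trans (le_of_eq ?_)
    have hpk := hp0 k
    rw [← Real.rpow_mul (mul_nonneg h2.le (hI0 k)), Real.mul_rpow h2.le (hI0 k)]
    have : χ * (1 / p (k+1)) = 1 / p k := by simp only [hp, pow_succ]; field_simp
    rw [this]
    congr 1
    rw [Real.rpow_def_of_pos h2]
    congr 1
    simp only [hc]; ring
  have hNk : ∀ k, N k ≤ Real.exp (∑ j ∈ Finset.range k, c j) * N 0 := fun k => by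
    induction k with
    | zero => simp
    | succ k ih =>
      rw [Finset.sum_range_succ, Real.exp_add]
      calc _ ≤ Real.exp (c k) * N k := hNs k
        _ ≤ Real.exp (c k) * (Real.exp (∑ j ∈ Finset.range k, c j) * N 0) := by gcongr
        _ = _ := by ring
  have hN0 : 0 ≤ N 0 := Real.rpow_nonneg (hI0 0) _
  have hNb : ∀ k, N k ≤ Real.exp S * N 0 := fun k => by
    refine (hNk k).trans ?_
    gcongr
    exact hcs.sum_le_tsum _ fun j _ => hc0 j
  have hN0e : N 0 = (∫ x in ball 0 (1/2), w x ^ 2) ^ (1/2 : ℝ) := by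
    simp only [hN, hI, hp, hr]
    norm_num
  rw [← hN0e]
  intro x hx
  by_contra hcon
  push Not at hcon
  obtain ⟨s, hs1, hs2⟩ := exists_between hcon
  have hs0 : 0 < s := lt_of_le_of_lt (by positivity) hs1
  have hopen : IsOpen ({y | s < w y} ∩ ball (0 : E n) (1/4)) :=
    (isOpen_lt continuous_const hw.continuous).inter isOpen_ball
  obtain ⟨δ, hδ, hball⟩ := Metric.isOpen_iff.mp hopen x ⟨hs2, hx⟩
  set m := (volume (ball x δ)).toReal with hm
  have hm0 : 0 < m := ENNReal.toReal_pos (measure_ball_pos _ _ hδ).ne' measure_ball_lt_top.ne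
  have hlow : ∀ k, s * m ^ (1 / p k) ≤ N k := fun k => by
    have iI : IntegrableOn (fun x => w x ^ (p k)) (ball 0 (r k)) :=
      ((hw.continuous.rpow_const fun x => Or.inl (hw0 x).ne').continuousOn.integrableOn_compact (isCompact_closedBall (0:E n) (r k))).mono_set ball_subset_closedBall
    have hsubset : ball x δ ⊆ ball 0 (r k) := fun y hy =>
      ball_subset_ball (by simp only [hr]; have : (0:ℝ) < (1/2) ^ k / 4 := by positivity
                           linarith) (hball hy).2
    have h1 : s ^ (p k) * m ≤ I k := by
      calc s ^ (p k) * m = ∫ y in ball x δ, s ^ (p k) := by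
            rw [setIntegral_const, smul_eq_mul, mul_comm]; rfl
        _ ≤ ∫ y in ball x δ, w y ^ (p k) := by
            refine setIntegral_mono_on (integrableOn_const measure_ball_lt_top.ne) (iI.mono_set hsubset)
              measurableSet_ball fun y hy => ?_
            exact Real.rpow_le_rpow hs0.le (hball hy).1.le (hp0 k).le
        _ ≤ I k := setIntegral_mono_set iI (Eventually.of_forall fun y => Real.rpow_nonneg (hw0 y).le _)
            hsubset.eventuallyLE
    have hpk := hp0 k
    have h2 := Real.rpow_le_rpow (by positivity) h1 (z := 1 / p k) (by positivity)
    rw [Real.mul_rpow (by positivity) hm0.le, ← Real.rpow_mul hs0.le, mul_one_div_cancel hpk.ne', Real.rpow_one] at h2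
    exact h2
  have hlim : Tendsto (fun k => s * m ^ (1 / p k)) atTop (𝓝 (s * m ^ (0:ℝ))) := by
    have hpt : Tendsto p atTop atTop := (tendsto_pow_atTop_atTop_of_one_lt hχ1).const_mul_atTop (by norm_num)
    have h1 : Tendsto (fun k => 1 / p k) atTop (𝓝 0) := by
      simp only [one_div]; exact tendsto_inv_atTop_zero.comp hpt
    exact (tendsto_const_nhds.rpow h1 (Or.inl hm0.ne')).const_mul s
  rw [Real.rpow_zero, mul_one] at hlim
  have := le_of_tendsto hlim (Eventually.of_forall fun k => (hlow k).trans (hNb k))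
  linarith

end EK


namespace EK

lemma sq_interval_le {φ : ℝ → ℝ} (hφ : Continuous φ) :
    (∫ t in (0:ℝ)..1, φ t) ^ 2 ≤ ∫ t in (0:ℝ)..1, φ t ^ 2 := by
  set m := ∫ t in (0:ℝ)..1, φ t with hm
  have h0 : 0 ≤ ∫ t in (0:ℝ)..1, (φ t - m) ^ 2 :=
    intervalIntegral.integral_nonneg (by norm_num) fun t _ => sq_nonneg _
  have h1 : ∫ t in (0:ℝ)..1, (φ t - m) ^ 2 = (∫ t in (0:ℝ)..1, φ t ^ 2) - 2 * m * m + m ^ 2 := by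
    have : ∀ t, (φ t - m) ^ 2 = φ t ^ 2 - (2 * m) * φ t + m ^ 2 := fun t => by ring
    simp only [this]
    rw [intervalIntegral.integral_add, intervalIntegral.integral_sub, intervalIntegral.integral_const_mul,
      intervalIntegral.integral_const, ← hm]
    · simp
    all_goals exact Continuous.intervalIntegrable (by fun_prop) _ _
  nlinarith

lemma segment_sq_le {n : ℕ} {f : E n → ℝ} (hf : ContDiff ℝ 1 f) (x y : E n) :
    (f x - f y) ^ 2 ≤ ‖x - y‖ ^ 2 * ∫ t in (0:ℝ)..1, ‖fderiv ℝ f (y + t • (x - y))‖ ^ 2 := by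
  have hfc := hf.continuous_fderiv one_ne_zero
  have hd : ∀ t : ℝ, HasDerivAt (fun t : ℝ => f (y + t • (x - y))) (fderiv ℝ f (y + t • (x - y)) (x - y)) t := by
    intro t
    have h1 : HasDerivAt (fun t : ℝ => y + t • (x - y)) (x - y) t := by
      simpa using ((hasDerivAt_id t).smul_const (x - y)).const_add y
    exact (hf.differentiable one_ne_zero _).hasFDerivAt.comp_hasDerivAt t h1
  have hc : Continuous fun t : ℝ => fderiv ℝ f (y + t • (x - y)) (x - y) := by fun_prop
  have h := intervalIntegral.integral_eq_sub_of_hasDerivAt (a := 0) (b := 1) (fun t _ => hd t) (hc.intervalIntegrable _ _)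
  have h2 : f x - f y = ∫ t in (0:ℝ)..1, fderiv ℝ f (y + t • (x - y)) (x - y) := by rw [h]; simp
  rw [h2]
  refine (sq_interval_le hc).trans ?_
  rw [← intervalIntegral.integral_const_mul]
  refine intervalIntegral.integral_mono_on (by norm_num) (Continuous.intervalIntegrable (by fun_prop) _ _)
    (Continuous.intervalIntegrable (by fun_prop) _ _) fun t _ => ?_
  rw [← mul_pow, mul_comm, ← sq_abs]
  gcongr
  exact (fderiv ℝ f _).le_opNorm _

lemma lintegral_affine {n : ℕ} (g : E n → ENNReal) {s : ℝ} (hs : 1/2 ≤ s) (z : E n) :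
    ∫⁻ x, g (s • x + z) ≤ 2 ^ n * ∫⁻ x, g x := by
  have hs0 : s ≠ 0 := by linarith
  set G : E n → ENNReal := fun x => g (x + z)
  have h1 : ∫⁻ x, G (s • x) = ∫⁻ x, G x ∂(Measure.map (s • ·) (volume : Measure (E n))) := by
    have he : MeasurableEmbedding (fun x : E n => s • x) := measurableEmbedding_const_smul₀ hs0
    rw [he.lintegral_map]
  have h2 : ∫⁻ x, G x = ∫⁻ x, g x := lintegral_add_right_eq_self g z
  change ∫⁻ x, G (s • x) ≤ _
  rw [h1, Measure.map_addHaar_smul _ hs0, lintegral_smul_measure, h2, smul_eq_mul]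
  gcongr
  rw [finrank_euclideanSpace_fin]
  have : |(s ^ n)⁻¹| ≤ 2 ^ n := by
    rw [abs_of_nonneg (by positivity), ← inv_pow]
    gcongr
    rw [inv_le_comm₀ (by linarith) (by norm_num)]
    linarith
  refine (ENNReal.ofReal_le_ofReal this).trans (le_of_eq ?_)
  rw [ENNReal.ofReal_pow (by norm_num)]; norm_num

/-- Poincaré type inequality -/
lemma poincare (n : ℕ) {f : E n → ℝ} (hf : ContDiff ℝ 1 f) {Z : Set (E n)} (hZ : MeasurableSet Z)
    (hZB : Z ⊆ ball 0 (1/2)) (hfZ : ∀ x ∈ Z, f x ≤ 0) :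
    (volume Z).toReal * ∫ x in ball 0 (1/2), (max (f x) 0) ^ 2 ≤
      2 ^ n * (volume (ball (0 : E n) (1/2))).toReal * ∫ x in ball 0 (1/2), ‖fderiv ℝ f x‖ ^ 2 := by
  set B := ball (0 : E n) (1/2) with hB
  have hfc := hf.continuous_fderiv one_ne_zero
  have hBm : MeasurableSet B := measurableSet_ball
  set G : E n → ENNReal := indicator B fun x => ENNReal.ofReal (‖fderiv ℝ f x‖ ^ 2) with hG
  have hGm : Measurable G := (Measurable.indicator (by fun_prop) hBm)
  set F : E n → ENNReal := fun x => ENNReal.ofReal ((max (f x) 0) ^ 2) with hF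
  have hfcont := hf.continuous
  have hFm : Measurable F := by fun_prop
  set J : Set ℝ := Ioc 0 1
  -- pointwise
  have h1 : ∀ y ∈ Z, ∀ x ∈ B, F x ≤ ∫⁻ t in J, G (y + t • (x - y)) := by
    intro y hy x hx
    have h2 := segment_sq_le hf x y
    have h3 : ‖x - y‖ ≤ 1 := by
      have := hZB hy
      rw [hB] at hx
      rw [mem_ball_zero_iff] at hx this
      exact (norm_sub_le _ _).trans (by linarith)
    have h4 : (max (f x) 0) ^ 2 ≤ (f x - f y) ^ 2 := by
      have := hfZ y hy
      rw [← sq_abs (f x - f y)]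
      refine pow_le_pow_left₀ (le_max_right _ _) ?_ 2
      apply max_le
      · exact le_trans (by linarith) (le_abs_self _)
      · exact abs_nonneg _
    have h5 : (max (f x) 0) ^ 2 ≤ ∫ t in (0:ℝ)..1, ‖fderiv ℝ f (y + t • (x - y))‖ ^ 2 := by
      refine h4.trans (h2.trans ?_)
      have : 0 ≤ ∫ t in (0:ℝ)..1, ‖fderiv ℝ f (y + t • (x - y))‖ ^ 2 :=
        intervalIntegral.integral_nonneg (by norm_num) fun t _ => by positivity
      have h6 : ‖x - y‖ ^ 2 ≤ 1 := pow_le_one₀ (norm_nonneg _) h3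
      nlinarith
    simp only [hF]
    refine (ENNReal.ofReal_le_ofReal h5).trans (le_of_eq ?_)
    rw [intervalIntegral.integral_of_le (by norm_num), ofReal_integral_eq_lintegral_ofReal]
    · refine setLIntegral_congr_fun measurableSet_Ioc fun t ht => ?_
      have : y + t • (x - y) ∈ B := (convex_ball (0:E n) (1/2)).add_smul_sub_mem (hZB hy) hx ⟨ht.1.le, ht.2⟩
      simp only [hG, indicator_of_mem this]
    · refine (Continuous.integrableOn_Icc ?_).mono_set Ioc_subset_Icc_self
      fun_prop
    · exact Eventually.of_forall fun t => by positivity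
  have h2 : volume Z * ∫⁻ x in B, F x ≤ ∫⁻ y in B, ∫⁻ x in B, ∫⁻ t in J, G (y + t • (x - y)) := by
    calc volume Z * ∫⁻ x in B, F x = ∫⁻ y in Z, ∫⁻ x in B, F x := by
          rw [setLIntegral_const, mul_comm]
      _ ≤ ∫⁻ y in Z, ∫⁻ x in B, ∫⁻ t in J, G (y + t • (x - y)) :=
          setLIntegral_mono' hZ fun y hy => setLIntegral_mono' hBm fun x hx => h1 y hy x hx
      _ ≤ _ := lintegral_mono_set hZB
  have hGall : ∫⁻ x, G x = ∫⁻ x in B, ENNReal.ofReal (‖fderiv ℝ f x‖ ^ 2) := by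
    rw [hG, lintegral_indicator hBm]
  have h3 : ∀ t ∈ J, ∫⁻ y in B, ∫⁻ x in B, G (y + t • (x - y)) ≤ volume B * (2 ^ n * ∫⁻ x, G x) := by
    intro t ht
    have hmeas : Measurable (Function.uncurry fun (y x : E n) => G (y + t • (x - y))) := by
      apply hGm.comp; fun_prop
    rcases le_total (1/2) t with h | h
    · calc _ ≤ ∫⁻ y in B, 2 ^ n * ∫⁻ x, G x := by
            refine lintegral_mono fun y => ?_
            refine (setLIntegral_le_lintegral _ _).trans ?_
            refine le_trans (le_of_eq ?_) (lintegral_affine G h (y - t • y))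
            refine lintegral_congr fun x => ?_
            congr 1; module
        _ = _ := by rw [setLIntegral_const, mul_comm]
    · rw [lintegral_lintegral_swap hmeas.aemeasurable]
      calc _ ≤ ∫⁻ y in B, 2 ^ n * ∫⁻ x, G x := by
            refine lintegral_mono fun x => ?_
            refine (setLIntegral_le_lintegral _ _).trans ?_
            refine le_trans (le_of_eq ?_) (lintegral_affine G (s := 1 - t) (by linarith) (t • x))
            refine lintegral_congr fun x => ?_
            congr 1; module
        _ = _ := by rw [setLIntegral_const, mul_comm]
  have h4 : ∫⁻ y in B, ∫⁻ x in B, ∫⁻ t in J, G (y + t • (x - y)) ≤ volume B * (2 ^ n * ∫⁻ x, G x) := by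
    have e1 : ∀ y, ∫⁻ x in B, ∫⁻ t in J, G (y + t • (x - y)) = ∫⁻ t in J, ∫⁻ x in B, G (y + t • (x - y)) := by
      intro y
      apply lintegral_lintegral_swap
      apply Measurable.aemeasurable
      apply hGm.comp; fun_prop
    simp only [e1]
    rw [lintegral_lintegral_swap]
    · calc _ ≤ ∫⁻ t in J, volume B * (2 ^ n * ∫⁻ x, G x) := setLIntegral_mono' measurableSet_Ioc h3
        _ = _ := by rw [setLIntegral_const]; simp [J]
    · apply Measurable.aemeasurable
      have : Measurable fun (p : (E n × ℝ) × E n) => G (p.1.1 + p.1.2 • (p.2 - p.1.1)) := by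
        apply hGm.comp; fun_prop
      exact this.lintegral_prod_right'
  have h5 := h2.trans h4
  have iR : IntegrableOn (fun x => ‖fderiv ℝ f x‖ ^ 2) B :=
    (Continuous.continuousOn (by fun_prop)).integrableOn_compact (isCompact_closedBall (0:E n) (1/2)) |>.mono_set ball_subset_closedBall
  have iL : IntegrableOn (fun x => (max (f x) 0) ^ 2) B :=
    (Continuous.continuousOn (by fun_prop)).integrableOn_compact (isCompact_closedBall (0:E n) (1/2)) |>.mono_set ball_subset_closedBall
  rw [hGall, ← ofReal_integral_eq_lintegral_ofReal iR (Eventually.of_forall fun t => by positivity)] at h5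
  simp only [hF] at h5
  rw [← ofReal_integral_eq_lintegral_ofReal iL (Eventually.of_forall fun t => by positivity)] at h5
  have hBt : volume B ≠ ⊤ := measure_ball_lt_top.ne
  have h6 := ENNReal.toReal_mono (by finiteness) h5
  rw [ENNReal.toReal_mul, ENNReal.toReal_mul, ENNReal.toReal_mul, ENNReal.toReal_ofReal (by positivity), ENNReal.toReal_ofReal (by positivity)] at h6
  refine h6.trans (le_of_eq ?_)
  simp; ring

lemma hasDerivAt_sqrt_tau {τ : ℝ} (hτ : 0 < τ) (s : ℝ) :
    HasDerivAt (fun s => √(τ ^ 2 + s ^ 2)) (s / √(τ ^ 2 + s ^ 2)) s := by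
  have h0 : τ ^ 2 + s ^ 2 ≠ 0 := by positivity
  have h1 : HasDerivAt (fun s : ℝ => τ ^ 2 + s ^ 2) (2 * s) s := by
    simpa using (hasDerivAt_pow 2 s).const_add (τ ^ 2)
  have h2 := h1.sqrt h0
  convert h2 using 1
  field_simp

lemma WSub.kappa {n : ℕ} {Λ : ℝ} {a : E n → Matrix (Fin n) (Fin n) ℝ} (ha : Ell Λ a) {w : E n → ℝ}
    (hw : ContDiff ℝ 1 w) (h : WSub a w) {τ : ℝ} (hτ : 0 < τ) :
    WSub a (fun x => w x + √(τ ^ 2 + w x ^ 2)) := by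
  have hpos : ∀ s : ℝ, 0 < √(τ ^ 2 + s ^ 2) := fun s => Real.sqrt_pos.mpr (by positivity)
  have hsq : ∀ s : ℝ, √(τ ^ 2 + s ^ 2) ^ 2 = τ ^ 2 + s ^ 2 := fun s => Real.sq_sqrt (by positivity)
  refine h.comp ha hw (ψ := fun s => s + √(τ ^ 2 + s ^ 2)) (ψ' := fun s => 1 + s / √(τ ^ 2 + s ^ 2))
    (ψ'' := fun s => τ ^ 2 / √(τ ^ 2 + s ^ 2) ^ 3) ?_ ?_ ?_ ?_ ?_
  · intro x; exact (hasDerivAt_id _).add (hasDerivAt_sqrt_tau hτ _)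
  · intro x
    have h1 := ((hasDerivAt_id (w x)).div (hasDerivAt_sqrt_tau hτ (w x)) (hpos _).ne').const_add 1
    refine h1.congr_deriv ?_
    have h2 := hsq (w x)
    have h3 := hpos (w x)
    simp only [id]
    set q := √(τ ^ 2 + w x ^ 2)
    have : τ ^ 2 = q ^ 2 - w x ^ 2 := by linarith
    rw [this]
    field_simp
  · have := hw.continuous
    refine Continuous.div continuous_const (by fun_prop) fun x => ?_
    have := hpos (w x); positivity
  · intro x
    have h3 := hpos (w x)
    have h4 : |w x| ≤ √(τ ^ 2 + w x ^ 2) := by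
      apply Real.abs_le_sqrt; nlinarith
    have : -1 ≤ w x / √(τ ^ 2 + w x ^ 2) := by
      rw [le_div_iff₀ h3]; linarith [neg_abs_le (w x)]
    linarith
  · intro x; have := hpos (w x); positivity

lemma kappa_contDiff {n : ℕ} {w : E n → ℝ} (hw : ContDiff ℝ 1 w) {τ : ℝ} (hτ : 0 < τ) :
    ContDiff ℝ 1 (fun x => w x + √(τ ^ 2 + w x ^ 2)) :=
  hw.add ((contDiff_const.add (hw.pow 2)).sqrt fun x => by positivity)

lemma kappa_pos {τ : ℝ} (hτ : 0 < τ) (s : ℝ) : 0 < s + √(τ ^ 2 + s ^ 2) := by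
  have : |s| < √(τ ^ 2 + s ^ 2) := by
    apply Real.lt_sqrt_of_sq_lt; rw [sq_abs]; nlinarith
  linarith [neg_abs_le s]

lemma kappa_le {τ : ℝ} (hτ : 0 < τ) (s : ℝ) : s + √(τ ^ 2 + s ^ 2) ≤ 2 * max s 0 + τ := by
  have : √(τ ^ 2 + s ^ 2) ≤ τ + |s| := by
    apply Real.sqrt_le_iff.mpr ⟨by positivity, ?_⟩
    rw [← sq_abs s]; nlinarith [abs_nonneg s]
  rcases le_total s 0 with h | h
  · rw [max_eq_right h]; rw [abs_of_nonpos h] at this; linarith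
  · rw [max_eq_left h]; rw [abs_of_nonneg h] at this; linarith

/-- weak Harnack type growth lemma -/
lemma growth (n : ℕ) (hn : 2 ≤ n) (Λ δ : ℝ) (hδ : 0 < δ) : ∃ c : ℝ, 0 < c ∧ ∀ a : E n → Matrix (Fin n) (Fin n) ℝ,
    Ell Λ a → ∀ v : E n → ℝ, ContDiff ℝ 1 v → (∀ x, 0 < v x) → WSub a (fun x => - v x) →
    δ ≤ (volume (ball (0 : E n) (1/2) ∩ {x | 1 ≤ v x})).toReal →
    ∀ x ∈ ball (0 : E n) (1/4), c ≤ v x := by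
  obtain ⟨C, hC, hmoser⟩ := moser n hn Λ
  obtain ⟨C₀, hC0, hcut⟩ := exists_cutoff n
  obtain ⟨η, hη, hηc, hηs, hη0, hη1, hηeq, hηd⟩ := hcut (1/2) 1 (by norm_num) (by norm_num)
  have hη' : ContDiff ℝ 1 η := hη.of_le (by exact_mod_cast le_top)
  set Q := ∫ x, ‖fderiv ℝ η x‖ ^ 2
  set m := (volume (ball (0 : E n) (1/2))).toReal
  set R := 2 * m + 8 * (2 ^ n * m * (4 * Λ ^ 2 * Q) / δ) with hR
  refine ⟨Real.exp (-(C * R ^ (1/2:ℝ))), Real.exp_pos _, fun a ha v hv hv0 hsub hmeas x hx => ?_⟩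
  set ℓ : E n → ℝ := fun x => - Real.log (v x) with hℓ
  have hℓc : ContDiff ℝ 1 ℓ := (hv.log fun x => (hv0 x).ne').neg
  have hℓs : WSub a ℓ := by
    have := hsub.comp ha hv.neg (ψ := fun s => - Real.log (-s)) (ψ' := fun s => - s⁻¹) (ψ'' := fun s => (s ^ 2)⁻¹)
      ?_ ?_ ?_ ?_ ?_
    · simpa using this
    · intro x
      have h1 : (- v x) ≠ 0 := by have := (hv0 x).ne'; simpa using this
      have := (Real.hasDerivAt_log h1).neg
      have h2 : (fun s : ℝ => - Real.log (-s)) = fun s => - Real.log s := by ext s; simp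
      rw [h2]; exact this
    · intro x
      have h1 : (- v x) ≠ 0 := by have := (hv0 x).ne'; simpa using this
      have := (hasDerivAt_inv h1).neg
      rw [neg_neg] at this
      exact this
    · refine Continuous.inv₀ ((hv.continuous.neg).pow 2) fun x => ?_
      have := (hv0 x).ne'; simpa using this
    · intro x; have := hv0 x
      rw [inv_neg]; simp only [neg_neg]; positivity
    · intro x; positivity
  set Z := ball (0 : E n) (1/2) ∩ {x | 1 ≤ v x} with hZ
  have hZm : MeasurableSet Z := measurableSet_ball.inter (measurableSet_le measurable_const hv.continuous.measurable)
  have hp := poincare n hℓc hZm inter_subset_left (fun x hx => by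
    have : 1 ≤ v x := hx.2
    have := Real.log_nonneg this
    simp only [hℓ]; linarith)
  have hlc := hsub.log_caccioppoli ha hv hv0 hη' hηc hηs
  have hℓcont := hℓc.continuous
  have hℓd := hℓc.continuous_fderiv one_ne_zero
  have hηcont := hη'.continuous
  have h1 : ∫ x in ball 0 (1/2), ‖fderiv ℝ ℓ x‖ ^ 2 ≤ 4 * Λ ^ 2 * Q := by
    refine le_trans ?_ hlc
    have i1 : Integrable fun x => η x ^ 2 * ‖fderiv ℝ ℓ x‖ ^ 2 := by
      refine Continuous.integrable_of_hasCompactSupport (by fun_prop) ?_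
      exact hηc.mono (by intro x hx; simp only [Function.mem_support] at hx ⊢; contrapose! hx; simp [hx])
    calc ∫ x in ball 0 (1/2), ‖fderiv ℝ ℓ x‖ ^ 2 = ∫ x in ball 0 (1/2), η x ^ 2 * ‖fderiv ℝ ℓ x‖ ^ 2 := by
          refine setIntegral_congr_fun measurableSet_ball fun x hx => ?_
          simp [hηeq x (ball_subset_closedBall hx)]
      _ ≤ _ := setIntegral_le_integral i1 (Eventually.of_forall fun x => by
          simp only [Pi.zero_apply]; positivity)
  have iL : IntegrableOn (fun x => (max (ℓ x) 0) ^ 2) (ball 0 (1/2)) :=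
    (Continuous.continuousOn (by fun_prop)).integrableOn_compact (isCompact_closedBall (0:E n) (1/2)) |>.mono_set ball_subset_closedBall
  have hL0 : 0 ≤ ∫ x in ball 0 (1/2), (max (ℓ x) 0) ^ 2 := integral_nonneg fun x => by positivity
  have h2 : ∫ x in ball 0 (1/2), (max (ℓ x) 0) ^ 2 ≤ 2 ^ n * m * (4 * Λ ^ 2 * Q) / δ := by
    rw [le_div_iff₀ hδ, mul_comm]
    calc _ ≤ (volume Z).toReal * ∫ x in ball 0 (1/2), (max (ℓ x) 0) ^ 2 := by gcongr
      _ ≤ _ := hp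
      _ ≤ _ := by gcongr
  have hm := hmoser a ha _ (kappa_contDiff hℓc one_pos) (fun x => kappa_pos one_pos _) (hℓs.kappa ha hℓc one_pos) x hx
  have h3 : ∫ x in ball 0 (1/2), (ℓ x + √(1 ^ 2 + ℓ x ^ 2)) ^ 2 ≤ R := by
    have : ∫ x in ball 0 (1/2), (ℓ x + √(1 ^ 2 + ℓ x ^ 2)) ^ 2 ≤ ∫ x in ball 0 (1/2), (2 + 8 * (max (ℓ x) 0) ^ 2) := by
      refine setIntegral_mono_on ?_ ?_ measurableSet_ball fun x _ => ?_
      · exact (Continuous.continuousOn (by fun_prop)).integrableOn_compact (isCompact_closedBall (0:E n) (1/2)) |>.mono_set ball_subset_closedBall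
      · exact (Continuous.continuousOn (by fun_prop)).integrableOn_compact (isCompact_closedBall (0:E n) (1/2)) |>.mono_set ball_subset_closedBall
      · have h4 := kappa_le one_pos (ℓ x)
        have h5 := kappa_pos one_pos (ℓ x)
        have h6 : (ℓ x + √(1 ^ 2 + ℓ x ^ 2)) ^ 2 ≤ (2 * max (ℓ x) 0 + 1) ^ 2 := pow_le_pow_left₀ h5.le h4 2
        nlinarith [sq_nonneg (2 * max (ℓ x) 0 - 1)]
    refine this.trans ?_
    have i2 : IntegrableOn (fun _ => (2:ℝ)) (ball (0:E n) (1/2)) := integrableOn_const measure_ball_lt_top.ne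
    rw [integral_add i2 (iL.const_mul 8), setIntegral_const, integral_const_mul, smul_eq_mul]
    rw [hR]
    have : (volume.real (ball (0 : E n) (1/2))) = m := rfl
    rw [this]
    linarith
  have h7 : ℓ x ≤ C * R ^ (1/2:ℝ) := by
    have h8 : ℓ x ≤ ℓ x + √(1 ^ 2 + ℓ x ^ 2) := by linarith [Real.sqrt_nonneg (1 ^ 2 + ℓ x ^ 2)]
    refine h8.trans (hm.trans ?_)
    gcongr
  have h9 : -(C * R ^ (1/2:ℝ)) ≤ Real.log (v x) := by simp only [hℓ] at h7; linarith
  rwa [← Real.le_log_iff_exp_le (hv0 x)]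

end EK


namespace EK

/-- directional derivative -/
noncomputable def dd {n : ℕ} (v : E n) (f : E n → ℝ) (x : E n) : ℝ := fderiv ℝ f x v

lemma pd_eq_dd {n : ℕ} (i : Fin n) (f : E n → ℝ) : pd i f = dd (e i) f := rfl

/-- smooth -/
abbrev Sm {n : ℕ} {F : Type*} [NormedAddCommGroup F] [NormedSpace ℝ F] (f : E n → F) : Prop := ContDiff ℝ (⊤ : ℕ∞) f

lemma Sm.dd {n : ℕ} {f : E n → ℝ} (hf : Sm f) (v : E n) : Sm (EK.dd v f) := by
  have : ContDiff ℝ (⊤ : ℕ∞) (fderiv ℝ f) := hf.fderiv_right (by exact_mod_cast le_top)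
  exact this.clm_apply contDiff_const

lemma Sm.pd {n : ℕ} {f : E n → ℝ} (hf : Sm f) (i : Fin n) : Sm (EK.pd i f) := hf.dd _

lemma Sm.c1 {n : ℕ} {F : Type*} [NormedAddCommGroup F] [NormedSpace ℝ F] {f : E n → F} (hf : Sm f) :
    ContDiff ℝ 1 f := hf.of_le (by exact_mod_cast le_top)

lemma Sm.c2 {n : ℕ} {F : Type*} [NormedAddCommGroup F] [NormedSpace ℝ F] {f : E n → F} (hf : Sm f) :
    ContDiff ℝ 2 f := contDiff_infty.1 hf 2

lemma Sm.diff {n : ℕ} {F : Type*} [NormedAddCommGroup F] [NormedSpace ℝ F] {f : E n → F} (hf : Sm f) (x : E n) :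
    DifferentiableAt ℝ f x := hf.c1.differentiable one_ne_zero x

lemma two_le_inf : (2 : WithTop ℕ∞) ≤ ((⊤ : ℕ∞) : WithTop ℕ∞) := by
  have : (((2:ℕ):ℕ∞) : WithTop ℕ∞) ≤ ((⊤ : ℕ∞) : WithTop ℕ∞) := WithTop.coe_le_coe.mpr le_top
  exact this

lemma dd_dd_eq {n : ℕ} {f : E n → ℝ} (hf : Sm f) (v w x : E n) :
    dd v (dd w f) x = fderiv ℝ (fderiv ℝ f) x v w := by
  have h1 : ContDiff ℝ (⊤ : ℕ∞) (fderiv ℝ f) := hf.fderiv_right (by exact_mod_cast le_top)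
  have h2 := (h1.differentiable (by simp) x).hasFDerivAt.clm_apply (hasFDerivAt_const w x)
  have h3 : fderiv ℝ (dd w f) x = _ := h2.fderiv
  unfold dd at h3 ⊢
  rw [h3]
  simp

lemma dd_comm {n : ℕ} {f : E n → ℝ} (hf : Sm f) (v w : E n) : dd v (dd w f) = dd w (dd v f) := by
  ext x
  rw [dd_dd_eq hf, dd_dd_eq hf]
  have := (hf.contDiffAt (x := x)).isSymmSndFDerivAt (by simp; exact two_le_inf)
  exact this v w

lemma dd_congr {n : ℕ} {f g : E n → ℝ} {s : Set (E n)} (hs : IsOpen s) (h : ∀ x ∈ s, f x = g x) (v : E n) :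
    ∀ x ∈ s, dd v f x = dd v g x := by
  intro x hx
  have : f =ᶠ[𝓝 x] g := by filter_upwards [hs.mem_nhds hx] with y hy using h y hy
  unfold dd; rw [this.fderiv_eq]

/-- determinant as a function of entries -/
noncomputable def detF {n : ℕ} (A : Fin n → Fin n → ℝ) : ℝ := (Matrix.of A).det

lemma detF_contDiff {n : ℕ} : ContDiff ℝ (⊤ : ℕ∞) (detF (n := n)) := by
  have : detF (n := n) = fun A => ∑ σ : Equiv.Perm (Fin n), (Equiv.Perm.sign σ : ℝ) * ∏ i, A (σ i) i := by
    ext A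
    unfold detF
    rw [Matrix.det_apply']
    rfl
  rw [this]
  fun_prop

/-- elementary matrix as function -/
noncomputable def sg {n : ℕ} (i j : Fin n) : Fin n → Fin n → ℝ := Pi.single i (Pi.single j 1)

lemma sum_sg {n : ℕ} (X : Fin n → Fin n → ℝ) : X = ∑ i, ∑ j, X i j • sg i j := by
  ext k l
  simp only [sg, Finset.sum_apply, Pi.smul_apply, smul_eq_mul]
  rw [Finset.sum_eq_single k, Finset.sum_eq_single l]
  · simp
  · intro c _ hc; simp [Ne.symm hc]
  · simp
  · intro c _ hc; simp [Ne.symm hc]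
  · simp

lemma of_add_smul_sg {n : ℕ} (A : Fin n → Fin n → ℝ) (i j : Fin n) (t : ℝ) :
    Matrix.of (A + t • sg i j) = (Matrix.of A).updateRow i (A i + t • Pi.single j 1) := by
  ext k l
  by_cases h : k = i
  · subst h; simp [sg, Matrix.updateRow_apply, Pi.single_apply]
  · simp [sg, Matrix.updateRow_apply, h, Pi.single_apply]

lemma detF_add_sg {n : ℕ} (A : Fin n → Fin n → ℝ) (i j : Fin n) (t : ℝ) :
    detF (A + t • sg i j) = detF A + t * (Matrix.of A).adjugate j i := by
  unfold detF
  rw [of_add_smul_sg, Matrix.det_updateRow_add, Matrix.det_updateRow_smul, Matrix.adjugate_apply]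
  congr 1
  congr 1
  exact Matrix.updateRow_eq_self (Matrix.of A) i

lemma fderiv_detF_sg {n : ℕ} (A : Fin n → Fin n → ℝ) (i j : Fin n) :
    fderiv ℝ detF A (sg i j) = (Matrix.of A).adjugate j i := by
  have h1 : DifferentiableAt ℝ (detF (n := n)) A := detF_contDiff.differentiable (by simp) A
  have h2 : HasDerivAt (fun t : ℝ => A + t • sg i j) (sg i j) 0 := by
    simpa using ((hasDerivAt_id (0:ℝ)).smul_const (sg i j)).const_add A
  have h3 : HasFDerivAt detF (fderiv ℝ detF A) (A + (0:ℝ) • sg i j) := by simpa using h1.hasFDerivAt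
  have h4 := h3.comp_hasDerivAt (0:ℝ) h2
  have h5 : HasDerivAt (fun t : ℝ => detF A + t * (Matrix.of A).adjugate j i) ((Matrix.of A).adjugate j i) 0 := by
    simpa using ((hasDerivAt_id (0:ℝ)).mul_const ((Matrix.of A).adjugate j i)).const_add (detF A)
  have h6 : (detF ∘ fun t : ℝ => A + t • sg i j) = (fun t : ℝ => detF A + t * (Matrix.of A).adjugate j i) := by
    ext t; exact detF_add_sg A i j t
  rw [h6] at h4
  exact h4.unique h5

lemma fderiv_detF {n : ℕ} (A X : Fin n → Fin n → ℝ) :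
    fderiv ℝ detF A X = ∑ i, ∑ j, (Matrix.of A).adjugate j i * X i j := by
  conv_lhs => rw [sum_sg X]
  simp only [map_sum, map_smul, fderiv_detF_sg, smul_eq_mul]
  refine Finset.sum_congr rfl fun i _ => Finset.sum_congr rfl fun j _ => by ring

/-- cofactor as a function -/
noncomputable def cof {n : ℕ} (i j : Fin n) (A : Fin n → Fin n → ℝ) : ℝ := (Matrix.of A).adjugate j i

lemma cof_eq {n : ℕ} (i j : Fin n) (A : Fin n → Fin n → ℝ) : cof i j A = detF (Function.update A i (Pi.single j 1)) := by
  unfold cof detF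
  rw [Matrix.adjugate_apply]; rfl

lemma cof_contDiff {n : ℕ} (i j : Fin n) : ContDiff ℝ (⊤ : ℕ∞) (cof (n := n) i j) := by
  have : cof (n := n) i j = fun A => fderiv ℝ detF A (sg i j) := by
    ext A; rw [fderiv_detF_sg]; rfl
  rw [this]
  exact (detF_contDiff.fderiv_right (by exact_mod_cast le_top)).clm_apply contDiff_const

/-- derivative of cofactor in elementary direction, antisymmetric -/
lemma fderiv_cof_sg {n : ℕ} (A : Fin n → Fin n → ℝ) (i j k l : Fin n) :
    fderiv ℝ (cof i j) A (sg k l) = if k = i then 0 else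
      detF (Function.update (Function.update A i (Pi.single j 1)) k (Pi.single l 1)) := by
  have h1 : DifferentiableAt ℝ (cof (n := n) i j) A := (cof_contDiff i j).differentiable (by simp) A
  have h2 : HasDerivAt (fun t : ℝ => A + t • sg k l) (sg k l) 0 := by
    simpa using ((hasDerivAt_id (0:ℝ)).smul_const (sg k l)).const_add A
  have h3 : HasFDerivAt (cof i j) (fderiv ℝ (cof i j) A) (A + (0:ℝ) • sg k l) := by simpa using h1.hasFDerivAt
  have h4 := h3.comp_hasDerivAt (0:ℝ) h2
  set c := if k = i then 0 else
      detF (Function.update (Function.update A i (Pi.single j 1)) k (Pi.single l 1)) with hc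
  have h5 : HasDerivAt (fun t : ℝ => cof i j A + t * c) c 0 := by
    simpa using ((hasDerivAt_id (0:ℝ)).mul_const c).const_add (cof i j A)
  have h6 : (cof i j ∘ fun t : ℝ => A + t • sg k l) = (fun t : ℝ => cof i j A + t * c) := by
    ext t
    simp only [Function.comp, cof_eq]
    by_cases hk : k = i
    · subst hk
      simp only [hc, if_true, mul_zero, add_zero]
      congr 1
      ext p q
      by_cases hp : p = k
      · subst hp; simp
      · simp [hp, sg]
    · simp only [hc, hk, if_false]
      have h7 := detF_add_sg (Function.update A i (Pi.single j 1)) k l t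
      rw [Matrix.adjugate_apply] at h7
      have h8 : Function.update (A + t • sg k l) i (Pi.single j 1) = Function.update A i (Pi.single j 1) + t • sg k l := by
        ext p q
        by_cases hp : p = i
        · subst hp; simp [sg, Ne.symm hk]
        · simp [hp]
      rw [h8, h7]; rfl
  rw [h6] at h4
  exact h4.unique h5

lemma fderiv_cof_antisymm {n : ℕ} (A : Fin n → Fin n → ℝ) (i j k l : Fin n) :
    fderiv ℝ (cof i j) A (sg k l) = - fderiv ℝ (cof k j) A (sg i l) := by
  rw [fderiv_cof_sg, fderiv_cof_sg]
  by_cases h : k = i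
  · subst h; simp
  · rw [if_neg h, if_neg (Ne.symm h)]
    unfold detF
    have h1 := Matrix.det_permute (Equiv.swap i k) (Matrix.of (Function.update (Function.update A k (Pi.single j 1)) i (Pi.single l 1)))
    rw [Equiv.Perm.sign_swap (Ne.symm h)] at h1
    simp only [Units.val_neg, Units.val_one, Int.cast_neg, Int.cast_one, neg_mul, one_mul] at h1
    rw [← h1]
    congr 1
    ext p q
    simp only [Matrix.of_apply, Matrix.submatrix_apply, id]
    by_cases hp : p = k
    · subst hp; simp
    · by_cases hp2 : p = i
      · subst hp2; simp [Ne.symm h]; simp [h, hp]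
      · rw [Equiv.swap_apply_of_ne_of_ne hp2 hp]; simp [hp, hp2]

end EK


namespace EK

/-- Hessian as a function -/
noncomputable def Hf {n : ℕ} (h : E n → ℝ) (x : E n) : Fin n → Fin n → ℝ := fun i j => pd i (pd j h) x

lemma Hf_sm {n : ℕ} {h : E n → ℝ} (hh : Sm h) : Sm (Hf h) := by
  refine contDiff_pi.2 fun i => contDiff_pi.2 fun j => ?_
  exact (hh.pd j).pd i

lemma Hf_symm {n : ℕ} {h : E n → ℝ} (hh : Sm h) (x : E n) (i j : Fin n) : Hf h x i j = Hf h x j i := by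
  unfold Hf
  rw [pd_eq_dd, pd_eq_dd, pd_eq_dd, pd_eq_dd, dd_comm hh]

lemma fderiv_Hf {n : ℕ} {h : E n → ℝ} (hh : Sm h) (x v : E n) : fderiv ℝ (Hf h) x v = Hf (dd v h) x := by
  ext i j
  have h1 : HasFDerivAt (Hf h) (fderiv ℝ (Hf h) x) x := ((Hf_sm hh).diff x).hasFDerivAt
  have h2 := hasFDerivAt_pi'.1 (hasFDerivAt_pi'.1 h1 i) j
  have h3 : fderiv ℝ (pd i (pd j h)) x = _ := h2.fderiv
  have h4 : fderiv ℝ (Hf h) x v i j = dd v (dd (e i) (dd (e j) h)) x := by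
    change _ = fderiv ℝ (pd i (pd j h)) x v
    rw [h3]; rfl
  rw [h4, dd_comm ((hh.dd _)), dd_comm hh]; rfl

lemma dd_comp_Hf {n : ℕ} {F : Type*} [NormedAddCommGroup F] [NormedSpace ℝ F] {h : E n → ℝ} (hh : Sm h)
    {G : (Fin n → Fin n → ℝ) → F} (hG : ContDiff ℝ (⊤ : ℕ∞) G) (x v : E n) :
    fderiv ℝ (fun x => G (Hf h x)) x v = fderiv ℝ G (Hf h x) (Hf (dd v h) x) := by
  have h1 := (hG.differentiable (by simp) (Hf h x)).hasFDerivAt.comp x ((Hf_sm hh).diff x).hasFDerivAt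
  have h2 : fderiv ℝ (fun x => G (Hf h x)) x = _ := h1.fderiv
  rw [h2, ContinuousLinearMap.comp_apply, fderiv_Hf hh]

/-- coefficient matrix of the linearised operator -/
noncomputable def am {n : ℕ} (b : ℝ) (h : E n → ℝ) (x : E n) : Matrix (Fin n) (Fin n) ℝ :=
  Matrix.of fun i j => (if i = j then 1 else 0) + b * cof i j (Hf h x)

lemma am_apply {n : ℕ} (b : ℝ) (h : E n → ℝ) (x : E n) (i j : Fin n) :
  am b h x i j = (if i = j then 1 else 0) + b * cof i j (Hf h x) := rfl

lemma am_sm {n : ℕ} {b : ℝ} {h : E n → ℝ} (hh : Sm h) (i j : Fin n) : Sm (fun x => am b h x i j) := by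
  simp only [am_apply]
  have : Sm (fun x => cof i j (Hf h x)) := (cof_contDiff i j).comp (Hf_sm hh)
  exact contDiff_const.add (contDiff_const.mul this)

lemma cof_symm {n : ℕ} {A : Fin n → Fin n → ℝ} (hA : ∀ i j, A i j = A j i) (i j : Fin n) : cof i j A = cof j i A := by
  unfold cof
  have h1 : (Matrix.of A).transpose = Matrix.of A := by ext i j; simp [hA j i]
  have h2 := Matrix.adjugate_transpose (Matrix.of A)
  rw [h1] at h2
  exact (congrFun (congrFun h2 i) j)

lemma am_symm {n : ℕ} {b : ℝ} {h : E n → ℝ} (hh : Sm h) (x : E n) (i j : Fin n) : am b h x i j = am b h x j i := by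
  rw [am_apply, am_apply, cof_symm (Hf_symm hh x)]
  by_cases h : i = j
  · subst h; rfl
  · simp [h, Ne.symm h]

lemma piola {n : ℕ} {b : ℝ} {h : E n → ℝ} (hh : Sm h) (x : E n) (j : Fin n) :
    ∑ i, pd i (fun x => am b h x i j) x = 0 := by
  have h1 : ∀ i, pd i (fun x => am b h x i j) x = b * ∑ k, ∑ l, pd i (pd k (pd l h)) x * fderiv ℝ (cof i j) (Hf h x) (sg k l) := by
    intro i
    have h2 : Sm (fun x => cof i j (Hf h x)) := (cof_contDiff i j).comp (Hf_sm hh)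
    have h3 := ((h2.diff x).hasFDerivAt.const_mul b).const_add (if i = j then (1:ℝ) else 0)
    have h4 : fderiv ℝ (fun x => am b h x i j) x = _ := h3.fderiv
    unfold pd at *
    rw [h4, smul_apply, dd_comp_Hf hh (cof_contDiff i j), smul_eq_mul]
    congr 1
    conv_lhs => rw [sum_sg (Hf (dd (e i) h) x)]
    simp only [map_sum, map_smul, smul_eq_mul]
    refine Finset.sum_congr rfl fun k _ => Finset.sum_congr rfl fun l _ => ?_
    congr 1
    change dd (e k) (dd (e l) (dd (e i) h)) x = dd (e i) (dd (e k) (dd (e l) h)) x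
    rw [dd_comm hh (e l) (e i), dd_comm (hh.dd (e l))]
  simp only [h1, ← Finset.mul_sum]
  set T := ∑ i, ∑ k, ∑ l, pd i (pd k (pd l h)) x * fderiv ℝ (cof i j) (Hf h x) (sg k l) with hT
  have h5 : T = - T := by
    conv_lhs => rw [hT, Finset.sum_comm]
    rw [hT, ← Finset.sum_neg_distrib]
    refine Finset.sum_congr rfl fun i _ => ?_
    rw [← Finset.sum_neg_distrib]
    refine Finset.sum_congr rfl fun k _ => ?_
    rw [← Finset.sum_neg_distrib]
    refine Finset.sum_congr rfl fun l _ => ?_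
    rw [fderiv_cof_antisymm]
    have : pd k (pd i (pd l h)) x = pd i (pd k (pd l h)) x := by
      rw [pd_eq_dd, pd_eq_dd i, dd_comm (hh.pd l)]; rfl
    rw [this]; ring
  have h6 : T = 0 := by linarith
  rw [h6, mul_zero]

/-- trace -/
noncomputable def trF {n : ℕ} (A : Fin n → Fin n → ℝ) : ℝ := ∑ i, A i i

/-- the linearised operator -/
noncomputable def Lop {n : ℕ} (b : ℝ) (h f : E n → ℝ) (x : E n) : ℝ :=
  trF (Hf f x) + b * fderiv ℝ detF (Hf h x) (Hf f x)

lemma Lop_eq {n : ℕ} (b : ℝ) (h f : E n → ℝ) (x : E n) :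
    Lop b h f x = ∑ i, ∑ j, am b h x i j * pd i (pd j f) x := by
  unfold Lop
  rw [fderiv_detF, trF, Finset.mul_sum, ← Finset.sum_add_distrib]
  refine Finset.sum_congr rfl fun i _ => ?_
  simp only [am_apply, add_mul, Finset.sum_add_distrib, Finset.mul_sum]
  congr 1
  · simp [Hf]
  · refine Finset.sum_congr rfl fun j _ => ?_
    rw [cof, Hf, mul_assoc]

/-- second derivative of the determinant -/
noncomputable def D2 {n : ℕ} (A X : Fin n → Fin n → ℝ) : ℝ := fderiv ℝ (fderiv ℝ detF) A X X

/-- solution on the ball of radius `R` -/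
structure Sol {n : ℕ} (R b : ℝ) (h : E n → ℝ) : Prop where
  sm : Sm h
  psd : ∀ x ∈ ball (0 : E n) R, (Matrix.of (Hf h x)).PosSemidef
  eq : ∀ x ∈ ball (0 : E n) R, trF (Hf h x) + b * detF (Hf h x) = 1

lemma trF_contDiff {n : ℕ} : ContDiff ℝ (⊤ : ℕ∞) (trF (n := n)) := by
  unfold trF; fun_prop

lemma fderiv_trF {n : ℕ} (A X : Fin n → Fin n → ℝ) : fderiv ℝ trF A X = trF X := by
  let L : (Fin n → Fin n → ℝ) →ₗ[ℝ] ℝ := 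
    { toFun := trF
      map_add' := by intro x y; simp [trF, Finset.sum_add_distrib]
      map_smul' := by intro c x; simp [trF, Finset.mul_sum] }
  have h1 : HasFDerivAt (LinearMap.toContinuousLinearMap L) (LinearMap.toContinuousLinearMap L) A := 
    ContinuousLinearMap.hasFDerivAt _
  have h2 : fderiv ℝ trF A = LinearMap.toContinuousLinearMap L := h1.fderiv
  rw [h2]; rfl

lemma Sol.lin {n : ℕ} {R b : ℝ} {h : E n → ℝ} (hs : Sol R b h) (v : E n) :
    ∀ x ∈ ball (0 : E n) R, Lop b h (dd v h) x = 0 := by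
  intro x hx
  have h1 : Sm (fun x => trF (Hf h x)) := trF_contDiff.comp (Hf_sm hs.sm)
  have h2 : Sm (fun x => detF (Hf h x)) := detF_contDiff.comp (Hf_sm hs.sm)
  have h3 := dd_congr isOpen_ball (g := fun _ => (1:ℝ)) hs.eq v x hx
  have h4 := (h1.diff x).hasFDerivAt.add ((h2.diff x).hasFDerivAt.const_mul b)
  have h5 : fderiv ℝ (fun x => trF (Hf h x) + b * detF (Hf h x)) x = _ := h4.fderiv
  unfold dd at h3
  rw [h5, add_apply, smul_apply, dd_comp_Hf hs.sm trF_contDiff, dd_comp_Hf hs.sm detF_contDiff,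
    fderiv_trF] at h3
  simpa [Lop] using h3

lemma dd_fderiv_detF {n : ℕ} {h f : E n → ℝ} (hh : Sm h) (hf : Sm f) (v x : E n) :
    dd v (fun x => fderiv ℝ detF (Hf h x) (Hf f x)) x =
      fderiv ℝ (fderiv ℝ detF) (Hf h x) (Hf (dd v h) x) (Hf f x) + fderiv ℝ detF (Hf h x) (Hf (dd v f) x) := by
  have h0 : ContDiff ℝ (⊤ : ℕ∞) (fderiv ℝ (detF (n := n))) := detF_contDiff.fderiv_right (by exact_mod_cast le_top)
  have h1 : Sm (fun x => fderiv ℝ detF (Hf h x)) := h0.comp (Hf_sm hh)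
  have h2 := (h1.diff x).hasFDerivAt.clm_apply ((Hf_sm hf).diff x).hasFDerivAt
  have h3 : fderiv ℝ (fun x => fderiv ℝ detF (Hf h x) (Hf f x)) x = _ := h2.fderiv
  unfold dd at h3 ⊢
  rw [h3]
  simp only [add_apply, ContinuousLinearMap.comp_apply, ContinuousLinearMap.flip_apply]
  rw [dd_comp_Hf hh h0, fderiv_Hf hf, add_comm]
  rfl

lemma Sol.lin2 {n : ℕ} {R b : ℝ} {h : E n → ℝ} (hs : Sol R b h) (v : E n) :
    ∀ x ∈ ball (0 : E n) R, Lop b h (dd v (dd v h)) x = - b * D2 (Hf h x) (Hf (dd v h) x) := by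
  intro x hx
  have h0 : ContDiff ℝ (⊤ : ℕ∞) (fderiv ℝ (detF (n := n))) := detF_contDiff.fderiv_right (by exact_mod_cast le_top)
  have hv := hs.sm.dd v
  have h1 : Sm (fun x => trF (Hf (dd v h) x)) := trF_contDiff.comp (Hf_sm hv)
  have h2 : Sm (fun x => fderiv ℝ detF (Hf h x) (Hf (dd v h) x)) := (h0.comp (Hf_sm hs.sm)).clm_apply (Hf_sm hv)
  have h3 := dd_congr isOpen_ball (g := fun _ => (0:ℝ)) (hs.lin v) v x hx
  have h4 := (h1.diff x).hasFDerivAt.add ((h2.diff x).hasFDerivAt.const_mul b)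
  have h5 : fderiv ℝ (Lop b h (dd v h)) x = _ := h4.fderiv
  have h6 := dd_fderiv_detF hs.sm hv v x
  have h7 := dd_comp_Hf hv trF_contDiff x v
  change fderiv ℝ (Lop b h (dd v h)) x v = _ at h3
  change fderiv ℝ (fun x => fderiv ℝ detF (Hf h x) (Hf (dd v h) x)) x v = _ at h6
  rw [h5, add_apply, smul_apply, h6, h7, fderiv_trF] at h3
  have h8 : dd v (fun _ : E n => (0:ℝ)) x = 0 := by simp [dd]
  rw [h8, smul_eq_mul] at h3
  unfold Lop D2
  linarith

/-- determinant of the Hessian -/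
noncomputable def uu {n : ℕ} (h : E n → ℝ) (x : E n) : ℝ := detF (Hf h x)

lemma uu_sm {n : ℕ} {h : E n → ℝ} (hh : Sm h) : Sm (uu h) := detF_contDiff.comp (Hf_sm hh)

lemma pd_uu {n : ℕ} {h : E n → ℝ} (hh : Sm h) (k : Fin n) (x : E n) : 
    pd k (uu h) x = fderiv ℝ detF (Hf h x) (Hf (pd k h) x) := dd_comp_Hf hh detF_contDiff x (e k)

lemma Hf_sum {n : ℕ} {ι : Type*} (s : Finset ι) (f : ι → E n → ℝ) (hf : ∀ i ∈ s, Sm (f i)) (x : E n) : 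
    Hf (fun x => ∑ i ∈ s, f i x) x = ∑ i ∈ s, Hf (f i) x := by
  have key : ∀ (g : ι → E n → ℝ), (∀ i ∈ s, Sm (g i)) → ∀ v, dd v (fun x => ∑ i ∈ s, g i x) = fun x => ∑ i ∈ s, dd v (g i) x := by
    intro g hg v
    ext y
    unfold dd
    rw [fderiv_fun_sum (fun i hi => (hg i hi).diff y)]
    simp
  ext i j
  unfold Hf
  simp only [pd_eq_dd, Finset.sum_apply]
  rw [key f hf, key _ (fun k hk => (hf k hk).dd _)]

lemma Hf_smul {n : ℕ} (c : ℝ) (f : E n → ℝ) (hf : Sm f) (x : E n) : Hf (fun x => c * f x) x = c • Hf f x := by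
  have key : ∀ g : E n → ℝ, Sm g → ∀ v, dd v (fun x => c * g x) = fun x => c * dd v g x := by
    intro g hg v; ext y; unfold dd
    rw [((hg.diff y).hasFDerivAt.const_mul c).fderiv]; simp
  ext i j
  unfold Hf
  simp only [pd_eq_dd, Pi.smul_apply, smul_eq_mul]
  rw [key f hf, key _ (hf.dd _)]

lemma Hf_add {n : ℕ} (f g : E n → ℝ) (hf : Sm f) (hg : Sm g) (x : E n) : Hf (fun x => f x + g x) x = Hf f x + Hf g x := by
  have key : ∀ f g : E n → ℝ, Sm f → Sm g → ∀ v, dd v (fun x => f x + g x) = fun x => dd v f x + dd v g x := by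
    intro f g hf hg v; ext y; unfold dd
    rw [((hf.diff y).hasFDerivAt.fun_add (hg.diff y).hasFDerivAt).fderiv]; simp
  ext i j
  unfold Hf
  simp only [pd_eq_dd, Pi.add_apply]
  rw [key f g hf hg, key _ _ (hf.dd _) (hg.dd _)]

lemma Hf_congr {n : ℕ} {f g : E n → ℝ} {s : Set (E n)} (hs : IsOpen s) (h : ∀ x ∈ s, f x = g x) :
    ∀ x ∈ s, Hf f x = Hf g x := by
  intro x hx
  ext i j
  exact dd_congr hs (dd_congr hs h (e j)) (e i) x hx

lemma Lop_congr {n : ℕ} {b : ℝ} {h f g : E n → ℝ} {s : Set (E n)} (hs : IsOpen s) (hfg : ∀ x ∈ s, f x = g x) :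
    ∀ x ∈ s, Lop b h f x = Lop b h g x := by
  intro x hx
  unfold Lop
  rw [Hf_congr hs hfg x hx]

lemma trF_sum {n : ℕ} {ι : Type*} (s : Finset ι) (A : ι → Fin n → Fin n → ℝ) : trF (∑ i ∈ s, A i) = ∑ i ∈ s, trF (A i) := by
  unfold trF; simp only [Finset.sum_apply]; rw [Finset.sum_comm]

lemma Lop_add {n : ℕ} {b : ℝ} {h f g : E n → ℝ} (hf : Sm f) (hg : Sm g) (x : E n) : 
    Lop b h (fun x => f x + g x) x = Lop b h f x + Lop b h g x := by
  unfold Lop; rw [Hf_add f g hf hg]; simp [trF, Finset.sum_add_distrib]; ring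

lemma Lop_smul {n : ℕ} {b : ℝ} {h f : E n → ℝ} (c : ℝ) (hf : Sm f) (x : E n) : 
    Lop b h (fun x => c * f x) x = c * Lop b h f x := by
  unfold Lop; rw [Hf_smul c f hf]; simp [trF, Finset.mul_sum]; rw [← Finset.mul_sum]; ring

lemma Sol.lin_u {n : ℕ} {R b : ℝ} {h : E n → ℝ} (hs : Sol R b h) :
    ∀ x ∈ ball (0 : E n) R, Lop b h (uu h) x = ∑ k, D2 (Hf h x) (Hf (pd k h) x) := by
  intro x hx
  have hu := uu_sm hs.sm
  have hkk : ∀ k, Sm (pd k (pd k h)) := fun k => (hs.sm.pd k).pd k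
  have hlap : Sm (fun x => ∑ k, pd k (pd k h) x) := by
    exact ContDiff.sum fun k _ => hkk k
  have e1 : ∀ y ∈ ball (0 : E n) R, b * uu h y = 1 + (-1) * ∑ k, pd k (pd k h) y := by
    intro y hy
    have := hs.eq y hy
    unfold trF Hf at this
    unfold uu
    unfold Hf
    linarith
  have e2 := Hf_congr isOpen_ball e1 x hx
  rw [Hf_smul b _ hu, Hf_add _ _ contDiff_const (contDiff_const.mul hlap), Hf_smul (-1) _ hlap, 
    Hf_sum _ _ (fun k _ => hkk k)] at e2
  have e0 : Hf (fun _ : E n => (1:ℝ)) x = 0 := by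
    ext i j; unfold Hf pd; simp
  rw [e0, zero_add] at e2
  have e3 : trF (Hf (uu h) x) = ∑ k, (D2 (Hf h x) (Hf (pd k h) x) + fderiv ℝ detF (Hf h x) (Hf (pd k (pd k h)) x)) := by
    unfold trF
    refine Finset.sum_congr rfl fun k _ => ?_
    have e4 : pd k (uu h) = fun x => fderiv ℝ detF (Hf h x) (Hf (pd k h) x) := by
      ext y; exact pd_uu hs.sm k y
    change pd k (pd k (uu h)) x = _
    rw [e4]
    exact dd_fderiv_detF hs.sm (hs.sm.pd k) (e k) x
  unfold Lop
  rw [← smul_eq_mul, ← map_smul, e2, e3, Finset.sum_add_distrib]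
  simp

/-- integration by parts -/
lemma ibp1 {n : ℕ} {f φ : E n → ℝ} (hf : ContDiff ℝ 1 f) (hφ : ContDiff ℝ 1 φ) (hc : HasCompactSupport φ) (i : Fin n) :
    ∫ x, f x * pd i φ x = - ∫ x, pd i f x * φ x := by
  have cf := hf.continuous
  have cφ := hφ.continuous
  have cf' : Continuous (pd i f) := (hf.continuous_fderiv one_ne_zero).clm_apply continuous_const
  have cφ' : Continuous (pd i φ) := (hφ.continuous_fderiv one_ne_zero).clm_apply continuous_const
  have hcp : HasCompactSupport (pd i φ) := by
    have := hc.fderiv (𝕜 := ℝ)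
    refine this.mono ?_
    intro x hx
    simp only [Function.mem_support, pd] at hx ⊢
    contrapose! hx; simp [hx]
  exact integral_mul_fderiv_eq_neg_fderiv_mul_of_integrable
    ((cf'.mul cφ).integrable_of_hasCompactSupport (hc.mul_left))
    ((cf.mul cφ').integrable_of_hasCompactSupport (hcp.mul_left))
    ((cf.mul cφ).integrable_of_hasCompactSupport (hc.mul_left))
    (fun x _ => hf.differentiable one_ne_zero x) (fun x _ => hφ.differentiable one_ne_zero x)

lemma ibp {n : ℕ} {b : ℝ} {h w φ : E n → ℝ} (hh : Sm h) (hw : Sm w) (hφ : ContDiff ℝ 1 φ) (hc : HasCompactSupport φ) :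
    ∫ x, bf (am b h x) (fderiv ℝ w x) (fderiv ℝ φ x) = - ∫ x, Lop b h w x * φ x := by
  have cφ := hφ.continuous
  have cφ' : ∀ i, Continuous (pd i φ) := fun i => (hφ.continuous_fderiv one_ne_zero).clm_apply continuous_const
  have hcp : ∀ i, HasCompactSupport (pd i φ) := by
    intro i
    have := hc.fderiv (𝕜 := ℝ)
    refine this.mono ?_
    intro x hx
    simp only [Function.mem_support, pd] at hx ⊢
    contrapose! hx; simp [hx]
  have hsm : ∀ j i, Sm (fun x => am b h x i j * pd i w x) := fun j i => (am_sm hh i j).mul (hw.pd i)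
  have e1 : ∀ x, bf (am b h x) (fderiv ℝ w x) (fderiv ℝ φ x) = ∑ j, (∑ i, am b h x i j * pd i w x) * pd j φ x := by
    intro x
    unfold bf
    rw [Finset.sum_comm]
    refine Finset.sum_congr rfl fun j _ => ?_
    rw [Finset.sum_mul]; rfl
  have hsm2 : ∀ j, Sm (fun x => ∑ i, am b h x i j * pd i w x) := fun j => ContDiff.sum fun i _ => hsm j i
  have e2 : ∀ x, Lop b h w x = ∑ j, pd j (fun x => ∑ i, am b h x i j * pd i w x) x := by
    intro x
    have e3 : ∀ j, pd j (fun x => ∑ i, am b h x i j * pd i w x) x = ∑ i, (am b h x i j * pd j (pd i w) x + pd i w x * pd j (fun x => am b h x i j) x) := by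
      intro j
      change fderiv ℝ (fun x => ∑ i, am b h x i j * pd i w x) x (e j) = _
      rw [fderiv_fun_sum (fun i _ => (hsm j i).diff x)]
      simp only [sum_apply]
      refine Finset.sum_congr rfl fun i _ => ?_
      have := ((am_sm (b := b) hh i j).diff x).hasFDerivAt.fun_mul ((hw.pd i).diff x).hasFDerivAt
      have h5 : fderiv ℝ (fun x => am b h x i j * pd i w x) x = _ := this.fderiv
      rw [h5]; simp only [add_apply, smul_apply, smul_eq_mul]; rfl
    simp only [e3, Finset.sum_add_distrib]
    have e4 : ∑ j, ∑ i, pd i w x * pd j (fun x => am b h x i j) x = 0 := by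
      rw [Finset.sum_comm]
      refine Finset.sum_eq_zero fun i _ => ?_
      rw [← Finset.mul_sum]
      have := piola (b := b) hh x i
      have h6 : ∀ j, (fun x => am b h x i j) = (fun x => am b h x j i) := by
        intro j; ext x; exact am_symm hh x i j
      simp only [h6, this, mul_zero]
    rw [e4, add_zero, Lop_eq]
    refine Finset.sum_congr rfl fun i _ => Finset.sum_congr rfl fun j _ => ?_
    rw [am_symm hh]
  simp only [e1, e2, Finset.sum_mul]
  rw [integral_finsetSum, integral_finsetSum, ← Finset.sum_neg_distrib]
  · refine Finset.sum_congr rfl fun j _ => ?_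
    rw [← ibp1 (hsm2 j).c1 hφ hc]
    simp only [Finset.sum_mul]
  · intro j _
    exact (((hsm2 j).pd j).continuous.mul cφ).integrable_of_hasCompactSupport hc.mul_left
  · intro j _
    have : Continuous (fun x => (∑ i, am b h x i j * pd i w x) * pd j φ x) := (hsm2 j).continuous.mul (cφ' j)
    have h7 := this.integrable_of_hasCompactSupport (μ := volume) (hcp j).mul_left
    simpa only [Finset.sum_mul] using h7

lemma WSub_of_Lop {n : ℕ} {b : ℝ} {h w : E n → ℝ} (hh : Sm h) (hw : Sm w) 
    (hL : ∀ x ∈ ball (0 : E n) 1, 0 ≤ Lop b h w x) : WSub (am b h) w := by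
  intro φ hφ hc hsupp h0
  rw [ibp hh hw hφ hc, neg_nonpos]
  refine integral_nonneg fun x => ?_
  by_cases hx : x ∈ ball (0 : E n) 1
  · exact mul_nonneg (hL x hx) (h0 x)
  · have : φ x = 0 := by
      by_contra h1
      exact hx (hsupp (subset_tsupport _ h1))
    simp [this]

end EK


namespace EK

lemma line_deriv {n : ℕ} {F : Type*} [NormedAddCommGroup F] [NormedSpace ℝ F] {G : (Fin n → Fin n → ℝ) → F}
    (hG : ContDiff ℝ (⊤ : ℕ∞) G) (A X : Fin n → Fin n → ℝ) (t : ℝ) :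
    HasDerivAt (fun t : ℝ => G (A + t • X)) (fderiv ℝ G (A + t • X) X) t := by
  have h2 : HasDerivAt (fun t : ℝ => A + t • X) X t := by
    simpa using ((hasDerivAt_id t).smul_const X).const_add A
  exact (hG.differentiable (by simp) (A + t • X)).hasFDerivAt.comp_hasDerivAt t h2

lemma poly_line {n : ℕ} (A X : Fin n → Fin n → ℝ) (P : Polynomial ℝ) (hP : ∀ t : ℝ, detF (A + t • X) = P.eval t) :
    fderiv ℝ detF A X = P.coeff 1 ∧ D2 A X = 2 * P.coeff 2 := by
  have h0 : ContDiff ℝ (⊤ : ℕ∞) (fderiv ℝ (detF (n := n))) := detF_contDiff.fderiv_right (by exact_mod_cast le_top)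
  have h1 : ∀ t : ℝ, fderiv ℝ detF (A + t • X) X = P.derivative.eval t := by
    intro t
    have h2 := line_deriv detF_contDiff A X t
    have h3 : (fun t : ℝ => detF (A + t • X)) = fun t => P.eval t := by ext t; exact hP t
    rw [h3] at h2
    exact h2.unique (P.hasDerivAt t)
  have h4 : fderiv ℝ (fderiv ℝ detF) A X X = P.derivative.derivative.eval 0 := by
    have h5 := (line_deriv h0 A X 0).clm_apply (hasDerivAt_const (0:ℝ) X)
    have h6 : (fun t : ℝ => fderiv ℝ detF (A + t • X) X) = fun t => P.derivative.eval t := by ext t; exact h1 t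
    rw [h6] at h5
    have h7 := h5.unique (P.derivative.hasDerivAt 0)
    simpa using h7
  constructor
  · have := h1 0
    simp only [zero_smul, add_zero] at this
    rw [this, ← Polynomial.coeff_zero_eq_eval_zero, Polynomial.coeff_derivative]; simp
  · unfold D2
    rw [h4, ← Polynomial.coeff_zero_eq_eval_zero, Polynomial.coeff_derivative, Polynomial.coeff_derivative]
    norm_num; ring

lemma prod_coeff {ι : Type*} (s : Finset ι) (μ : ι → ℝ) :
    (∏ i ∈ s, (1 + Polynomial.C (μ i) * Polynomial.X)).coeff 0 = 1 ∧
    (∏ i ∈ s, (1 + Polynomial.C (μ i) * Polynomial.X)).coeff 1 = ∑ i ∈ s, μ i ∧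
    2 * (∏ i ∈ s, (1 + Polynomial.C (μ i) * Polynomial.X)).coeff 2 = (∑ i ∈ s, μ i) ^ 2 - ∑ i ∈ s, μ i ^ 2 := by
  classical
  induction s using Finset.induction_on with
  | empty => simp [Polynomial.coeff_one]
  | insert a s ha ih =>
    obtain ⟨h0, h1, h2⟩ := ih
    rw [Finset.prod_insert ha, Finset.sum_insert ha, Finset.sum_insert ha]
    set Q := ∏ i ∈ s, (1 + Polynomial.C (μ i) * Polynomial.X)
    have e : (1 + Polynomial.C (μ a) * Polynomial.X) * Q = Q + Polynomial.C (μ a) * (Q * Polynomial.X) := by ring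
    rw [e]
    have c1 : (Q * Polynomial.X).coeff 1 = Q.coeff 0 := Polynomial.coeff_mul_X Q 0
    have c2 : (Q * Polynomial.X).coeff 2 = Q.coeff 1 := Polynomial.coeff_mul_X Q 1
    simp only [Polynomial.coeff_add, Polynomial.coeff_C_mul, Polynomial.coeff_mul_X_zero, c1, c2]
    rw [h0, h1]
    refine ⟨by ring, by ring, by nlinarith [h2]⟩

lemma det_one_add {n : ℕ} (Y : Matrix (Fin n) (Fin n) ℝ) (hY : Y.IsHermitian) (t : ℝ) :
    (1 + t • Y).det = ∏ i, (1 + t * hY.eigenvalues i) := by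
  by_cases ht : t = 0
  · subst ht; simp
  have h1 := Matrix.eval_charpoly Y (-t⁻¹)
  rw [hY.charpoly_eq, Polynomial.eval_prod] at h1
  have h2 : (1 + t • Y) = (-t) • (Matrix.scalar (Fin n) (-t⁻¹) - Y) := by
    ext i j
    simp only [Matrix.add_apply, Matrix.smul_apply, Matrix.sub_apply, Matrix.scalar_apply, Matrix.one_apply, Matrix.diagonal_apply]
    by_cases h : i = j
    · simp [h]; field_simp; ring
    · simp [h]
  rw [h2, Matrix.det_smul, ← h1, Fintype.card_fin]
  have h3 : (-t)^n = ∏ i : Fin n, (-t) := by simp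
  rw [h3, ← Finset.prod_mul_distrib]
  refine Finset.prod_congr rfl fun i _ => ?_
  simp; field_simp; ring

open scoped MatrixOrder in
lemma D2_le {n : ℕ} (hn : 0 < n) (A X : Fin n → Fin n → ℝ) (hA : (Matrix.of A).PosDef) (hX : ∀ i j, X i j = X j i) :
    D2 A X * detF A ≤ (1 - 1 / n) * (fderiv ℝ detF A X) ^ 2 := by
  obtain ⟨B, hB⟩ := CStarAlgebra.nonneg_iff_eq_star_mul_self.mp hA.posSemidef.nonneg
  rw [Matrix.star_eq_conjTranspose] at hB
  have hdet : detF A = B.det ^ 2 := by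
    unfold detF; rw [hB, Matrix.det_mul, Matrix.det_conjTranspose]; simp; ring
  have hpos : 0 < detF A := hA.det_pos
  have hBd : B.det ≠ 0 := by
    intro h; rw [hdet, h] at hpos; simp at hpos
  have hu : IsUnit B.det := isUnit_iff_ne_zero.2 hBd
  set Y := (B⁻¹).conjTranspose * (Matrix.of X) * B⁻¹ with hY
  have hXh : (Matrix.of X).IsHermitian := by
    ext i j; simp [hX i j]
  have hYh : Y.IsHermitian := by
    unfold Matrix.IsHermitian
    rw [hY, Matrix.conjTranspose_mul, Matrix.conjTranspose_mul, Matrix.conjTranspose_conjTranspose, hXh.eq, Matrix.mul_assoc]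
  have hBB : B⁻¹ * B = 1 := Matrix.nonsing_inv_mul B hu
  have hX2 : Matrix.of X = B.conjTranspose * Y * B := by
    have h4 : B.conjTranspose * (B⁻¹).conjTranspose = 1 := by
      rw [← Matrix.conjTranspose_mul, hBB]; simp
    calc Matrix.of X = (B.conjTranspose * (B⁻¹).conjTranspose) * Matrix.of X * (B⁻¹ * B) := by rw [h4, hBB]; simp
      _ = _ := by rw [hY]; simp only [Matrix.mul_assoc]
  set μ := hYh.eigenvalues
  have hP : ∀ t : ℝ, detF (A + t • X) = 
      (Polynomial.C (detF A) * ∏ i, (1 + Polynomial.C (μ i) * Polynomial.X)).eval t := by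
    intro t
    have h5 : Matrix.of (A + t • X) = B.conjTranspose * (1 + t • Y) * B := by
      rw [Matrix.mul_add, Matrix.add_mul, Matrix.mul_one, ← hB, Matrix.mul_smul, Matrix.smul_mul, ← hX2]; rfl
    have h6 : detF (A + t • X) = detF A * (1 + t • Y).det := by
      rw [hdet]
      unfold detF
      rw [h5, Matrix.det_mul, Matrix.det_mul, Matrix.det_conjTranspose]
      simp; ring
    rw [h6, det_one_add Y hYh t, Polynomial.eval_mul, Polynomial.eval_prod]
    simp only [Polynomial.eval_C, Polynomial.eval_add, Polynomial.eval_one, Polynomial.eval_mul, Polynomial.eval_X]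
    congr 1
    refine Finset.prod_congr rfl fun i _ => by ring
  obtain ⟨h7, h8⟩ := poly_line A X _ hP
  obtain ⟨-, c1, c2⟩ := prod_coeff Finset.univ μ
  rw [Polynomial.coeff_C_mul] at h7 h8
  rw [c1] at h7
  rw [h7, h8]
  have hcs : (∑ i, μ i) ^ 2 ≤ n * ∑ i, μ i ^ 2 := by
    have := sq_sum_le_card_mul_sum_sq (s := (Finset.univ : Finset (Fin n))) (f := μ)
    simpa using this
  have hn' : (0:ℝ) < n := by exact_mod_cast hn
  have hcs2 : (1/n) * (∑ i, μ i) ^ 2 ≤ ∑ i, μ i ^ 2 := by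
    rw [div_mul_eq_mul_div, one_mul, div_le_iff₀ hn']; linarith
  have : 2 * (detF A * (∏ i, (1 + Polynomial.C (μ i) * Polynomial.X)).coeff 2) * detF A = 
     detF A ^ 2 * ((∑ i, μ i) ^ 2 - ∑ i, μ i ^ 2) := by rw [← c2]; ring
  rw [this]
  have h9 : 0 ≤ detF A ^ 2 := sq_nonneg _
  nlinarith [mul_le_mul_of_nonneg_left hcs2 h9]

lemma psd_nonneg {n : ℕ} {A : Fin n → Fin n → ℝ} (hA : (Matrix.of A).PosSemidef) (v : Fin n → ℝ) :
    0 ≤ ∑ i, ∑ j, A i j * v i * v j := by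
  have := hA.dotProduct_mulVec_nonneg v
  simp only [star_trivial, dotProduct, Matrix.mulVec, Matrix.of_apply, Finset.mul_sum] at this
  refine this.trans (le_of_eq ?_)
  refine Finset.sum_congr rfl fun i _ => Finset.sum_congr rfl fun j _ => by ring

lemma psd_symm {n : ℕ} {A : Fin n → Fin n → ℝ} (hA : (Matrix.of A).PosSemidef) (i j : Fin n) : A i j = A j i := by
  have := congrFun (congrFun hA.1 j) i
  simpa using this

lemma psd_of {n : ℕ} {A : Fin n → Fin n → ℝ} (h1 : ∀ i j, A i j = A j i) 
    (h : ∀ v : Fin n → ℝ, 0 ≤ ∑ i, ∑ j, A i j * v i * v j) : (Matrix.of A).PosSemidef := by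
  refine Matrix.PosSemidef.of_dotProduct_mulVec_nonneg ?_ ?_
  · ext i j; simp [h1 i j]
  · intro v
    refine (h v).trans (le_of_eq ?_)
    simp only [star_trivial, dotProduct, Matrix.mulVec, Matrix.of_apply, Finset.mul_sum]
    refine Finset.sum_congr rfl fun i _ => Finset.sum_congr rfl fun j _ => by ring

lemma cof_posDef {n : ℕ} {A : Fin n → Fin n → ℝ} (hA : (Matrix.of A).PosDef) (v : Fin n → ℝ) :
    0 ≤ ∑ i, ∑ j, cof i j A * v i * v j := by
  have h1 := hA.inv.posSemidef
  have h2 : (Matrix.of A).adjugate = (Matrix.of A).det • (Matrix.of A)⁻¹ := by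
    rw [Matrix.inv_def, smul_smul, Ring.inverse_eq_inv', mul_inv_cancel₀ hA.det_pos.ne', one_smul]
  have h3 : (Matrix.of A).adjugate.PosSemidef := by
    rw [h2]; exact h1.smul hA.det_pos.le
  have h4 := psd_nonneg (A := (Matrix.of A).adjugate) h3 v
  rw [Finset.sum_comm] at h4
  refine h4.trans (le_of_eq ?_)
  refine Finset.sum_congr rfl fun i _ => Finset.sum_congr rfl fun j _ => ?_
  unfold cof; ring

lemma cof_psd {n : ℕ} {A : Fin n → Fin n → ℝ} (hA : (Matrix.of A).PosSemidef) (v : Fin n → ℝ) :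
    0 ≤ ∑ i, ∑ j, cof i j A * v i * v j := by
  set I : Fin n → Fin n → ℝ := fun i j => if i = j then 1 else 0
  have hc : Continuous fun t : ℝ => ∑ i, ∑ j, cof i j (A + t • I) * v i * v j := by
    refine continuous_finsetSum _ fun i _ => continuous_finsetSum _ fun j _ => ?_
    have : Continuous fun t : ℝ => cof i j (A + t • I) := (cof_contDiff i j).continuous.comp (by fun_prop)
    exact (this.mul continuous_const).mul continuous_const
  have h1 : Tendsto (fun t : ℝ => ∑ i, ∑ j, cof i j (A + t • I) * v i * v j) (𝓝[>] 0) 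
      (𝓝 (∑ i, ∑ j, cof i j (A + (0:ℝ) • I) * v i * v j)) := (hc.tendsto 0).mono_left nhdsWithin_le_nhds
  rw [zero_smul, add_zero] at h1
  refine ge_of_tendsto h1 ?_
  filter_upwards [self_mem_nhdsWithin] with t ht
  have ht' : (0:ℝ) < t := ht
  refine cof_posDef ?_ v
  have h2 : Matrix.of (A + t • I) = Matrix.of A + t • (1 : Matrix (Fin n) (Fin n) ℝ) := by
    ext i j; simp [I, Matrix.one_apply]
  rw [h2]
  exact Matrix.PosDef.posSemidef_add hA (Matrix.PosDef.one.smul ht')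

lemma psd_entry {n : ℕ} {A : Fin n → Fin n → ℝ} (hA : (Matrix.of A).PosSemidef) (ht : trF A ≤ 1) (i j : Fin n) :
    |A i j| ≤ 1 := by
  have hd : ∀ k, 0 ≤ A k k := fun k => hA.diag_nonneg
  have hk : ∀ k, A k k ≤ 1 := fun k => (Finset.single_le_sum (f := fun k => A k k) (fun i _ => hd i) (Finset.mem_univ k)).trans ht
  by_cases hij : i = j
  · subst hij; rw [abs_of_nonneg (hd i)]; exact hk i
  have hq : ∀ s : ℝ, 0 ≤ A i i + 2 * s * A i j + s ^ 2 * A j j := by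
    intro s
    have := psd_nonneg hA (Pi.single i 1 + s • Pi.single j 1)
    have e : ∀ k l, A k l * (Pi.single i 1 + s • Pi.single j (1:ℝ) : Fin n → ℝ) k * (Pi.single i 1 + s • Pi.single j (1:ℝ) : Fin n → ℝ) l = 
       ((if l = i then A k l else 0) + (if l = j then s * A k l else 0)) * ((if k = i then 1 else 0) + (if k = j then s else 0)) := by
      intro k l
      simp only [Pi.add_apply, Pi.smul_apply, Pi.single_apply, smul_eq_mul]
      split_ifs <;> ring
    simp only [e, ← Finset.sum_mul, Finset.sum_add_distrib, Finset.sum_ite_eq', Finset.mem_univ, if_true] at this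
    simp only [mul_add, Finset.sum_add_distrib, mul_ite, mul_one, mul_zero, Finset.sum_ite_eq', Finset.mem_univ, if_true] at this
    rw [psd_symm hA j i] at this
    linarith
  have h1 := hq 1
  have h2 := hq (-1)
  have h3 := hk i
  have h4 := hk j
  rw [abs_le]; constructor <;> linarith

lemma psd_det_le {n : ℕ} {A : Fin n → Fin n → ℝ} (hA : (Matrix.of A).PosSemidef) (ht : trF A ≤ 1) :
    0 ≤ detF A ∧ detF A ≤ 1 := by
  refine ⟨hA.det_nonneg, ?_⟩
  have h0 := hA.eigenvalues_nonneg
  have h1 : ∑ i, hA.1.eigenvalues i ≤ 1 := by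
    have := hA.1.trace_eq_sum_eigenvalues
    have h2 : (Matrix.of A).trace = trF A := rfl
    rw [h2] at this
    rw [this] at ht
    simpa using ht
  have h3 := hA.1.det_eq_prod_eigenvalues
  unfold detF
  rw [h3]
  refine Finset.prod_le_one (fun i _ => by simpa using h0 i) fun i _ => ?_
  have := (Finset.single_le_sum (fun i _ => h0 i) (Finset.mem_univ i)).trans h1
  simpa using this

lemma norm_le_one {n : ℕ} {A : Fin n → Fin n → ℝ} (h : ∀ i j, |A i j| ≤ 1) : ‖A‖ ≤ 1 := by
  refine (pi_norm_le_iff_of_nonneg zero_le_one).2 fun i => (pi_norm_le_iff_of_nonneg zero_le_one).2 fun j => ?_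
  exact h i j

lemma cof_bdd (n : ℕ) : ∃ C > 0, ∀ A : Fin n → Fin n → ℝ, (∀ i j, |A i j| ≤ 1) → ∀ i j, |cof i j A| ≤ C := by
  have : ∀ i j : Fin n, ∃ C, ∀ A ∈ closedBall (0 : Fin n → Fin n → ℝ) 1, ‖cof i j A‖ ≤ C := fun i j =>
    (isCompact_closedBall _ _).exists_bound_of_continuousOn (cof_contDiff i j).continuous.continuousOn
  choose C hC using this
  refine ⟨1 + ∑ i, ∑ j, |C i j|, by positivity, fun A hA i j => ?_⟩
  have h1 := hC i j A (by simpa using norm_le_one hA)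
  have h2 : |C i j| ≤ ∑ j, |C i j| := Finset.single_le_sum (f := fun j => |C i j|) (fun _ _ => abs_nonneg _) (Finset.mem_univ j)
  have h3 : ∑ j, |C i j| ≤ ∑ i, ∑ j, |C i j| := Finset.single_le_sum (f := fun i => ∑ j, |C i j|) (fun _ _ => by positivity) (Finset.mem_univ i)
  have h4 := le_abs_self (C i j)
  rw [Real.norm_eq_abs] at h1
  linarith

lemma Sol.tr_le {n : ℕ} {R b : ℝ} {h : E n → ℝ} (hb : 0 ≤ b) (hs : Sol R b h) : ∀ x ∈ ball (0 : E n) R, trF (Hf h x) ≤ 1 := by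
  intro x hx
  have h1 := hs.eq x hx
  have h2 : 0 ≤ detF (Hf h x) := (hs.psd x hx).det_nonneg
  nlinarith [mul_nonneg hb h2]

/-- ellipticity constant -/
lemma bf_am_lower {n : ℕ} {b : ℝ} (hb : 0 ≤ b) {h : E n → ℝ} {x : E n} (hp : (Matrix.of (Hf h x)).PosSemidef) (ξ : E n →L[ℝ] ℝ) :
    ‖ξ‖ ^ 2 ≤ bf (am b h x) ξ ξ := by
  have h1 := cof_psd hp (fun i => ξ (e i))
  have h2 : bf (am b h x) ξ ξ = ‖ξ‖ ^ 2 + b * ∑ i, ∑ j, cof i j (Hf h x) * ξ (e i) * ξ (e j) := by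
    unfold bf
    rw [norm_sq_dual, Finset.mul_sum, ← Finset.sum_add_distrib]
    refine Finset.sum_congr rfl fun i _ => ?_
    simp only [am_apply, add_mul, Finset.sum_add_distrib, Finset.mul_sum]
    congr 1
    · simp [sq]
    · refine Finset.sum_congr rfl fun j _ => by ring
  rw [h2]
  nlinarith [mul_nonneg hb h1]

lemma dual_le {n : ℕ} (ξ : E n →L[ℝ] ℝ) (i : Fin n) : |ξ (e i)| ≤ ‖ξ‖ := by
  have := ξ.le_opNorm (e i)
  simpa [e] using this

lemma bf_upper {n : ℕ} {c : Matrix (Fin n) (Fin n) ℝ} {K : ℝ} (hc : ∀ i j, |c i j| ≤ K) (ξ η : E n →L[ℝ] ℝ) :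
    |bf c ξ η| ≤ (n * (n * K)) * ‖ξ‖ * ‖η‖ := by
  unfold bf
  have : ∀ i j, |c i j * ξ (e i) * η (e j)| ≤ K * ‖ξ‖ * ‖η‖ := by
    intro i j
    rw [abs_mul, abs_mul]
    have := hc i j
    have h1 := dual_le ξ i
    have h2 := dual_le η j
    gcongr
    exact mul_nonneg ((abs_nonneg _).trans this) (norm_nonneg _)
    exact ((abs_nonneg _).trans this)
  calc |∑ i, ∑ j, c i j * ξ (e i) * η (e j)| ≤ ∑ i, ∑ j, |c i j * ξ (e i) * η (e j)| :=
        (Finset.abs_sum_le_sum_abs _ _).trans (Finset.sum_le_sum fun i _ => Finset.abs_sum_le_sum_abs _ _)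
    _ ≤ ∑ i : Fin n, ∑ j : Fin n, K * ‖ξ‖ * ‖η‖ := Finset.sum_le_sum fun i _ => Finset.sum_le_sum fun j _ => this i j
    _ = _ := by simp; ring

lemma ell_exists (n : ℕ) (b : ℝ) (hb : 0 ≤ b) : ∃ Λ > 0, ∀ h : E n → ℝ, Sol 1 b h → Ell Λ (am b h) := by
  obtain ⟨C, hC, hcof⟩ := cof_bdd n
  refine ⟨n * (n * (1 + b * C)) + 1, by positivity, fun h hs => ⟨fun i j => (am_sm hs.sm i j).continuous, ?_, ?_⟩⟩
  · intro x hx ξ; exact bf_am_lower hb (hs.psd x hx) ξ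
  · intro x hx ξ η
    have h1 : ∀ i j, |am b h x i j| ≤ 1 + b * C := by
      intro i j
      rw [am_apply]
      have h2 := hcof (Hf h x) (psd_entry (hs.psd x hx) (hs.tr_le hb x hx)) i j
      refine (abs_add_le _ _).trans (add_le_add ?_ ?_)
      · split_ifs <;> simp
      · rw [abs_mul, abs_of_nonneg hb]; gcongr
    refine (bf_upper h1 ξ η).trans ?_
    gcongr; linarith

end EK


namespace EK

lemma dd_rpow {n : ℕ} {u : E n → ℝ} (hu : Sm u) (hpos : ∀ x, 0 < u x) (β : ℝ) (v : E n) :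
    dd v (fun x => u x ^ β) = fun x => β * u x ^ (β - 1) * dd v u x := by
  ext x
  unfold dd
  have := ((hu.diff x).hasFDerivAt.rpow_const (p := β) (Or.inl (hpos x).ne')).fderiv
  rw [this]; simp

lemma rpow_sm {n : ℕ} {u : E n → ℝ} (hu : Sm u) (hpos : ∀ x, 0 < u x) (β : ℝ) : Sm (fun x => u x ^ β) :=
  hu.rpow_const_of_ne fun x => (hpos x).ne'

lemma Hf_rpow {n : ℕ} {u : E n → ℝ} (hu : Sm u) (hpos : ∀ x, 0 < u x) (β : ℝ) (x : E n) :
    Hf (fun x => u x ^ β) x = (β * u x ^ (β - 1)) • Hf u x + 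
      (β * (β - 1) * u x ^ (β - 2)) • (fun i j => pd i u x * pd j u x) := by
  ext i j
  unfold Hf
  simp only [pd_eq_dd, Pi.add_apply, Pi.smul_apply, smul_eq_mul]
  rw [dd_rpow hu hpos]
  have h1 := ((((rpow_sm hu hpos (β-1)).diff x).hasFDerivAt.const_mul β).fun_mul ((hu.dd (e j)).diff x).hasFDerivAt).fderiv
  have h2 := congrFun (dd_rpow hu hpos (β - 1) (e i)) x
  unfold dd at h2
  change fderiv ℝ (fun x => β * u x ^ (β - 1) * dd (e j) u x) x (e i) = _
  rw [h1]
  simp only [add_apply, smul_apply, smul_eq_mul, h2]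
  rw [show β - 1 - 1 = β - 2 by ring]
  unfold dd
  ring

lemma tens {n : ℕ} (b : ℝ) (h : E n → ℝ) (x : E n) (ξ : E n →L[ℝ] ℝ) :
    trF (fun i j => ξ (e i) * ξ (e j)) + b * fderiv ℝ detF (Hf h x) (fun i j => ξ (e i) * ξ (e j)) = bf (am b h x) ξ ξ := by
  rw [fderiv_detF, trF, Finset.mul_sum, ← Finset.sum_add_distrib]
  refine Finset.sum_congr rfl fun i _ => ?_
  simp only [am_apply, add_mul, Finset.sum_add_distrib, Finset.mul_sum]
  congr 1
  · simp
  · refine Finset.sum_congr rfl fun j _ => ?_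
    rw [cof]; ring

lemma Lop_rpow {n : ℕ} {b : ℝ} {h u : E n → ℝ} (hu : Sm u) (hpos : ∀ x, 0 < u x) (β : ℝ) (x : E n) :
    Lop b h (fun x => u x ^ β) x = β * u x ^ (β - 1) * Lop b h u x + 
      β * (β - 1) * u x ^ (β - 2) * bf (am b h x) (fderiv ℝ u x) (fderiv ℝ u x) := by
  rw [← tens]
  unfold Lop
  rw [Hf_rpow hu hpos]
  simp only [map_add, map_smul, trF, Pi.add_apply, Pi.smul_apply, smul_eq_mul, Finset.sum_add_distrib, ← Finset.mul_sum]
  unfold pd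
  ring

/-- solution together with auxiliary concave function -/
structure SolU {n : ℕ} (b K : ℝ) (h U : E n → ℝ) : Prop where
  sol : Sol 2 b h
  sm : Sm U
  U0 : ∀ x ∈ ball (0 : E n) 2, 0 ≤ U x
  U1 : ∀ x ∈ ball (0 : E n) 2, U x ≤ 1
  LU : ∀ x ∈ ball (0 : E n) 2, Lop b h U x ≤ 0
  Lh : ∀ v : E n, ‖v‖ ^ 2 ≤ 4 → ∀ x ∈ ball (0 : E n) 2, 0 ≤ Lop b h (fun x => dd v (dd v h) x + (- K) * U x) x

lemma Sol.mono {n : ℕ} {R r b : ℝ} {h : E n → ℝ} (hs : Sol R b h) (hr : r ≤ R) : Sol r b h :=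
  ⟨hs.sm, fun x hx => hs.psd x (ball_subset_ball hr hx), fun x hx => hs.eq x (ball_subset_ball hr hx)⟩

lemma solU_of_zero {n : ℕ} {h : E n → ℝ} (hs : Sol 4 0 h) : SolU 0 0 h (fun _ => 0) := by
  refine ⟨hs.mono (by norm_num), contDiff_const, by simp, by simp, ?_, ?_⟩
  · intro x hx
    have : Hf (fun _ : E n => (0:ℝ)) x = 0 := by ext i j; unfold Hf pd; simp
    unfold Lop; rw [this]; simp [trF]
  · intro v _ x hx
    have := hs.lin2 v x (ball_subset_ball (by norm_num) hx)
    simp only [neg_zero, zero_mul, add_zero]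
    change 0 ≤ Lop 0 h (dd v (dd v h)) x
    rw [this]; simp

lemma solU_of_pos {n : ℕ} (hn : 0 < n) {b : ℝ} (hb : 0 ≤ b) {h : E n → ℝ} (hs : Sol 4 b h) (hpos : ∀ x ∈ ball (0 : E n) 4, 0 < uu h x) :
    ∃ U, SolU b (16 * n ^ 2 * b) h U := by
  obtain ⟨C, -, hcut⟩ := exists_cutoff n
  obtain ⟨χ, hχ, -, hsupp, hχ0, hχ1, hχe, -⟩ := hcut 2 4 (by norm_num) (by norm_num)
  set u : E n → ℝ := fun x => χ x * uu h x + (1 - χ x) with hu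
  have huu := uu_sm hs.sm
  have husm : Sm u := (hχ.mul huu).add (contDiff_const.sub hχ)
  have hup : ∀ x, 0 < u x := by
    intro x
    by_cases hx : x ∈ ball (0 : E n) 4
    · have h1 := hpos x hx
      have h2 := hχ0 x
      have h3 := hχ1 x
      simp only [hu]
      by_cases h4 : χ x = 0
      · rw [h4]; norm_num
      · have h5 : 0 < χ x := lt_of_le_of_ne h2 (Ne.symm h4)
        have := mul_pos h5 h1
        linarith
    · have : χ x = 0 := by
        by_contra h1
        exact hx (hsupp (subset_tsupport _ h1))
      simp [hu, this]
  have hueq : ∀ x ∈ ball (0 : E n) 2, u x = uu h x := by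
    intro x hx
    simp only [hu, hχe x (ball_subset_closedBall hx)]; ring
  have hsub : ball (0 : E n) 2 ⊆ ball 0 4 := ball_subset_ball (by norm_num)
  have hu1 : ∀ x ∈ ball (0 : E n) 2, u x ≤ 1 := by
    intro x hx
    rw [hueq x hx]
    exact (psd_det_le (hs.psd x (hsub hx)) (hs.tr_le hb x (hsub hx))).2
  have hn' : (0:ℝ) < n := by exact_mod_cast hn
  set β : ℝ := 1 / (2 * n) with hβ
  have hβ0 : 0 < β := by positivity
  have hn1 : (1:ℝ) ≤ n := by exact_mod_cast hn
  have hβ1 : β < 1 := by rw [hβ, div_lt_one (by positivity)]; linarith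
  have hD2 : ∀ x ∈ ball (0 : E n) 2, ∀ v, D2 (Hf h x) (Hf (dd v h) x) * u x ≤ (1 - 1 / n) * (dd v u x) ^ 2 := by
    intro x hx v
    rw [hueq x hx]
    have hpd : (Matrix.of (Hf h x)).PosDef := (hs.psd x (hsub hx)).posDef_iff_det_ne_zero.2 (hpos x (hsub hx)).ne'
    have h1 := D2_le hn (Hf h x) (Hf (dd v h) x) hpd (Hf_symm (hs.sm.dd v) x)
    have h2 : fderiv ℝ detF (Hf h x) (Hf (dd v h) x) = dd v u x := by
      rw [← dd_comp_Hf hs.sm detF_contDiff x v]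
      exact (dd_congr isOpen_ball hueq v x hx).symm
    rw [h2] at h1
    exact h1
  have hUL : ∀ x ∈ ball (0 : E n) 2, Lop b h (fun x => u x ^ β) x ≤ - (1 / (4 * n ^ 2)) * (u x ^ (β - 2) * ‖fderiv ℝ u x‖ ^ 2) := by
    intro x hx
    have hux := hup x
    rw [Lop_rpow husm hup]
    have h1 := bf_am_lower hb (hs.psd x (hsub hx)) (fderiv ℝ u x)
    have h2 : Lop b h u x * u x ≤ (1 - 1/n) * ‖fderiv ℝ u x‖ ^ 2 := by
      rw [Lop_congr isOpen_ball hueq x hx, hs.lin_u x (hsub hx), Finset.sum_mul, norm_sq_dual, Finset.mul_sum]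
      exact Finset.sum_le_sum fun k _ => hD2 x hx (e k)
    have h3 : u x ^ (β - 1) = u x ^ (β - 2) * u x := by
      rw [← Real.rpow_add_one hux.ne']; congr 1; ring
    rw [h3]
    set q := u x ^ (β - 2) with hq
    have hq0 : 0 < q := Real.rpow_pos_of_pos hux _
    set N := ‖fderiv ℝ u x‖ ^ 2
    have h4 : β * (q * u x) * Lop b h u x ≤ β * q * ((1 - 1/n) * N) := by
      have := mul_le_mul_of_nonneg_left h2 (mul_pos hβ0 hq0).le
      calc _ = β * q * (Lop b h u x * u x) := by ring
        _ ≤ _ := this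
    have h5 : β * (β - 1) * q * bf (am b h x) (fderiv ℝ u x) (fderiv ℝ u x) ≤ β * (β - 1) * q * N := by
      apply mul_le_mul_of_nonpos_left h1
      have : 0 < β * q := mul_pos hβ0 hq0
      nlinarith
    have h6 : β * q * ((1 - 1/n) * N) + β * (β - 1) * q * N = - (1 / (4 * n ^ 2)) * (q * N) := by
      rw [hβ]; field_simp; ring
    linarith
  refine ⟨fun x => u x ^ β, hs.mono (by norm_num), rpow_sm husm hup β, fun x hx => (Real.rpow_pos_of_pos (hup x) _).le, 
    fun x hx => Real.rpow_le_one (hup x).le (hu1 x hx) hβ0.le, ?_, ?_⟩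
  · intro x hx
    refine (hUL x hx).trans ?_
    have : 0 < u x ^ (β - 2) := Real.rpow_pos_of_pos (hup x) _
    have : 0 ≤ (1 / (4 * (n:ℝ) ^ 2)) * (u x ^ (β - 2) * ‖fderiv ℝ u x‖ ^ 2) := by positivity
    linarith
  · intro v hv x hx
    have hux := hup x
    have hvv := (hs.sm.dd v).dd v
    rw [Lop_add (f := dd v (dd v h)) hvv (contDiff_const.mul (rpow_sm husm hup β)), Lop_smul _ (rpow_sm husm hup β),
      hs.lin2 v x (hsub hx)]
    have h1 := hUL x hx
    have h2 := hD2 x hx v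
    have h3 : (dd v u x) ^ 2 ≤ 4 * ‖fderiv ℝ u x‖ ^ 2 := by
      have h4 : |dd v u x| ≤ ‖fderiv ℝ u x‖ * ‖v‖ := (fderiv ℝ u x).le_opNorm v
      calc (dd v u x) ^ 2 = |dd v u x| ^ 2 := (sq_abs _).symm
        _ ≤ (‖fderiv ℝ u x‖ * ‖v‖) ^ 2 := by gcongr
        _ = ‖v‖ ^ 2 * ‖fderiv ℝ u x‖ ^ 2 := by ring
        _ ≤ _ := by gcongr
    set N := ‖fderiv ℝ u x‖ ^ 2
    have hN : 0 ≤ N := sq_nonneg _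
    set D := D2 (Hf h x) (Hf (dd v h) x)
    set q := u x ^ (β - 2) with hq
    have h5 : 1 ≤ q * u x := by
      rw [hq, ← Real.rpow_add_one hux.ne']
      exact Real.one_le_rpow_of_pos_of_le_one_of_nonpos hux (hu1 x hx) (by linarith)
    have h6 : D * u x ≤ 4 * N := by
      have h8 : 0 ≤ 1 - 1 / (n:ℝ) := by
        rw [sub_nonneg, div_le_one hn']; exact hn1
      have h9 : 0 ≤ 1 / (n:ℝ) := by positivity
      have h7 : (1 - 1 / (n:ℝ)) * (dd v u x) ^ 2 ≤ (dd v u x) ^ 2 := by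
        nlinarith [sq_nonneg (dd v u x)]
      linarith
    have hq0 : 0 < q := Real.rpow_pos_of_pos hux _
    have h7 : D ≤ 4 * (q * N) := by
      by_contra hcon
      push Not at hcon
      have : 4 * (q * N) * u x < D * u x := mul_lt_mul_of_pos_right hcon hux
      have h8 : N ≤ (q * u x) * N := by nlinarith
      nlinarith
    have h8 : - (16 * n ^ 2 * b) * (- (1 / (4 * n ^ 2)) * (q * N)) ≤ - (16 * n ^ 2 * b) * Lop b h (fun x => u x ^ β) x := by
      apply mul_le_mul_of_nonpos_left h1
      have : 0 ≤ 16 * (n:ℝ) ^ 2 * b := by positivity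
      linarith
    have h9 : - (16 * n ^ 2 * b) * (- (1 / (4 * n ^ 2)) * (q * N)) = b * (4 * (q * N)) := by
      field_simp; ring
    have h10 := mul_le_mul_of_nonneg_left h7 hb
    linarith

end EK


namespace EK

lemma dd_sum {n : ℕ} (v : E n) (f : E n → ℝ) (x : E n) : dd v f x = ∑ i, v i * pd i f x := dual_apply_eq _ v

lemma dd_dd_sum {n : ℕ} {h : E n → ℝ} (hh : Sm h) (v w x : E n) :
    dd v (dd w h) x = ∑ i, ∑ j, Hf h x i j * v i * w j := by
  rw [dd_sum]
  refine Finset.sum_congr rfl fun i _ => ?_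
  have : pd i (dd w h) x = dd w (pd i h) x := by rw [pd_eq_dd, dd_comm hh]; rfl
  rw [this, dd_sum, Finset.mul_sum]
  refine Finset.sum_congr rfl fun j _ => ?_
  have : pd j (pd i h) x = Hf h x i j := Hf_symm hh x j i
  rw [this]; ring

lemma min_second {n : ℕ} {f : E n → ℝ} (hf : Sm f) {x : E n} (hm : IsLocalMin f x) (v : E n) :
    0 ≤ dd v (dd v f) x := by
  have hline : ∀ (g : E n → ℝ), Sm g → ∀ t : ℝ, HasDerivAt (fun t : ℝ => g (x + t • v)) (dd v g (x + t • v)) t := by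
    intro g hg t
    have h2 : HasDerivAt (fun t : ℝ => x + t • v) v t := by
      simpa using ((hasDerivAt_id t).smul_const v).const_add x
    exact (hg.diff (x + t • v)).hasFDerivAt.comp_hasDerivAt t h2
  set g : ℝ → ℝ := fun t => f (x + t • v) with hg
  have hg1 : deriv g = fun t => dd v f (x + t • v) := by ext t; exact (hline f hf t).deriv
  have hg2 : deriv (deriv g) 0 = dd v (dd v f) x := by
    rw [hg1, (hline _ (hf.dd v) 0).deriv]; simp
  have hc : Continuous fun t : ℝ => x + t • v := by fun_prop
  have hmin : IsLocalMin g 0 := by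
    have : Tendsto (fun t : ℝ => x + t • v) (𝓝 0) (𝓝 x) := by
      have := hc.tendsto 0; simpa using this
    have h3 := this.eventually hm
    unfold IsLocalMin IsMinFilter
    filter_upwards [h3] with t ht
    simpa [hg] using ht
  have h0 : deriv g 0 = 0 := hmin.deriv_eq_zero
  by_contra hneg
  push Not at hneg
  rw [← hg2] at hneg
  have hmax : IsLocalMax g 0 := isLocalMax_of_deriv_deriv_neg hneg h0 (hline f hf 0).continuousAt
  have hconst : g =ᶠ[𝓝 0] fun _ => g 0 := by
    filter_upwards [hmin, hmax] with t h1 h2 using le_antisymm h2 h1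
  have h5 : deriv g =ᶠ[𝓝 0] fun _ => 0 := by
    have := hconst.deriv
    filter_upwards [this] with t ht
    rw [ht]; simp
  have h6 := h5.deriv_eq
  rw [h6] at hneg
  simp at hneg

open scoped MatrixOrder in
lemma trace_psd {n : ℕ} {c A : Fin n → Fin n → ℝ} (hc : ∀ v : Fin n → ℝ, 0 ≤ ∑ i, ∑ j, c i j * v i * v j)
    (hA : (Matrix.of A).PosSemidef) : 0 ≤ ∑ i, ∑ j, c i j * A i j := by
  obtain ⟨B, hB⟩ := CStarAlgebra.nonneg_iff_eq_star_mul_self.mp hA.nonneg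
  have h1 : ∀ i j, A i j = ∑ k, B k i * B k j := by
    intro i j
    have := congrFun (congrFun hB i) j
    simpa [Matrix.mul_apply, Matrix.star_apply] using this
  have h2 : ∑ i, ∑ j, c i j * A i j = ∑ k, ∑ i, ∑ j, c i j * B k i * B k j := by
    rw [Finset.sum_comm (s := (Finset.univ : Finset (Fin n))) (f := fun k i => ∑ j, c i j * B k i * B k j)]
    refine Finset.sum_congr rfl fun i _ => ?_
    rw [Finset.sum_comm]
    refine Finset.sum_congr rfl fun j _ => ?_
    rw [h1, Finset.mul_sum]
    refine Finset.sum_congr rfl fun k _ => by ring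
  rw [h2]
  exact Finset.sum_nonneg fun k _ => hc _

lemma am_quad {n : ℕ} {b : ℝ} (hb : 0 ≤ b) {h : E n → ℝ} {x : E n} (hp : (Matrix.of (Hf h x)).PosSemidef) (v : Fin n → ℝ) :
    ∑ i, v i ^ 2 ≤ ∑ i, ∑ j, am b h x i j * v i * v j := by
  have h1 := cof_psd hp v
  have h2 : ∑ i, ∑ j, am b h x i j * v i * v j = ∑ i, v i ^ 2 + b * ∑ i, ∑ j, cof i j (Hf h x) * v i * v j := by
    rw [Finset.mul_sum, ← Finset.sum_add_distrib]
    refine Finset.sum_congr rfl fun i _ => ?_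
    simp only [am_apply, add_mul, Finset.sum_add_distrib, Finset.mul_sum]
    congr 1
    · simp [sq]
    · refine Finset.sum_congr rfl fun j _ => by ring
  rw [h2]
  nlinarith [mul_nonneg hb h1]

lemma Lop_nonneg_of_min {n : ℕ} {b : ℝ} (hb : 0 ≤ b) {h f : E n → ℝ} {x : E n} (hp : (Matrix.of (Hf h x)).PosSemidef)
    (hf : Sm f) (hm : IsLocalMin f x) : 0 ≤ Lop b h f x := by
  rw [Lop_eq]
  refine trace_psd (c := am b h x) (A := Hf f x) (fun v => (Finset.sum_nonneg fun i _ => sq_nonneg (v i)).trans (am_quad hb hp v)) ?_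
  refine psd_of (Hf_symm hf x) fun v => ?_
  have := min_second hf hm (WithLp.toLp 2 v)
  rw [dd_dd_sum hf] at this
  exact this

lemma D2_contDiff {n : ℕ} : ContDiff ℝ 1 (fun p : (Fin n → Fin n → ℝ) × (Fin n → Fin n → ℝ) => D2 p.1 p.2) := by
  have h0 : ContDiff ℝ (⊤ : ℕ∞) (fderiv ℝ (detF (n := n))) := detF_contDiff.fderiv_right (by exact_mod_cast le_top)
  have h1 : ContDiff ℝ (⊤ : ℕ∞) (fderiv ℝ (fderiv ℝ (detF (n := n)))) := h0.fderiv_right (by exact_mod_cast le_top)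
  have h2 : ContDiff ℝ 1 (fderiv ℝ (fderiv ℝ (detF (n := n)))) := h1.of_le (by exact_mod_cast le_top)
  unfold D2
  exact ((h2.comp contDiff_fst).clm_apply contDiff_snd).clm_apply contDiff_snd

lemma D2_lip (n : ℕ) (K : ℝ) : ∃ C ≥ 0, ∀ A X A' X' : Fin n → Fin n → ℝ, ‖A‖ ≤ K → ‖X‖ ≤ K → ‖A'‖ ≤ K → ‖X'‖ ≤ K →
    |D2 A X - D2 A' X'| ≤ C * (‖A - A'‖ + ‖X - X'‖) := by
  have hc : Continuous (fderiv ℝ (fun p : (Fin n → Fin n → ℝ) × (Fin n → Fin n → ℝ) => D2 p.1 p.2)) := 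
    D2_contDiff.continuous_fderiv one_ne_zero
  obtain ⟨C, hC⟩ := (isCompact_closedBall (0 : (Fin n → Fin n → ℝ) × (Fin n → Fin n → ℝ)) K).exists_bound_of_continuousOn hc.continuousOn
  refine ⟨|C|, abs_nonneg _, fun A X A' X' hA hX hA' hX' => ?_⟩
  have h1 := Convex.norm_image_sub_le_of_norm_fderiv_le (𝕜 := ℝ) (f := fun p : (Fin n → Fin n → ℝ) × (Fin n → Fin n → ℝ) => D2 p.1 p.2)
    (s := closedBall 0 K) (C := |C|) (x := (A', X')) (y := (A, X)) (fun p _ => D2_contDiff.differentiable one_ne_zero p)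
    (fun p hp => (hC p hp).trans (le_abs_self _)) (convex_closedBall _ _) (by simp [Prod.norm_def, hA', hX']) (by simp [Prod.norm_def, hA, hX])
  refine h1.trans ?_
  gcongr
  rw [Prod.norm_def]
  exact max_le (by simp) (by simp)

lemma mat_norm_le {n : ℕ} {A : Fin n → Fin n → ℝ} {K : ℝ} (hK : 0 ≤ K) (h : ∀ i j, |A i j| ≤ K) : ‖A‖ ≤ K := by
  refine (pi_norm_le_iff_of_nonneg hK).2 fun i => (pi_norm_le_iff_of_nonneg hK).2 fun j => ?_
  exact h i j

lemma entry_le_norm {n : ℕ} (A : Fin n → Fin n → ℝ) (i j : Fin n) : |A i j| ≤ ‖A‖ :=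
  (norm_le_pi_norm (A i) j).trans (norm_le_pi_norm A i)

lemma D2_sing (n : ℕ) (K : ℝ) (hK : 0 ≤ K) : ∃ C ≥ 0, ∀ (A X : Fin n → Fin n → ℝ) (v : Fin n → ℝ) (μ W : ℝ), ‖A‖ ≤ K → ‖X‖ ≤ K → 
    0 ≤ μ → μ ≤ K → (∀ i, |v i| ≤ 1) → ∑ i, v i ^ 2 = 1 → (∀ i j, X i j = X j i) → 
    (∀ i, ∑ j, A i j * v j = μ * v i) → (∀ i, |∑ j, X i j * v j| ≤ W) → W ≤ n * K → 0 ≤ W → |D2 A X| ≤ C * (μ + W) := by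
  obtain ⟨C, hC, hlip⟩ := D2_lip n (K + K + (n + 2) * (n * K))
  refine ⟨C * (n + 2), by positivity, fun A X v μ W hA hX hμ hμK hv hv1 hXs hAe hXe hWK hW => ?_⟩
  set w : Fin n → ℝ := fun i => ∑ j, X i j * v j with hw
  set q : ℝ := ∑ i, w i * v i with hq
  have hq1 : |q| ≤ n * W := by
    calc |q| ≤ ∑ i, |w i * v i| := Finset.abs_sum_le_sum_abs _ _
      _ ≤ ∑ i : Fin n, W := by
        refine Finset.sum_le_sum fun i _ => ?_
        rw [abs_mul]
        have := mul_le_mul (hXe i) (hv i) (abs_nonneg _) hW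
        simpa using this
      _ = n * W := by simp
  set A0 : Fin n → Fin n → ℝ := fun i j => A i j - μ * v i * v j with hA0
  set X0 : Fin n → Fin n → ℝ := fun i j => X i j - v i * w j - w i * v j + q * v i * v j with hX0
  have hvv : ∀ i j, |v i * v j| ≤ 1 := by
    intro i j; rw [abs_mul]; exact mul_le_one₀ (hv i) (abs_nonneg _) (hv j)
  have dA : ‖A - A0‖ ≤ μ := by
    refine mat_norm_le hμ fun i j => ?_
    have : (A - A0) i j = μ * (v i * v j) := by simp [hA0]; ring
    rw [this, abs_mul, abs_of_nonneg hμ]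
    exact mul_le_of_le_one_right hμ (hvv i j)
  have dX : ‖X - X0‖ ≤ (n + 2) * W := by
    refine mat_norm_le (by positivity) fun i j => ?_
    have : (X - X0) i j = v i * w j + w i * v j - q * (v i * v j) := by simp [hX0]; ring
    rw [this]
    have h1 : |v i * w j| ≤ W := by
      rw [abs_mul]; have := mul_le_mul (hv i) (hXe j) (abs_nonneg _) zero_le_one; simpa using this
    have h2 : |w i * v j| ≤ W := by
      rw [abs_mul]; have := mul_le_mul (hXe i) (hv j) (abs_nonneg _) hW; simpa using this
    have h3 : |q * (v i * v j)| ≤ n * W := by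
      rw [abs_mul]; exact (mul_le_of_le_one_right (abs_nonneg _) (hvv i j)).trans hq1
    rw [abs_le] at *
    constructor <;> linarith
  have nX0 : ‖X0‖ ≤ K + K + (n + 2) * (n * K) := by
    have : X0 = X - (X - X0) := by abel
    rw [this]
    refine (norm_sub_le _ _).trans ?_
    have : (n + 2) * W ≤ (n + 2) * (n * K) := by gcongr
    linarith
  have nA0 : ‖A0‖ ≤ K + K + (n + 2) * (n * K) := by
    have : A0 = A - (A - A0) := by abel
    rw [this]
    refine (norm_sub_le _ _).trans ?_
    have : 0 ≤ (n + 2) * (n * K) := by positivity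
    linarith
  have hbig : K ≤ K + K + (n + 2) * (n * K) := by
    have : 0 ≤ (n + 2) * (n * K) := by positivity
    linarith
  have h1 := hlip A X A0 X0 (hA.trans hbig) (hX.trans hbig) nA0 nX0
  have hz : D2 A0 X0 = 0 := by
    have hP : ∀ t : ℝ, detF (A0 + t • X0) = (0 : Polynomial ℝ).eval t := by
      intro t
      rw [Polynomial.eval_zero]
      unfold detF
      refine Matrix.exists_mulVec_eq_zero_iff.1 ⟨v, ?_, ?_⟩
      · intro h; rw [h] at hv1; simp at hv1
      · ext i
        simp only [Matrix.mulVec, dotProduct, Matrix.of_apply, Pi.add_apply, Pi.smul_apply, smul_eq_mul, Pi.zero_apply]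
        have e1 : ∀ j, (A0 i j + t * X0 i j) * v j = A i j * v j - μ * v i * v j ^ 2 + t * (X i j * v j - v i * (w j * v j) - w i * v j ^ 2 + q * v i * v j ^ 2) := by
          intro j; simp only [hA0, hX0]; ring
        simp only [e1, Finset.sum_add_distrib, Finset.sum_sub_distrib, ← Finset.mul_sum, hv1, hAe]
        have e2 : ∑ j, X i j * v j = w i := rfl
        rw [e2, ← hq]; ring
    have := (poly_line A0 X0 0 hP).2
    simpa using this
  rw [hz, sub_zero] at h1
  refine h1.trans ?_
  rw [mul_assoc]
  gcongr
  have : μ ≤ (n + 2) * μ := by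
    have : (0:ℝ) ≤ n := Nat.cast_nonneg n
    nlinarith
  nlinarith

/-- barrier -/
noncomputable def barr {n : ℕ} (ε a c : ℝ) (y x : E n) : ℝ := ε * (Real.exp (-a * ‖x - y‖ ^ 2) - c)

lemma barr_sm {n : ℕ} (ε a c : ℝ) (y : E n) : Sm (barr ε a c y) := by
  unfold barr
  have : ContDiff ℝ (⊤ : ℕ∞) (fun x : E n => ‖x - y‖ ^ 2) := (contDiff_id.sub contDiff_const).norm_sq ℝ
  exact contDiff_const.mul ((contDiff_const.mul this).exp.sub contDiff_const)

lemma pd_exp {n : ℕ} (a : ℝ) (y x : E n) (j : Fin n) :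
    pd j (fun x => Real.exp (-a * ‖x - y‖ ^ 2)) x = Real.exp (-a * ‖x - y‖ ^ 2) * (-2 * a * (x j - y j)) := by
  have h1 : HasFDerivAt (fun x : E n => x - y) (ContinuousLinearMap.id ℝ (E n)) x := (hasFDerivAt_id x).sub_const y
  have h2 := (h1.norm_sq.const_mul (-a)).exp
  unfold pd
  rw [h2.fderiv]
  simp only [smul_apply, ContinuousLinearMap.comp_apply, smul_eq_mul]
  have h3 : ∀ z : E n, inner ℝ z (e j) = z j := by
    intro z
    rw [e, EuclideanSpace.inner_single_right]; simp
  simp [inner_sub_left, h3]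
  ring

lemma pd_barr {n : ℕ} (ε a c : ℝ) (y x : E n) (j : Fin n) :
    pd j (barr ε a c y) x = ε * (Real.exp (-a * ‖x - y‖ ^ 2) * (-2 * a * (x j - y j))) := by
  rw [← pd_exp]
  have h0 : ContDiff ℝ (⊤ : ℕ∞) (fun x : E n => ‖x - y‖ ^ 2) := (contDiff_id.sub contDiff_const).norm_sq ℝ
  have h1 : Sm (fun x : E n => Real.exp (-a * ‖x - y‖ ^ 2)) := (contDiff_const.mul h0).exp
  have h2 := (((h1.diff x).hasFDerivAt.sub_const c).const_mul ε).fderiv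
  change fderiv ℝ (fun x => ε * (Real.exp (-a * ‖x - y‖ ^ 2) - c)) x (e j) = _
  rw [h2]; rfl

lemma Hf_barr {n : ℕ} (ε a c : ℝ) (y x : E n) (i j : Fin n) :
    Hf (barr ε a c y) x i j = ε * Real.exp (-a * ‖x - y‖ ^ 2) * (4 * a ^ 2 * (x i - y i) * (x j - y j) - 2 * a * (if i = j then 1 else 0)) := by
  have e1 : pd j (barr ε a c y) = fun x => ε * (Real.exp (-a * ‖x - y‖ ^ 2) * (-2 * a * (x j - y j))) := by
    ext x; exact pd_barr ε a c y x j
  unfold Hf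
  rw [e1]
  have h0 : ContDiff ℝ (⊤ : ℕ∞) (fun x : E n => ‖x - y‖ ^ 2) := (contDiff_id.sub contDiff_const).norm_sq ℝ
  have h1 : Sm (fun x : E n => Real.exp (-a * ‖x - y‖ ^ 2)) := (contDiff_const.mul h0).exp
  have h3 : HasFDerivAt (fun x : E n => x j) (EuclideanSpace.proj j : E n →L[ℝ] ℝ) x := (EuclideanSpace.proj j : E n →L[ℝ] ℝ).hasFDerivAt
  have h2 := (((h1.diff x).hasFDerivAt.fun_mul ((h3.sub_const (y j)).const_mul (-2 * a))).const_mul ε).fderiv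
  have h4 := pd_exp a y x i
  unfold pd at h4
  unfold pd
  rw [h2]
  simp only [add_apply, smul_apply, smul_eq_mul, h4]
  have h5 : (EuclideanSpace.proj j : E n →L[ℝ] ℝ) (e i) = if i = j then 1 else 0 := by
    simp [e, Pi.single_apply, eq_comm]
  rw [h5]; ring

end EK


namespace EK

/-- quadratic form -/
noncomputable def qf {n : ℕ} (A : Fin n → Fin n → ℝ) (v : Fin n → ℝ) : ℝ := ∑ i, ∑ j, A i j * v i * v j

lemma psd_zero {n : ℕ} {A : Fin n → Fin n → ℝ} (hA : (Matrix.of A).PosSemidef) {v : Fin n → ℝ} (h : qf A v = 0) (i : Fin n) :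
    ∑ j, A i j * v j = 0 := by
  have h1 : dotProduct (star v) ((Matrix.of A).mulVec v) = 0 := by
    rw [← h]
    simp only [qf, star_trivial, dotProduct, Matrix.mulVec, Matrix.of_apply, Finset.mul_sum]
    refine Finset.sum_congr rfl fun i _ => Finset.sum_congr rfl fun j _ => by ring
  have h2 := (hA.dotProduct_mulVec_zero_iff v).1 h1
  simpa [Matrix.mulVec, dotProduct] using congrFun h2 i

lemma qf_smul {n : ℕ} (A : Fin n → Fin n → ℝ) (c : ℝ) (v : Fin n → ℝ) : qf A (fun i => c * v i) = c ^ 2 * qf A v := by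
  simp only [qf, Finset.mul_sum]
  refine Finset.sum_congr rfl fun i _ => Finset.sum_congr rfl fun j _ => by ring

lemma min_eigen {n : ℕ} {A : Fin n → Fin n → ℝ} (hs : ∀ i j, A i j = A j i) {v : Fin n → ℝ} (hv : ∑ i, v i ^ 2 = 1)
    (hmin : ∀ w : Fin n → ℝ, ∑ i, w i ^ 2 = 1 → qf A v ≤ qf A w) (i : Fin n) : ∑ j, A i j * v j = qf A v * v i := by
  set μ := qf A v with hμ
  set B : Fin n → Fin n → ℝ := fun i j => A i j - μ * (if i = j then 1 else 0) with hB
  have hBq : ∀ w, qf B w = qf A w - μ * ∑ i, w i ^ 2 := by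
    intro w
    simp only [qf, hB]
    rw [Finset.mul_sum, ← Finset.sum_sub_distrib]
    refine Finset.sum_congr rfl fun i _ => ?_
    have : ∀ j, (A i j - μ * (if i = j then 1 else 0)) * w i * w j = A i j * w i * w j - (if i = j then μ * w i * w j else 0) := by
      intro j; split_ifs <;> ring
    simp only [this, Finset.sum_sub_distrib]
    simp; ring
  have hp : (Matrix.of B).PosSemidef := by
    refine psd_of ?_ ?_
    · intro i j; simp only [hB, hs i j, eq_comm]
    · intro w
      change 0 ≤ qf B w
      rw [hBq]
      set s := ∑ i, w i ^ 2 with hsd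
      have s0 : 0 ≤ s := Finset.sum_nonneg fun i _ => sq_nonneg _
      rcases s0.eq_or_lt with h0 | h0
      · have hw : ∀ i, w i = 0 := by
          intro i
          have := (Finset.sum_eq_zero_iff_of_nonneg (fun i _ => sq_nonneg (w i))).1 h0.symm i (Finset.mem_univ i)
          simpa using this
        rw [← h0]; simp [qf, hw]
      · have h1 : ∑ i, ((√s)⁻¹ * w i) ^ 2 = 1 := by
          simp only [mul_pow, ← Finset.mul_sum, inv_pow, Real.sq_sqrt s0, ← hsd]
          exact inv_mul_cancel₀ h0.ne'
        have h2 := hmin _ h1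
        rw [qf_smul, inv_pow, Real.sq_sqrt s0, inv_mul_eq_div, le_div_iff₀ h0] at h2
        linarith
  have h0 : qf B v = 0 := by rw [hBq, hv]; ring
  have := psd_zero hp h0 i
  simp only [hB, sub_mul, Finset.sum_sub_distrib] at this
  simp at this
  linarith

lemma sum_sq_norm {n : ℕ} (v : E n) : ∑ i, v i ^ 2 = ‖v‖ ^ 2 := by
  rw [EuclideanSpace.norm_sq_eq]; simp

lemma Lop_barr {n : ℕ} {b : ℝ} (hb : 0 ≤ b) {h : E n → ℝ} {x : E n} (hp : (Matrix.of (Hf h x)).PosSemidef) {Λ : ℝ}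
    (hΛ : ∑ i, am b h x i i ≤ Λ) {ε a c : ℝ} (y : E n) (hε : 0 ≤ ε) (ha : 0 ≤ a) :
    ε * Real.exp (-a * ‖x - y‖ ^ 2) * (4 * a ^ 2 * ‖x - y‖ ^ 2 - 2 * a * Λ) ≤ Lop b h (barr ε a c y) x := by
  rw [Lop_eq]
  have h1 : ∑ i, ∑ j, am b h x i j * pd i (pd j (barr ε a c y)) x =
      ε * Real.exp (-a * ‖x - y‖ ^ 2) * (4 * a ^ 2 * (∑ i, ∑ j, am b h x i j * (x - y) i * (x - y) j) - 2 * a * ∑ i, am b h x i i) := by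
    rw [Finset.mul_sum (a := 4 * a ^ 2), Finset.mul_sum (a := 2 * a), ← Finset.sum_sub_distrib, Finset.mul_sum]
    refine Finset.sum_congr rfl fun i _ => ?_
    have : ∀ j, am b h x i j * pd i (pd j (barr ε a c y)) x = ε * Real.exp (-a * ‖x - y‖ ^ 2) * (4 * a ^ 2 * (am b h x i j * (x - y) i * (x - y) j)) -
      (if i = j then ε * Real.exp (-a * ‖x - y‖ ^ 2) * (2 * a * am b h x i j) else 0) := by
      intro j
      have := Hf_barr ε a c y x i j
      unfold Hf at this
      rw [this]
      simp only [PiLp.sub_apply]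
      split_ifs <;> ring
    simp only [this, Finset.sum_sub_distrib]
    rw [← Finset.mul_sum, ← Finset.mul_sum]
    simp; ring
  rw [h1]
  have h2 := am_quad hb hp (x - y).ofLp
  rw [sum_sq_norm] at h2
  gcongr

lemma contra_min {n : ℕ} {R b : ℝ} (hb : 0 ≤ b) {h : E n → ℝ} (hs : Sol R b h) (Λ C K : ℝ) (hK : 1 ≤ K)
    (hC : ∀ (A X : Fin n → Fin n → ℝ) (v : Fin n → ℝ) (μ W : ℝ), ‖A‖ ≤ K → ‖X‖ ≤ K → 
    0 ≤ μ → μ ≤ K → (∀ i, |v i| ≤ 1) → ∑ i, v i ^ 2 = 1 → (∀ i j, X i j = X j i) → 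
    (∀ i, ∑ j, A i j * v j = μ * v i) → (∀ i, |∑ j, X i j * v j| ≤ W) → W ≤ n * K → 0 ≤ W → |D2 A X| ≤ C * (μ + W)) (hC0 : 0 ≤ C)
    {x y v : E n} (hx : x ∈ ball (0 : E n) R) (hΛ : ∑ i, am b h x i i ≤ Λ)
    (hv : ‖v‖ = 1) (hX : ‖Hf (dd v h) x‖ ≤ K) {ε a c R1 : ℝ} (hε : 0 < ε) (hε1 : ε ≤ 1) (ha : 0 < a) (hc : 0 ≤ c)
    (hr1 : R1 / 2 ≤ ‖x - y‖) (hr2 : ‖x - y‖ ≤ 2 * R1) (hR1 : 0 < R1)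
    (hmin : IsLocalMin (fun x => dd v (dd v h) x + (-1) * barr ε a c y x) x)
    (hvm : ∀ w : Fin n → ℝ, ∑ i, w i ^ 2 = 1 → qf (Hf h x) v ≤ qf (Hf h x) w) (hle : qf (Hf h x) v ≤ barr ε a c y x) :
    a ^ 2 * R1 ^ 2 - 2 * a * Λ ≤ b * C * (1 + 4 * a * R1) := by
  set μ := qf (Hf h x) v with hμ
  set T := ε * Real.exp (-a * ‖x - y‖ ^ 2) with hT
  have hT0 : 0 < T := by positivity
  have hexp : Real.exp (-a * ‖x - y‖ ^ 2) ≤ 1 := by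
    rw [Real.exp_le_one_iff]; nlinarith [sq_nonneg ‖x - y‖]
  have hμT : μ ≤ T := by
    refine hle.trans ?_
    unfold barr; rw [hT]; nlinarith
  have hT1 : T ≤ 1 := by
    rw [hT]; nlinarith [Real.exp_pos (-a * ‖x - y‖ ^ 2)]
  have hp := hs.psd x hx
  have hμ0 : 0 ≤ μ := psd_nonneg hp v
  have hv1 : ∑ i, v i ^ 2 = 1 := by rw [sum_sq_norm, hv]; norm_num
  have hvi : ∀ i, |v i| ≤ 1 := by
    intro i
    have := PiLp.norm_apply_le v i
    rw [hv] at this; exact this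
  have heig := min_eigen (psd_symm hp) hv1 hvm
  have smv := (hs.sm.dd v).dd v
  have smb := barr_sm ε a c y
  have smf : Sm (fun x => dd v (dd v h) x + (-1) * barr ε a c y x) := smv.add (contDiff_const.mul smb)
  have hL := Lop_nonneg_of_min hb hp smf hmin
  rw [Lop_add smv (contDiff_const.mul smb), Lop_smul _ smb, hs.lin2 v x hx] at hL
  have hL2 := Lop_barr (c := c) hb hp hΛ y hε.le ha.le
  -- gradient
  have hgrad : ∀ i, ∑ j, Hf (dd v h) x i j * v j = pd i (barr ε a c y) x := by
    intro i
    have h0 : fderiv ℝ (fun x => dd v (dd v h) x + (-1) * barr ε a c y x) x = 0 := hmin.fderiv_eq_zero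
    have h1 := ((smv.diff x).hasFDerivAt.add ((smb.diff x).hasFDerivAt.const_mul (-1))).fderiv
    have h2 : fderiv ℝ (dd v (dd v h)) x = fderiv ℝ (barr ε a c y) x := by
      have h3 : fderiv ℝ (dd v (dd v h)) x + (-1 : ℝ) • fderiv ℝ (barr ε a c y) x = 0 := h1.symm.trans h0
      rw [neg_one_smul, add_neg_eq_zero] at h3; exact h3
    unfold pd
    rw [← h2]
    change _ = dd (e i) (dd v (dd v h)) x
    rw [dd_dd_sum (hs.sm.dd v)]
    refine Eq.trans ?_ (Finset.sum_eq_single i ?_ ?_).symm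
    · refine Finset.sum_congr rfl fun j _ => ?_
      simp [e]
    · intro k _ hk; simp [e, hk]
    · simp
  set W := ‖fun i => pd i (barr ε a c y) x‖ with hW
  have hW1 : W ≤ T * (4 * a * R1) := by
    refine (pi_norm_le_iff_of_nonneg (by positivity)).2 fun i => ?_
    rw [pd_barr, Real.norm_eq_abs, ← mul_assoc, ← hT, abs_mul, abs_of_pos hT0]
    gcongr
    have : |x i - y i| ≤ ‖x - y‖ := by
      have := PiLp.norm_apply_le (x - y) i
      simpa using this
    rw [abs_mul, abs_of_nonpos (by linarith)]
    nlinarith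
  have hW2 : W ≤ n * K := by
    refine (pi_norm_le_iff_of_nonneg (by positivity)).2 fun i => ?_
    rw [← hgrad, Real.norm_eq_abs]
    refine (Finset.abs_sum_le_sum_abs _ _).trans ?_
    calc ∑ j, |Hf (dd v h) x i j * v j| ≤ ∑ j : Fin n, K := by
          refine Finset.sum_le_sum fun j _ => ?_
          rw [abs_mul]
          have h1 : |Hf (dd v h) x i j| ≤ K := ((norm_le_pi_norm (Hf (dd v h) x i) j).trans (norm_le_pi_norm (Hf (dd v h) x) i)).trans hX
          have := mul_le_mul h1 (hvi j) (abs_nonneg _) (by linarith)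
          simpa using this
      _ = n * K := by simp
  have hA : ‖Hf h x‖ ≤ K := (norm_le_one (psd_entry hp (hs.tr_le hb x hx))).trans hK
  have hD := hC (Hf h x) (Hf (dd v h) x) v μ W hA hX hμ0 (by linarith) hvi hv1 (Hf_symm (hs.sm.dd v) x) heig
    (fun i => by rw [hgrad]; exact norm_le_pi_norm (fun i => pd i (barr ε a c y) x) i) hW2 (norm_nonneg _)
  have hD2 : - D2 (Hf h x) (Hf (dd v h) x) ≤ C * (T * (1 + 4 * a * R1)) := by
    refine (neg_le_abs _).trans (hD.trans ?_)
    gcongr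
    linarith
  have hfin : T * (4 * a ^ 2 * ‖x - y‖ ^ 2 - 2 * a * Λ) ≤ T * (b * C * (1 + 4 * a * R1)) := by
    have := mul_le_mul_of_nonneg_left hD2 hb
    nlinarith
  have h5 := le_of_mul_le_mul_left hfin hT0
  have h6 : R1 ^ 2 ≤ 4 * ‖x - y‖ ^ 2 := by nlinarith
  nlinarith [mul_le_mul_of_nonneg_left h6 (sq_nonneg a)]

end EK


namespace EK

lemma qf_pos {n : ℕ} {A : Fin n → Fin n → ℝ} (hA : (Matrix.of A).PosSemidef) (hd : detF A ≠ 0) {v : Fin n → ℝ} (hv : v ≠ 0) :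
    0 < qf A v := by
  refine lt_of_le_of_ne (psd_nonneg hA v) fun h => hd ?_
  refine Matrix.exists_mulVec_eq_zero_iff.1 ⟨v, hv, ?_⟩
  ext i
  simpa [Matrix.mulVec, dotProduct] using psd_zero hA h.symm i

lemma exists_null {n : ℕ} {A : Fin n → Fin n → ℝ} (hd : detF A = 0) : ∃ v : E n, ‖v‖ = 1 ∧ qf A v = 0 := by
  obtain ⟨v, hv, h⟩ := Matrix.exists_mulVec_eq_zero_iff.2 (show (Matrix.of A).det = 0 from hd)
  set w : E n := WithLp.toLp 2 v
  have hw : w ≠ 0 := by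
    intro h0; apply hv; ext i; exact congrArg (fun z : E n => z i) h0
  refine ⟨‖w‖⁻¹ • w, by rw [norm_smul, norm_inv, norm_norm, inv_mul_cancel₀ (norm_ne_zero_iff.2 hw)], ?_⟩
  have h1 : qf A v = 0 := by
    unfold qf
    refine Finset.sum_eq_zero fun i _ => ?_
    have := congrFun h i
    simp [Matrix.mulVec, dotProduct] at this
    have h2 : ∑ j, A i j * v i * v j = v i * ∑ j, A i j * v j := by
      rw [Finset.mul_sum]; exact Finset.sum_congr rfl fun j _ => by ring
    rw [h2, this, mul_zero]
  have h2 := qf_smul A (‖w‖⁻¹) v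
  rw [h1, mul_zero] at h2
  exact h2

lemma qf_continuous {n : ℕ} {h : E n → ℝ} (hh : Sm h) : Continuous fun p : E n × E n => qf (Hf h p.1) p.2 := by
  unfold qf
  have h1 : ∀ i j, Continuous fun x => Hf h x i j := fun i j => ((hh.pd j).pd i).continuous
  refine continuous_finsetSum _ fun i _ => continuous_finsetSum _ fun j _ => ?_
  have := h1 i j
  fun_prop

lemma quad_large (p q r : ℝ) (hp : 0 < p) : ∃ a > 0, q * a + r < a ^ 2 * p := by
  refine ⟨(|q| + |r|) / p + 1, by positivity, ?_⟩
  set a := (|q| + |r|) / p + 1 with ha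
  have h1 : 1 ≤ a := by rw [ha]; have : 0 ≤ (|q| + |r|) / p := by positivity
                        linarith
  have h2 : a * p = |q| + |r| + p := by rw [ha]; field_simp
  have h3 : a ^ 2 * p = a * (|q| + |r| + p) := by rw [← h2]; ring
  rw [h3]
  have := le_abs_self q
  have := le_abs_self r
  have := abs_nonneg r
  have := abs_nonneg q
  nlinarith

set_option maxHeartbeats 800000 in
lemma hopf_contra {n : ℕ} {R b : ℝ} (hb : 0 ≤ b) {h : E n → ℝ} (hs : Sol R b h) {x0 y : E n} {R1 : ℝ} (hR1 : 0 < R1)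
    (hx0 : x0 ∈ ball (0 : E n) R) (hz : uu h x0 = 0) (hd : ‖x0 - y‖ = R1) 
    (hpos : ∀ x ∈ ball (0 : E n) R, ‖x - y‖ ≤ R1 → x ≠ x0 → uu h x ≠ 0) : False := by
  obtain ⟨s0, hs0, hsub⟩ := Metric.isOpen_iff.1 isOpen_ball x0 hx0
  set s := min (s0 / 2) (R1 / 2) with hsdef
  have hspos : 0 < s := by positivity
  have hsR : s ≤ R1 / 2 := min_le_right _ _
  have hN : closedBall x0 s ⊆ ball (0 : E n) R := by
    refine (closedBall_subset_ball ?_).trans hsub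
    have : s ≤ s0 / 2 := min_le_left _ _
    linarith
  have hcN : IsCompact (closedBall x0 s) := isCompact_closedBall _ _
  obtain ⟨K0, hK0⟩ := hcN.exists_bound_of_continuousOn (f := fderiv ℝ (Hf h)) ((Hf_sm hs.sm).continuous_fderiv (by simp)).continuousOn
  set K := max K0 1 with hK
  have hK1 : 1 ≤ K := le_max_right _ _
  have hXK : ∀ x ∈ closedBall x0 s, ∀ v : E n, ‖v‖ = 1 → ‖Hf (dd v h) x‖ ≤ K := by
    intro x hx v hv
    rw [← fderiv_Hf hs.sm]
    refine ((fderiv ℝ (Hf h) x).le_opNorm v).trans ?_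
    rw [hv, mul_one]; exact (hK0 x hx).trans (le_max_left _ _)
  obtain ⟨C, hC0, hC⟩ := D2_sing n K (by linarith)
  obtain ⟨Λ, hΛ⟩ := hcN.exists_bound_of_continuousOn (f := fun x => ∑ i, am b h x i i)
    (continuous_finsetSum _ fun i _ => (am_sm hs.sm i i).continuous).continuousOn
  obtain ⟨a, ha, hbig⟩ := quad_large (R1 ^ 2) (2 * Λ + b * C * 4 * R1) (b * C) (by positivity)
  -- the constant m
  have hcS : IsCompact (sphere (0 : E n) 1) := isCompact_sphere _ _
  have hcT : IsCompact ((sphere x0 s ∩ closedBall y R1) ×ˢ sphere (0 : E n) 1) := ((isCompact_sphere _ _).inter_right isClosed_closedBall).prod hcS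
  obtain ⟨m, hm0, hm⟩ := hcT.exists_forall_le' (f := fun p : E n × E n => qf (Hf h p.1) p.2) (a := 0) (qf_continuous hs.sm).continuousOn (by
    rintro ⟨x, v⟩ ⟨⟨hx1, hx2⟩, hv⟩
    have hxN : x ∈ closedBall x0 s := sphere_subset_closedBall hx1
    refine qf_pos (hs.psd x (hN hxN)) (hpos x (hN hxN) ?_ ?_) ?_
    · simpa [dist_eq_norm] using hx2
    · rintro rfl; simp at hx1; linarith
    · intro h0
      have : v = 0 := by ext i; exact congrFun h0 i
      simp [this] at hv)
  set ε := min (m / 2) 1 with hε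
  have hε0 : 0 < ε := by positivity
  have hε1 : ε ≤ 1 := min_le_right _ _
  have hεm : ε < m := by have : ε ≤ m / 2 := min_le_left _ _
                         linarith
  set c := Real.exp (-a * R1 ^ 2) with hc
  have hc0 : 0 < c := Real.exp_pos _
  set φ := barr ε a c y with hφ
  have hφc : Continuous φ := (barr_sm ε a c y).continuous
  have hcont : Continuous fun p : E n × E n => qf (Hf h p.1) p.2 - φ p.1 := (qf_continuous hs.sm).sub (hφc.comp continuous_fst)
  obtain ⟨v0, hv0, hq0⟩ := exists_null hz
  obtain ⟨⟨x, v⟩, ⟨hxN, hvS⟩, hmin⟩ := (hcN.prod hcS).exists_isMinOn ⟨(x0, v0), mem_closedBall_self hspos.le, by simpa using hv0⟩ hcont.continuousOn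
  have hmin' : ∀ x' ∈ closedBall x0 s, ∀ v' : E n, ‖v'‖ = 1 → qf (Hf h x) v - φ x ≤ qf (Hf h x') v' - φ x' := by
    intro x' hx' v' hv'
    exact isMinOn_iff.1 hmin (x', v') (mk_mem_prod hx' (by simpa using hv'))
  simp only at hxN hvS
  have hv : ‖v‖ = 1 := by simpa using hvS
  have hφ0 : φ x0 = 0 := by rw [hφ, barr, hd, hc]; ring
  have hle : qf (Hf h x) v ≤ φ x := by
    have := hmin' x0 (mem_closedBall_self hspos.le) v0 hv0
    rw [hq0, hφ0] at this; linarith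
  have hxB : x ∈ ball (0 : E n) R := hN hxN
  have hin : x ∈ ball x0 s := by
    by_contra hnb
    have hsph : x ∈ sphere x0 s := by
      rw [mem_sphere]; rw [mem_closedBall] at hxN; rw [mem_ball] at hnb; linarith
    by_cases hxy : ‖x - y‖ ≤ R1
    · have h1 : m ≤ qf (Hf h x) v := hm (x, v) ⟨⟨hsph, by simpa [dist_eq_norm] using hxy⟩, hvS⟩
      have h2 : φ x ≤ ε := by
        rw [hφ, barr]
        have hexp : Real.exp (-a * ‖x - y‖ ^ 2) ≤ 1 := by
          rw [Real.exp_le_one_iff]; nlinarith [sq_nonneg ‖x - y‖]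
        nlinarith
      linarith
    · push Not at hxy
      have h1 : 0 ≤ qf (Hf h x) v := psd_nonneg (hs.psd x hxB) v
      have h2 : φ x < 0 := by
        rw [hφ, barr]
        have hexp : Real.exp (-a * ‖x - y‖ ^ 2) < c := by
          rw [hc, Real.exp_lt_exp]
          have : R1 ^ 2 < ‖x - y‖ ^ 2 := by gcongr
          nlinarith
        nlinarith
      linarith
  have hdx : ‖x - x0‖ ≤ R1 / 2 := by
    have : ‖x - x0‖ ≤ s := by simpa [dist_eq_norm] using hxN
    linarith
  have hr1 : R1 / 2 ≤ ‖x - y‖ := by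
    have h1 := norm_sub_norm_le (x0 - y) (x0 - x)
    have h2 : x0 - y - (x0 - x) = x - y := by abel
    rw [h2, hd, norm_sub_rev x0 x] at h1; linarith
  have hr2 : ‖x - y‖ ≤ 2 * R1 := by
    have h1 := norm_add_le (x - x0) (x0 - y)
    have h2 : x - x0 + (x0 - y) = x - y := by abel
    rw [h2, hd] at h1; linarith
  have hlm : IsLocalMin (fun x => dd v (dd v h) x + (-1) * barr ε a c y x) x := by
    filter_upwards [isOpen_ball.mem_nhds hin] with x' hx'
    have := hmin' x' (ball_subset_closedBall hx') v hv
    rw [dd_dd_sum hs.sm, dd_dd_sum hs.sm]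
    unfold qf at this
    linarith
  have hvm : ∀ w : Fin n → ℝ, ∑ i, w i ^ 2 = 1 → qf (Hf h x) v ≤ qf (Hf h x) w := by
    intro w hw
    have h1 : ‖(WithLp.toLp 2 w : E n)‖ = 1 := by
      have := sum_sq_norm (WithLp.toLp 2 w : E n)
      simp only at this
      rw [hw] at this
      nlinarith [norm_nonneg (WithLp.toLp 2 w : E n)]
    have := hmin' x hxN _ h1
    simp only at this
    linarith
  have := contra_min hb hs Λ C K hK1 hC hC0 hxB ((le_abs_self _).trans (hΛ x hxN)) hv (hXK x hxN v hv) hε0 hε1 ha hc0.le hr1 hr2 hR1 hlm hvm hle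
  nlinarith

lemma const_rank {n : ℕ} {R b : ℝ} (hb : 0 ≤ b) {h : E n → ℝ} (hs : Sol R b h) :
    (∀ x ∈ ball (0 : E n) R, 0 < uu h x) ∨ (∀ x ∈ ball (0 : E n) R, uu h x = 0) := by
  by_contra hcon
  push Not at hcon
  obtain ⟨⟨x1, hx1, hu1⟩, x2, hx2, hu2⟩ := hcon
  have hnn : ∀ x ∈ ball (0 : E n) R, 0 ≤ uu h x := fun x hx => (hs.psd x hx).det_nonneg
  have huc : Continuous (uu h) := (uu_sm hs.sm).continuous
  set P := {x | x ∈ ball (0 : E n) R ∧ 0 < uu h x} with hP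
  have hz : ∃ z ∈ ball (0 : E n) R, uu h z = 0 ∧ z ∈ closure P := by
    by_contra hno
    push Not at hno
    have hpre : IsPreconnected (ball (0 : E n) R) := (convex_ball _ _).isPreconnected
    obtain ⟨w, hw, hw1, hw2⟩ := hpre {x | 0 < uu h x} (closure P)ᶜ (isOpen_lt continuous_const huc) isClosed_closure.isOpen_compl (by
      intro x hx
      rcases (hnn x hx).eq_or_lt with h0 | h0
      · exact Or.inr (hno x hx h0.symm)
      · exact Or.inl h0) ⟨x2, hx2, lt_of_le_of_ne (hnn x2 hx2) hu2.symm⟩ ⟨x1, hx1, hno x1 hx1 (le_antisymm hu1 (hnn x1 hx1))⟩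
    exact hw2 (subset_closure ⟨hw, hw1⟩)
  obtain ⟨z, hzB, hz0, hzc⟩ := hz
  have hzR : ‖z‖ < R := by simpa using hzB
  obtain ⟨y0, ⟨hy0B, hy0⟩, hdist⟩ := Metric.mem_closure_iff.1 hzc ((R - ‖z‖) / 4) (by linarith)
  rw [dist_eq_norm] at hdist
  have hsubB : closedBall y0 ‖z - y0‖ ⊆ ball (0 : E n) R := by
    intro x hx
    rw [mem_closedBall, dist_eq_norm] at hx
    rw [mem_ball, dist_zero_right]
    have h1 : x = (x - y0) + (y0 - z) + z := by abel
    have h2 := norm_add₃_le (a := x - y0) (b := y0 - z) (c := z)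
    rw [← h1, norm_sub_rev y0 z] at h2
    linarith
  have hcz : IsCompact (closedBall y0 ‖z - y0‖ ∩ {x | uu h x = 0}) := (isCompact_closedBall _ _).inter_right (isClosed_eq huc continuous_const)
  obtain ⟨x0, ⟨hx0m, hx0z⟩, hx0min⟩ := hcz.exists_isMinOn (f := fun x => ‖x - y0‖) ⟨z, by simp [dist_eq_norm], hz0⟩ (by fun_prop)
  simp only [mem_ofPred_eq] at hx0z
  have hx0d : ‖x0 - y0‖ ≤ ‖z - y0‖ := by simpa [dist_eq_norm] using hx0m
  have hne : ∀ x ∈ ball (0 : E n) R, ‖x - y0‖ < ‖x0 - y0‖ → uu h x ≠ 0 := by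
    intro x _ hlt h0
    have : ‖x0 - y0‖ ≤ ‖x - y0‖ := hx0min ⟨by rw [mem_closedBall, dist_eq_norm]; linarith, h0⟩
    linarith
  have hR0 : 0 < ‖x0 - y0‖ := by
    rw [norm_pos_iff, sub_ne_zero]
    rintro rfl
    rw [hx0z] at hy0; exact lt_irrefl _ hy0
  set y : E n := (1 / 2 : ℝ) • (x0 + y0) with hy
  have e1 : x0 - y = (1 / 2 : ℝ) • (x0 - y0) := by rw [hy]; module
  refine hopf_contra hb hs (x0 := x0) (y := y) (R1 := ‖x0 - y0‖ / 2) (by linarith) (hsubB hx0m) hx0z ?_ ?_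
  · rw [e1, norm_smul]; norm_num; ring
  · intro x hxB hxy hxne
    refine hne x hxB ?_
    have hpar := parallelogram_law_with_norm ℝ (x - y) (x0 - y)
    have e2 : x - y + (x0 - y) = x - y0 := by rw [hy]; module
    have e3 : x - y - (x0 - y) = x - x0 := by abel
    have e4 : ‖x0 - y‖ = ‖x0 - y0‖ / 2 := by rw [e1, norm_smul]; norm_num; ring
    rw [e2, e3, e4] at hpar
    have h5 : 0 < ‖x - x0‖ := norm_pos_iff.2 (sub_ne_zero.2 hxne)
    have := norm_nonneg (x - y)
    by_contra hcon
    push Not at hcon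
    nlinarith

lemma solU_exists {n : ℕ} (hn : 0 < n) {b : ℝ} (hb : 0 ≤ b) {h : E n → ℝ} (hs : Sol 4 b h) :
    ∃ b' K U, (b' = b ∨ b' = 0) ∧ 0 ≤ K ∧ K ≤ 16 * n ^ 2 * b ∧ Sol 4 b' h ∧ SolU b' K h U := by
  rcases const_rank hb hs with h1 | h1
  · obtain ⟨U, hU⟩ := solU_of_pos hn hb hs h1
    exact ⟨b, _, U, Or.inl rfl, by positivity, le_rfl, hs, hU⟩
  · have h2 : Sol 4 0 h := ⟨hs.sm, hs.psd, fun x hx => by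
      have := hs.eq x hx
      have h3 : detF (Hf h x) = 0 := h1 x hx
      rw [h3] at this ⊢; linarith⟩
    exact ⟨0, 0, _, Or.inr rfl, le_rfl, by positivity, h2, solU_of_zero h2⟩

end EK


namespace EK

lemma dd_resc {n : ℕ} {f : E n → ℝ} (hf : Sm f) (c r : ℝ) (x0 v : E n) :
    dd v (fun x => c * f (x0 + r • x)) = fun x => (c * r) * dd v f (x0 + r • x) := by
  ext x
  have h1 : HasFDerivAt (fun x : E n => x0 + r • x) (r • ContinuousLinearMap.id ℝ (E n)) x := 
    ((hasFDerivAt_id x).const_smul r).const_add x0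
  have h2 := (((hf.diff (x0 + r • x)).hasFDerivAt.comp x h1).const_mul c).fderiv
  unfold dd
  change fderiv ℝ (fun x => c * (f ∘ fun x => x0 + r • x) x) x v = _
  rw [h2]
  simp [mul_assoc]

lemma resc_sm {n : ℕ} {f : E n → ℝ} (hf : Sm f) (c r : ℝ) (x0 : E n) : Sm (fun x => c * f (x0 + r • x)) := by
  have : ContDiff ℝ (⊤ : ℕ∞) (fun x : E n => x0 + r • x) := by fun_prop
  exact contDiff_const.mul (hf.comp this)

lemma Hf_resc {n : ℕ} {f : E n → ℝ} (hf : Sm f) (c r : ℝ) (x0 x : E n) :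
    Hf (fun x => c * f (x0 + r • x)) x = (c * r ^ 2) • Hf f (x0 + r • x) := by
  ext i j
  unfold Hf
  simp only [pd_eq_dd, Pi.smul_apply, smul_eq_mul]
  rw [dd_resc hf, dd_resc (hf.dd _)]
  ring

/-- translated and rescaled function -/
noncomputable def tr {n : ℕ} (x0 : E n) (r : ℝ) (h : E n → ℝ) (x : E n) : ℝ := (r ^ 2)⁻¹ * h (x0 + r • x)

lemma tr_sm {n : ℕ} {h : E n → ℝ} (hh : Sm h) (x0 : E n) (r : ℝ) : Sm (tr x0 r h) := resc_sm hh _ _ _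

lemma Hf_tr {n : ℕ} {h : E n → ℝ} (hh : Sm h) (x0 : E n) {r : ℝ} (hr : r ≠ 0) (x : E n) : Hf (tr x0 r h) x = Hf h (x0 + r • x) := by
  unfold tr
  rw [Hf_resc hh, inv_mul_cancel₀ (pow_ne_zero 2 hr), one_smul]

lemma Sol.tr {n : ℕ} {R R' b : ℝ} {h : E n → ℝ} (hs : Sol R b h) (x0 : E n) {r : ℝ} (hr : 0 < r) (hle : ‖x0‖ + r * R' ≤ R) :
    Sol R' b (EK.tr x0 r h) := by
  have hm : ∀ x ∈ ball (0 : E n) R', x0 + r • x ∈ ball (0 : E n) R := by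
    intro x hx
    rw [mem_ball, dist_zero_right] at hx ⊢
    refine (norm_add_le _ _).trans_lt ?_
    rw [norm_smul, Real.norm_of_nonneg hr.le]
    nlinarith
  refine ⟨tr_sm hs.sm x0 r, fun x hx => ?_, fun x hx => ?_⟩
  · rw [Hf_tr hs.sm x0 hr.ne']; exact hs.psd _ (hm x hx)
  · rw [Hf_tr hs.sm x0 hr.ne']; exact hs.eq _ (hm x hx)

lemma tr_tr {n : ℕ} (r s : ℝ) (h : E n → ℝ) : tr 0 s (tr 0 r h) = tr 0 (r * s) h := by
  ext x; unfold tr; simp only [zero_add, smul_smul]; rw [mul_pow, mul_inv]; ring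

lemma Lop_resc {n : ℕ} {b r : ℝ} {h f : E n → ℝ} (hh : Sm h) (hf : Sm f) (hr : r ≠ 0) (x : E n) :
    Lop b (tr 0 r h) (fun x => 1 * f (0 + r • x)) x = r ^ 2 * Lop b h f (0 + r • x) := by
  unfold Lop
  rw [Hf_tr hh 0 hr, Hf_resc hf]
  simp [trF, Finset.mul_sum]; rw [← Finset.mul_sum]; ring

lemma SolU.resc {n : ℕ} {b K : ℝ} {h U : E n → ℝ} (hs : SolU b K h U) {r : ℝ} (hr : 0 < r) (hr1 : r ≤ 1) :
    SolU b K (EK.tr 0 r h) (fun x => 1 * U (0 + r • x)) := by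
  have hm : ∀ x ∈ ball (0 : E n) 2, 0 + r • x ∈ ball (0 : E n) 2 := by
    intro x hx
    rw [mem_ball, dist_zero_right] at hx ⊢
    rw [zero_add, norm_smul, Real.norm_of_nonneg hr.le]
    nlinarith [norm_nonneg x]
  refine ⟨hs.sol.tr 0 hr (by simp; linarith), resc_sm hs.sm _ _ _, ?_, ?_, ?_, ?_⟩
  · intro x hx; rw [one_mul]; exact hs.U0 _ (hm x hx)
  · intro x hx; rw [one_mul]; exact hs.U1 _ (hm x hx)
  · intro x hx
    rw [Lop_resc hs.sol.sm hs.sm hr.ne']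
    exact mul_nonpos_of_nonneg_of_nonpos (by positivity) (hs.LU _ (hm x hx))
  · intro v hv x hx
    have e1 : (fun x => dd v (dd v (EK.tr 0 r h)) x + (-K) * (1 * U (0 + r • x))) = 
        fun x => 1 * (fun x => dd v (dd v h) x + (-K) * U x) (0 + r • x) := by
      ext x
      unfold EK.tr
      rw [dd_resc hs.sol.sm, dd_resc (hs.sol.sm.dd v)]
      field_simp
    rw [e1, Lop_resc hs.sol.sm (((hs.sol.sm.dd v).dd v).add (contDiff_const.mul hs.sm)) hr.ne']
    exact mul_nonneg (by positivity) (hs.Lh v hv _ (hm x hx))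

/-- family of subsolutions -/
noncomputable def wf {n : ℕ} (K : ℝ) (h U : E n → ℝ) : Option (Fin n × Fin n) → E n → ℝ
  | none => fun x => 0 * h x + (-1) * U x
  | some p => fun x => dd (e p.1 + e p.2) (dd (e p.1 + e p.2) h) x + (-K) * U x

lemma wf_sm {n : ℕ} {b K : ℝ} {h U : E n → ℝ} (hs : SolU b K h U) (p) : Sm (wf K h U p) := by
  cases p with
  | none => exact (contDiff_const.mul hs.sol.sm).add (contDiff_const.mul hs.sm)
  | some p => exact ((hs.sol.sm.dd _).dd _).add (contDiff_const.mul hs.sm)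

lemma norm_ee {n : ℕ} (i j : Fin n) : ‖(e i + e j : E n)‖ ^ 2 ≤ 4 := by
  have h1 : ∀ i : Fin n, ‖(e i : E n)‖ = 1 := fun i => by simp [e]
  have := norm_add_le (e i : E n) (e j)
  rw [h1, h1] at this
  nlinarith [norm_nonneg (e i + e j : E n)]

lemma wf_Lop {n : ℕ} {b K : ℝ} {h U : E n → ℝ} (hs : SolU b K h U) (p) : ∀ x ∈ ball (0 : E n) 2, 0 ≤ Lop b h (wf K h U p) x := by
  intro x hx
  cases p with
  | none =>
    unfold wf
    rw [Lop_add (contDiff_const.mul hs.sol.sm) (contDiff_const.mul hs.sm), Lop_smul _ hs.sm, Lop_smul _ hs.sol.sm]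
    have := hs.LU x hx
    linarith
  | some p => exact hs.Lh _ (norm_ee _ _) x hx

lemma wf_lower {n : ℕ} {b K : ℝ} (hK : 0 ≤ K) {h U : E n → ℝ} (hs : SolU b K h U) (p) : ∀ x ∈ ball (0 : E n) 2, - (K + 1) ≤ wf K h U p x := by
  intro x hx
  have h0 := hs.U0 x hx
  have h1 := hs.U1 x hx
  cases p with
  | none => simp only [wf]; linarith
  | some p =>
    simp only [wf]
    have h2 : 0 ≤ dd (e p.1 + e p.2) (dd (e p.1 + e p.2) h) x := by
      rw [dd_dd_sum hs.sol.sm]; exact psd_nonneg (hs.sol.psd x hx) _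
    nlinarith

lemma dd_ee {n : ℕ} {h : E n → ℝ} (hh : Sm h) (i j : Fin n) (x : E n) :
    dd (e i + e j) (dd (e i + e j) h) x = Hf h x i i + 2 * Hf h x i j + Hf h x j j := by
  have h1 : ∀ f : E n → ℝ, Sm f → dd (e i + e j) f = fun x => pd i f x + pd j f x := by
    intro f _; ext x; unfold dd pd; rw [map_add]
  have h2 : ∀ k, pd k (fun x => pd i h x + pd j h x) x = pd k (pd i h) x + pd k (pd j h) x := by
    intro k; unfold pd
    have := (((hh.pd i).diff x).hasFDerivAt.fun_add ((hh.pd j).diff x).hasFDerivAt).fderiv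
    unfold pd at this
    rw [this]; rfl
  rw [h1 h hh, h1 _ ((hh.pd i).add (hh.pd j))]
  simp only
  rw [h2, h2]
  have := Hf_symm hh x j i
  unfold Hf at *
  linarith

lemma wf_upper {n : ℕ} {b K : ℝ} (hb : 0 ≤ b) (hK : 0 ≤ K) {h U : E n → ℝ} (hs : SolU b K h U) (p) : ∀ x ∈ ball (0 : E n) 2, wf K h U p x ≤ 4 := by
  intro x hx
  have h0 := hs.U0 x hx
  cases p with
  | none => simp only [wf]; linarith
  | some p =>
    simp only [wf]
    rw [dd_ee hs.sol.sm]
    have h3 := fun i j => (abs_le.1 (psd_entry (hs.sol.psd x hx) (hs.sol.tr_le hb x hx) i j)).2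
    have := h3 p.1 p.1
    have := h3 p.1 p.2
    have := h3 p.2 p.2
    nlinarith

end EK


namespace EK

lemma Lop_const {n : ℕ} {b : ℝ} {h : E n → ℝ} (c : ℝ) (x : E n) : Lop b h (fun _ => c) x = 0 := by
  have : Hf (fun _ : E n => c) x = 0 := by ext i j; unfold Hf pd; simp
  unfold Lop; rw [this]; simp [trF]

lemma G_step (n : ℕ) (hn : 2 ≤ n) {b θ δ : ℝ} (hb : 0 ≤ b) (hθ : 0 < θ) (hδ : 0 < δ) : ∃ c > 0, ∀ (K : ℝ) (h U : E n → ℝ),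
    SolU b K h U → ∀ p M, (∀ x ∈ ball (0 : E n) 2, wf K h U p x ≤ M) → 
    δ ≤ (volume (ball (0 : E n) (1/2) ∩ {x | wf K h U p x ≤ M - θ})).toReal →
    ∀ x ∈ ball (0 : E n) (1/4), wf K h U p x ≤ M - c * θ := by
  obtain ⟨Λ, hΛ, hell⟩ := ell_exists n b hb
  obtain ⟨c, hc, hg⟩ := growth n hn Λ δ hδ
  obtain ⟨C₀, hC0, hcut⟩ := exists_cutoff n
  obtain ⟨χ, hχ, -, hχs, hχ0, hχ1, hχe, -⟩ := hcut 1 2 (by norm_num) (by norm_num)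
  refine ⟨c, hc, fun K h U hs p M hM hvol x hx => ?_⟩
  set w := wf K h U p with hw
  have hws : Sm w := wf_sm hs p
  refine le_of_forall_pos_le_add fun τ hτ => ?_
  set v : E n → ℝ := fun x => χ x * ((M + τ - w x) / θ) + (1 - χ x) with hv
  have hvs : Sm v := (hχ.mul ((contDiff_const.sub hws).div_const θ)).add (contDiff_const.sub hχ)
  have hvpos : ∀ x, 0 < v x := by
    intro x
    by_cases hxb : x ∈ ball (0 : E n) 2
    · have h1 : 0 < (M + τ - w x) / θ := by
        have := hM x hxb; apply div_pos _ hθ; linarith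
      rcases (hχ0 x).eq_or_lt with h2 | h2
      · simp [hv, ← h2]
      · have := hχ1 x
        have := mul_pos h2 h1
        simp only [hv]; linarith
    · have : χ x = 0 := image_eq_zero_of_notMem_tsupport fun h => hxb (hχs h)
      simp [hv, this]
  have hveq : ∀ x ∈ closedBall (0 : E n) 1, v x = (M + τ - w x) / θ := by
    intro x hx; simp [hv, hχe x hx]
  have hsub : WSub (am b h) (fun x => - v x) := by
    refine WSub_of_Lop hs.sol.sm hvs.neg fun x hx => ?_
    rw [Lop_congr (g := fun x => θ⁻¹ * w x + (-(M + τ) / θ)) isOpen_ball (fun y hy => by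
      rw [hveq y (ball_subset_closedBall hy)]; field_simp; ring) x hx,
      Lop_add (contDiff_const.mul hws) contDiff_const, Lop_smul _ hws, Lop_const, add_zero]
    exact mul_nonneg (by positivity) (wf_Lop hs p x (ball_subset_ball (by norm_num) hx))
  have hkey := hg (am b h) (hell h (hs.sol.mono (by norm_num))) v hvs.c1 hvpos hsub (hvol.trans ?_) x hx
  · rw [hveq x (ball_subset_closedBall (ball_subset_ball (by norm_num) hx)), le_div_iff₀ hθ] at hkey
    linarith
  · refine ENNReal.toReal_mono ((measure_mono inter_subset_left).trans_lt measure_ball_lt_top).ne (measure_mono ?_)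
    rintro y ⟨hy1, hy2⟩
    refine ⟨hy1, ?_⟩
    simp only [mem_ofPred_eq] at hy2 ⊢
    rw [hveq y (ball_subset_closedBall (ball_subset_ball (by norm_num) hy1)), le_div_iff₀ hθ]
    linarith

/-- all bad sets are small -/
def Good {n : ℕ} (K θ δ : ℝ) (h U : E n → ℝ) : Prop := ∃ M : Option (Fin n × Fin n) → ℝ, 
  (∀ p, ∀ x ∈ ball (0 : E n) 2, wf K h U p x ≤ M p) ∧ 
  ∀ p, (volume (ball (0 : E n) (1/2) ∩ {x | wf K h U p x ≤ M p - θ})).toReal ≤ δ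

lemma wf_resc {n : ℕ} {b K r : ℝ} {h U : E n → ℝ} (hs : SolU b K h U) (hr : r ≠ 0) (p) (x : E n) :
    wf K (tr 0 r h) (fun x => 1 * U (0 + r • x)) p x = wf K h U p (r • x) := by
  cases p with
  | none => simp [wf]
  | some p =>
    simp only [wf]
    rw [dd_ee (tr_sm hs.sol.sm 0 r), dd_ee hs.sol.sm, Hf_tr hs.sol.sm 0 hr]
    simp

lemma G_iter (n : ℕ) (hn : 2 ≤ n) {b θ δ : ℝ} (hb : 0 ≤ b) (hθ : 0 < θ) (hδ : 0 < δ) : ∃ c > 0, ∀ K ≥ 0, ∀ N : ℕ, ∀ (h U : E n → ℝ)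
    (M : Option (Fin n × Fin n) → ℝ), SolU b K h U → (∀ p, ∀ x ∈ ball (0 : E n) 2, wf K h U p x ≤ M p) →
    ∑ p, (M p + (K + 1)) < N * c → ∃ r : ℝ, (1/8) ^ N ≤ r ∧ r ≤ 1 ∧ ∃ V, SolU b K (tr 0 r h) V ∧ Good K θ δ (tr 0 r h) V := by
  obtain ⟨c, hc, hstep⟩ := G_step n hn hb hθ hδ
  refine ⟨c * θ, by positivity, fun K hK N => ?_⟩
  induction N with
  | zero =>
    intro h U M hs hM hlt
    exfalso
    have : 0 ≤ ∑ p, (M p + (K + 1)) := Finset.sum_nonneg fun p _ => by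
      have h1 := wf_lower hK hs p 0 (by simp)
      have h2 := hM p 0 (by simp)
      linarith
    rw [Nat.cast_zero, zero_mul] at hlt; linarith
  | succ N ih =>
    intro h U M hs hM hlt
    by_cases hgood : ∀ p, (volume (ball (0 : E n) (1/2) ∩ {x | wf K h U p x ≤ M p - θ})).toReal ≤ δ
    · refine ⟨1, pow_le_one₀ (by norm_num) (by norm_num), le_rfl, U, ?_⟩
      have : tr 0 1 h = h := by ext x; simp [tr]
      rw [this]; exact ⟨hs, M, hM, hgood⟩
    · push Not at hgood
      obtain ⟨q, hq⟩ := hgood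
      have h1 := hstep K h U hs q (M q) (hM q) hq.le
      have hs' := hs.resc (r := 1/8) (by norm_num) (by norm_num)
      have hmem : ∀ x ∈ ball (0 : E n) 2, (1/8 : ℝ) • x ∈ ball (0 : E n) (1/4) := by
        intro x hx
        rw [mem_ball, dist_zero_right] at hx ⊢
        rw [norm_smul, Real.norm_of_nonneg (by norm_num)]; linarith
      obtain ⟨r, hr1, hr2, V, hV⟩ := ih (tr 0 (1/8) h) _ (Function.update M q (M q - c * θ)) hs' (by
        intro p x hx
        rw [wf_resc hs (by norm_num)]
        by_cases hpq : p = q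
        · subst hpq; simp only [Function.update_self]; exact h1 _ (hmem x hx)
        · rw [Function.update_of_ne hpq]
          exact hM p _ (ball_subset_ball (by norm_num) (hmem x hx))) (by
        rw [Finset.sum_add_distrib] at hlt ⊢
        rw [Finset.sum_update_of_mem (Finset.mem_univ q)]
        rw [Finset.sum_eq_add_sum_sdiff_singleton_of_mem (Finset.mem_univ q) M] at hlt
        push_cast at hlt
        linarith)
      have hr0 : 0 < r := lt_of_lt_of_le (by positivity) hr1
      refine ⟨1/8 * r, ?_, by linarith, V, ?_⟩
      · rw [pow_succ, mul_comm]; gcongr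
      · rw [tr_tr] at hV; exact hV

/-- squared deviation of the Hessian -/
noncomputable def dv {n : ℕ} (h : E n → ℝ) (A : Fin n → Fin n → ℝ) (x : E n) : ℝ := ∑ i, ∑ j, (Hf h x i j - A i j) ^ 2

lemma dv_cont {n : ℕ} {h : E n → ℝ} (hh : Sm h) (A : Fin n → Fin n → ℝ) : Continuous (dv h A) := by
  unfold dv
  refine continuous_finsetSum _ fun i _ => continuous_finsetSum _ fun j _ => ?_
  have : Continuous fun x => Hf h x i j := ((hh.pd j).pd i).continuous
  fun_prop

lemma dv_nonneg {n : ℕ} (h : E n → ℝ) (A : Fin n → Fin n → ℝ) (x : E n) : 0 ≤ dv h A x := 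
  Finset.sum_nonneg fun i _ => Finset.sum_nonneg fun j _ => sq_nonneg _

lemma dv_le {n : ℕ} {h : E n → ℝ} {A : Fin n → Fin n → ℝ} {x : E n} {t : ℝ} (H : ∀ i j, |Hf h x i j - A i j| ≤ t) : 
    dv h A x ≤ n ^ 2 * t ^ 2 := by
  calc dv h A x ≤ ∑ i : Fin n, ∑ j : Fin n, t ^ 2 := Finset.sum_le_sum fun i _ => Finset.sum_le_sum fun j _ => by
          have := H i j
          rw [← sq_abs]; gcongr
    _ = n ^ 2 * t ^ 2 := by simp; ring

lemma G_good {n : ℕ} {b K θ δ : ℝ} (hb : 0 ≤ b) (hK : 0 ≤ K) (hθ : 0 < θ) {h U : E n → ℝ} (hs : SolU b K h U) (hG : Good K θ δ h U) 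
    (hδ : Fintype.card (Option (Fin n × Fin n)) * δ < volume.real (ball (0 : E n) (1/2))) :
    ∃ x1 ∈ ball (0 : E n) (1/2), ∫ x in ball (0 : E n) (1/2), dv h (Hf h x1) x ≤ 
      n ^ 2 * ((1 + K) * θ) ^ 2 * volume.real (ball (0 : E n) (1/2)) + n ^ 2 * 2 ^ 2 * (Fintype.card (Option (Fin n × Fin n)) * δ) := by
  obtain ⟨M, hM, hbad⟩ := hG
  set Bp : Option (Fin n × Fin n) → Set (E n) := fun p => ball (0 : E n) (1/2) ∩ {x | wf K h U p x ≤ M p - θ} with hBp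
  set B := ⋃ p, Bp p with hB
  have hBm : MeasurableSet B := MeasurableSet.iUnion fun p => measurableSet_ball.inter 
    (isClosed_le (wf_sm hs p).continuous continuous_const).measurableSet
  have hBsub : B ⊆ ball (0 : E n) (1/2) := iUnion_subset fun p => inter_subset_left
  have hBv : volume.real B ≤ Fintype.card (Option (Fin n × Fin n)) * δ := by
    refine (measureReal_iUnion_fintype_le _).trans ?_
    refine (Finset.sum_le_sum fun p _ => hbad p).trans ?_
    simp
  have hbb : ball (0 : E n) (1/2) ⊆ ball 0 2 := ball_subset_ball (by norm_num)
  obtain ⟨x1, hx1, hx1B⟩ : ∃ x1 ∈ ball (0 : E n) (1/2), x1 ∉ B := by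
    by_contra hcon
    push Not at hcon
    have : volume.real (ball (0 : E n) (1/2)) ≤ volume.real B := 
      measureReal_mono hcon ((measure_mono hBsub).trans_lt measure_ball_lt_top).ne
    linarith
  have hclose : ∀ x ∈ ball (0 : E n) (1/2), x ∉ B → ∀ p, |wf K h U p x - wf K h U p x1| ≤ θ := by
    have key : ∀ y ∈ ball (0 : E n) (1/2), y ∉ B → ∀ p, M p - θ < wf K h U p y := by
      intro y hy hyB p
      by_contra hcon
      push Not at hcon
      exact hyB (mem_iUnion.2 ⟨p, hy, hcon⟩)
    intro x hx hxB p
    have h1 := key x hx hxB p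
    have h2 := key x1 hx1 hx1B p
    have h3 := hM p x (hbb hx)
    have h4 := hM p x1 (hbb hx1)
    rw [abs_le]; constructor <;> linarith
  refine ⟨x1, hx1, ?_⟩
  have hgood : ∀ x ∈ ball (0 : E n) (1/2), x ∉ B → dv h (Hf h x1) x ≤ n ^ 2 * ((1 + K) * θ) ^ 2 := by
    intro x hx hxB
    refine dv_le fun i j => ?_
    have hU := hclose x hx hxB none
    simp only [wf, zero_mul, zero_add] at hU
    have hq : ∀ i j, |(Hf h x i i + 2 * Hf h x i j + Hf h x j j) - (Hf h x1 i i + 2 * Hf h x1 i j + Hf h x1 j j)| ≤ (1 + K) * θ := by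
      intro i j
      have := hclose x hx hxB (some (i, j))
      simp only [wf, dd_ee hs.sol.sm] at this
      rw [abs_le] at *
      constructor <;> nlinarith
    have hi := hq i i
    have hj := hq j j
    have hij := hq i j
    rw [abs_le] at *
    constructor <;> linarith
  have hall : ∀ x ∈ ball (0 : E n) (1/2), dv h (Hf h x1) x ≤ n ^ 2 * 2 ^ 2 := by
    intro x hx
    refine dv_le fun i j => ?_
    have h1 := psd_entry (hs.sol.psd x (hbb hx)) (hs.sol.tr_le hb x (hbb hx)) i j
    have h2 := psd_entry (hs.sol.psd x1 (hbb hx1)) (hs.sol.tr_le hb x1 (hbb hx1)) i j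
    rw [abs_le] at *
    constructor <;> linarith
  have hci : ∀ c : ℝ, IntegrableOn (fun _ => c) (ball (0 : E n) (1/2)) := fun c => integrableOn_const measure_ball_lt_top.ne
  have hintB : IntegrableOn (B.indicator fun _ => ((n:ℝ) ^ 2 * 2 ^ 2)) (ball (0 : E n) (1/2)) := (hci _).indicator hBm
  calc ∫ x in ball (0 : E n) (1/2), dv h (Hf h x1) x ≤ ∫ x in ball (0 : E n) (1/2), ((n ^ 2 * ((1 + K) * θ) ^ 2) + B.indicator (fun _ => ((n:ℝ) ^ 2 * 2 ^ 2)) x) := by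
        refine setIntegral_mono_on ?_ ((hci _).add hintB) measurableSet_ball fun x hx => ?_
        · exact ((dv_cont hs.sol.sm _).continuousOn.integrableOn_compact (isCompact_closedBall (0:E n) (1/2))).mono_set ball_subset_closedBall
        · by_cases hxB : x ∈ B
          · rw [indicator_of_mem hxB]
            have : (0:ℝ) ≤ n ^ 2 * ((1 + K) * θ) ^ 2 := by positivity
            linarith [hall x hx]
          · rw [indicator_of_notMem hxB, add_zero]; exact hgood x hx hxB
    _ = n ^ 2 * ((1 + K) * θ) ^ 2 * volume.real (ball (0 : E n) (1/2)) + n ^ 2 * 2 ^ 2 * volume.real B := by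
        rw [integral_add (hci _) hintB, setIntegral_indicator hBm, setIntegral_const, setIntegral_const, inter_eq_right.2 hBsub]
        simp only [smul_eq_mul]; ring
    _ ≤ _ := by gcongr

/-- scaled energy -/
noncomputable def En {n : ℕ} (h : E n → ℝ) (A : Fin n → Fin n → ℝ) : ℝ := ∫ x in ball (0 : E n) 2, dv h A x

lemma En_quarter {n : ℕ} {h : E n → ℝ} (hh : Sm h) (A : Fin n → Fin n → ℝ) : 
    En (tr 0 (1/4) h) A = 4 ^ n * ∫ x in ball (0 : E n) (1/2), dv h A x := by
  unfold En
  have h1 : ∀ x, dv (tr 0 (1/4) h) A x = dv h A ((1/4 : ℝ) • x) := by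
    intro x; unfold dv; rw [Hf_tr hh 0 (by norm_num)]; simp
  simp only [h1]
  rw [Measure.setIntegral_comp_smul_of_pos volume (dv h A) _ (by norm_num : (0:ℝ) < 1/4), _root_.smul_ball (by norm_num : (1/4:ℝ) ≠ 0)]
  simp only [smul_zero, finrank_euclideanSpace, Fintype.card_fin, smul_eq_mul]
  have h2 : (((1:ℝ)/4) ^ n)⁻¹ = 4 ^ n := by rw [one_div, inv_pow, inv_inv]
  rw [h2]; norm_num

/-- Part G -/
lemma part_G (n : ℕ) (hn : 2 ≤ n) {b Km ε : ℝ} (hb : 0 ≤ b) (hKm : 0 ≤ Km) (hε : 0 < ε) : ∃ r0 > 0, ∀ K, 0 ≤ K → K ≤ Km → ∀ h U : E n → ℝ, SolU b K h U →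
    ∃ r, r0 ≤ r ∧ r ≤ 1 ∧ ∃ A : Fin n → Fin n → ℝ, (Matrix.of A).PosSemidef ∧ trF A ≤ 1 ∧ En (tr 0 r h) A ≤ ε := by
  set V := volume.real (ball (0 : E n) (1/2)) with hV
  have hV0 : 0 < V := by
    rw [hV, measureReal_def]; exact ENNReal.toReal_pos (measure_ball_pos _ _ (by norm_num)).ne' measure_ball_lt_top.ne
  set P : ℝ := ((Fintype.card (Option (Fin n × Fin n)) : ℕ) : ℝ) with hP
  have hP0 : 0 ≤ P := by positivity
  set X : ℝ := 4 ^ n * (n ^ 2 * (1 + Km) ^ 2 * V) with hX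
  have hX0 : 0 ≤ X := by positivity
  set Y : ℝ := 4 ^ n * (n ^ 2 * 2 ^ 2 * P) with hY
  have hY0 : 0 ≤ Y := by positivity
  set θ : ℝ := min 1 (ε / (2 * (X + 1))) with hθd
  have hθ : 0 < θ := by positivity
  have hθ1 : θ ≤ 1 := min_le_left _ _
  have hθX : X * θ ^ 2 ≤ ε / 2 := by
    have h1 : θ * (2 * (X + 1)) ≤ ε := by
      rw [← le_div_iff₀ (by positivity)]; exact min_le_right _ _
    have h2 : θ ^ 2 ≤ θ := by nlinarith
    nlinarith [mul_le_mul_of_nonneg_left h2 hX0]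
  set δ : ℝ := min (V / (P + 1)) (ε / (2 * (Y + 1))) with hδd
  have hδ : 0 < δ := by positivity
  have hδY : Y * δ ≤ ε / 2 := by
    have h1 : δ * (2 * (Y + 1)) ≤ ε := by
      rw [← le_div_iff₀ (by positivity)]; exact min_le_right _ _
    nlinarith
  have hδP : P * δ < V := by
    have h1 : δ * (P + 1) ≤ V := by
      rw [← le_div_iff₀ (by positivity)]; exact min_le_left _ _
    nlinarith
  obtain ⟨c, hc, hit⟩ := G_iter n hn hb hθ hδ
  obtain ⟨N, hN⟩ := exists_nat_gt (P * (4 + (Km + 1)) / c)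
  rw [div_lt_iff₀ hc] at hN
  refine ⟨1 / 8 ^ N * (1/4), by positivity, fun K hK0 hK h U hs => ?_⟩
  obtain ⟨r, hr1, hr2, W, hsW, hG⟩ := hit K hK0 N h U (fun _ => 4) hs (wf_upper hb hK0 hs) (by
    refine lt_of_le_of_lt ?_ hN
    rw [Finset.sum_const, Finset.card_univ, nsmul_eq_mul]
    gcongr)
  obtain ⟨x1, hx1, hle⟩ := G_good hb hK0 hθ hsW hG hδP
  have hx12 : x1 ∈ ball (0 : E n) 2 := ball_subset_ball (by norm_num) hx1
  have hr0 : 0 < r := lt_of_lt_of_le (by positivity) hr1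
  refine ⟨r * (1/4), ?_, by linarith, Hf (tr 0 r h) x1, hsW.sol.psd x1 hx12, hsW.sol.tr_le hb x1 hx12, ?_⟩
  · gcongr; rwa [one_div_pow] at hr1
  · rw [← tr_tr, En_quarter hsW.sol.sm]
    refine (mul_le_mul_of_nonneg_left hle (by positivity)).trans ?_
    have h3 : (4:ℝ) ^ n * (n ^ 2 * ((1 + K) * θ) ^ 2 * V + n ^ 2 * 2 ^ 2 * (P * δ)) ≤ X * θ ^ 2 + Y * δ := by
      have : (4:ℝ) ^ n * (n ^ 2 * ((1 + K) * θ) ^ 2 * V + n ^ 2 * 2 ^ 2 * (P * δ)) = 4 ^ n * (n ^ 2 * (1 + K) ^ 2 * V) * θ ^ 2 + Y * δ := by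
        rw [hY]; ring
      rw [this, hX]
      gcongr
    linarith

end EK


namespace EK

/-- quadratic polynomial with Hessian `A` -/
noncomputable def hq {n : ℕ} (A : Fin n → Fin n → ℝ) (x : E n) : ℝ := (1/2) * ∑ i, ∑ j, A i j * (x i * x j)

lemma coord_sm {n : ℕ} (i : Fin n) : Sm (fun x : E n => x i) := by
  exact (EuclideanSpace.proj (𝕜 := ℝ) i).contDiff

lemma coord_hasFDerivAt {n : ℕ} (i : Fin n) (x : E n) : 
    HasFDerivAt (fun x : E n => x i) (EuclideanSpace.proj (𝕜 := ℝ) i : E n →L[ℝ] ℝ) x :=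
  (EuclideanSpace.proj (𝕜 := ℝ) i : E n →L[ℝ] ℝ).hasFDerivAt

lemma e_apply {n : ℕ} (i j : Fin n) : (e i : E n) j = if j = i then 1 else 0 := by
  simp [e, PiLp.single_apply, Pi.single_apply]

lemma lin_sm {n : ℕ} (c : Fin n → ℝ) : Sm (fun x : E n => ∑ i, c i * x i) := 
  ContDiff.sum fun i _ => contDiff_const.mul (coord_sm i)

lemma pd_lin {n : ℕ} (c : Fin n → ℝ) (k : Fin n) (x : E n) : pd k (fun x : E n => ∑ i, c i * x i) x = c k := by
  have h : HasFDerivAt (fun x : E n => ∑ i, c i * x i) (∑ i, c i • (EuclideanSpace.proj (𝕜 := ℝ) i : E n →L[ℝ] ℝ)) x := 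
    HasFDerivAt.fun_sum fun i _ => (coord_hasFDerivAt i x).const_mul (c i)
  unfold pd
  rw [h.fderiv]
  simp [e_apply]

lemma hq_sm {n : ℕ} (A : Fin n → Fin n → ℝ) : Sm (hq A) := 
  contDiff_const.mul (ContDiff.sum fun i _ => ContDiff.sum fun j _ => contDiff_const.mul ((coord_sm i).mul (coord_sm j)))

lemma pd_hq {n : ℕ} {A : Fin n → Fin n → ℝ} (hA : ∀ i j, A i j = A j i) (k : Fin n) : 
    pd k (hq A) = fun x => ∑ i, A k i * x i := by
  ext x
  have h : HasFDerivAt (hq A) _ x := 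
    (HasFDerivAt.fun_sum (u := Finset.univ) fun i _ => HasFDerivAt.fun_sum (u := Finset.univ) fun j _ => 
      ((coord_hasFDerivAt i x).fun_mul (coord_hasFDerivAt j x)).const_mul (A i j)).const_mul (1/2)
  unfold pd
  rw [h.fderiv]
  simp [e_apply, mul_add, Finset.sum_add_distrib]
  have : ∑ i, A i k * x i = ∑ i, A k i * x i := Finset.sum_congr rfl fun i _ => by rw [hA]
  rw [this]; ring

lemma Hf_hq {n : ℕ} {A : Fin n → Fin n → ℝ} (hA : ∀ i j, A i j = A j i) (x : E n) : Hf (hq A) x = A := by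
  ext i j
  unfold Hf
  rw [pd_hq hA, pd_lin, hA]

lemma psd_sym {n : ℕ} {A : Fin n → Fin n → ℝ} (hA : (Matrix.of A).PosSemidef) (i j : Fin n) : A i j = A j i := by
  have := hA.1.apply j i
  simpa using this

lemma ell_exists' (n : ℕ) (b : ℝ) (hb : 0 ≤ b) : ∃ Λ > 0, ∀ h : E n → ℝ, Sm h → 
    (∀ x ∈ ball (0 : E n) 1, (Matrix.of (Hf h x)).PosSemidef ∧ trF (Hf h x) ≤ 1) → Ell Λ (am b h) := by
  obtain ⟨C, hC, hcof⟩ := cof_bdd n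
  refine ⟨n * (n * (1 + b * C)) + 1, by positivity, fun h hh hs => ⟨fun i j => (am_sm hh i j).continuous, ?_, ?_⟩⟩
  · intro x hx ξ; exact bf_am_lower hb (hs x hx).1 ξ
  · intro x hx ξ η
    have h1 : ∀ i j, |am b h x i j| ≤ 1 + b * C := by
      intro i j
      rw [am_apply]
      have h2 := hcof (Hf h x) (psd_entry (hs x hx).1 (hs x hx).2) i j
      refine (abs_add_le _ _).trans (add_le_add ?_ ?_)
      · split_ifs <;> simp
      · rw [abs_mul, abs_of_nonneg hb]; gcongr
    refine (bf_upper h1 ξ η).trans ?_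
    gcongr; linarith

lemma am_bdd (n : ℕ) (b : ℝ) (hb : 0 ≤ b) : ∃ Λ > 0, ∀ h : E n → ℝ, ∀ x, (Matrix.of (Hf h x)).PosSemidef → trF (Hf h x) ≤ 1 → 
    ∀ i j, |am b h x i j| ≤ Λ := by
  obtain ⟨C, hC, hcof⟩ := cof_bdd n
  refine ⟨1 + b * C, by positivity, fun h x hp ht i j => ?_⟩
  rw [am_apply]
  have h2 := hcof (Hf h x) (psd_entry hp ht) i j
  refine (abs_add_le _ _).trans (add_le_add ?_ ?_)
  · split_ifs <;> simp
  · rw [abs_mul, abs_of_nonneg hb]; gcongr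

lemma pd_mul {n : ℕ} {f g : E n → ℝ} (hf : Sm f) (hg : Sm g) (i : Fin n) (x : E n) : 
    pd i (fun x => f x * g x) x = f x * pd i g x + g x * pd i f x := by
  unfold pd
  rw [((hf.diff x).hasFDerivAt.fun_mul (hg.diff x).hasFDerivAt).fderiv]
  simp

lemma pd_add {n : ℕ} {f g : E n → ℝ} (hf : Sm f) (hg : Sm g) (i : Fin n) (x : E n) : 
    pd i (fun x => f x + g x) x = pd i f x + pd i g x := by
  unfold pd
  rw [((hf.diff x).hasFDerivAt.fun_add (hg.diff x).hasFDerivAt).fderiv]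
  simp

lemma Lop_sq {n : ℕ} {b : ℝ} {h f : E n → ℝ} (hf : Sm f) (x : E n) : 
    Lop b h (fun x => f x * f x) x = 2 * (f x * Lop b h f x) + 2 * bf (am b h x) (fderiv ℝ f x) (fderiv ℝ f x) := by
  have e1 : ∀ j, pd j (fun x => f x * f x) = fun x => (2 * f x) * pd j f x := by
    intro j; ext y; rw [pd_mul hf hf]; ring
  have h2 : Sm (fun x => 2 * f x) := contDiff_const.mul hf
  have e2 : ∀ i, pd i (fun x => 2 * f x) x = 2 * pd i f x := by
    intro i; rw [pd_mul contDiff_const hf]; simp [pd]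
  simp only [Lop_eq, bf, Finset.mul_sum, ← Finset.sum_add_distrib]
  refine Finset.sum_congr rfl fun i _ => Finset.sum_congr rfl fun j _ => ?_
  rw [e1, pd_mul h2 (hf.pd j), e2]
  unfold pd; ring

lemma bf_comm {n : ℕ} {c : Matrix (Fin n) (Fin n) ℝ} (hc : ∀ i j, c i j = c j i) (ξ η : E n →L[ℝ] ℝ) : bf c ξ η = bf c η ξ := by
  unfold bf
  rw [Finset.sum_comm]
  refine Finset.sum_congr rfl fun i _ => Finset.sum_congr rfl fun j _ => ?_
  rw [hc]; ring

lemma zero_of_nmem_tsupport {n : ℕ} {η : E n → ℝ} {x : E n} (hx : x ∉ tsupport η) : η x = 0 := by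
  by_contra h
  exact hx (subset_tsupport _ h)

lemma Lop_zero_of_nmem {n : ℕ} {b : ℝ} {h η : E n → ℝ} {x : E n} (hx : x ∉ tsupport η) : Lop b h η x = 0 := by
  rw [Lop_congr (s := (tsupport η)ᶜ) (g := fun _ => 0) (isClosed_tsupport η).isOpen_compl (fun y hy => zero_of_nmem_tsupport hy) x hx, Lop_const]

lemma Lop_cont {n : ℕ} {b : ℝ} {h f : E n → ℝ} (hh : Sm h) (hf : Sm f) : Continuous (Lop b h f) := by
  have : Lop b h f = fun x => ∑ i, ∑ j, am b h x i j * pd i (pd j f) x := by ext x; exact Lop_eq _ _ _ _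
  rw [this]
  exact continuous_finsetSum _ fun i _ => continuous_finsetSum _ fun j _ => (am_sm hh i j).continuous.mul ((hf.pd j).pd i).continuous

lemma Lop_symm {n : ℕ} {b : ℝ} {h F η : E n → ℝ} (hh : Sm h) (hF : Sm F) (hη : Sm η) (hc : HasCompactSupport η) :
    ∫ x, Lop b h F x * η x = ∫ x, F x * Lop b h η x := by
  obtain ⟨R, hR0, hR⟩ : ∃ R > 0, tsupport η ⊆ ball 0 R := by
    obtain ⟨R, hR⟩ := hc.isCompact.isBounded.subset_ball 0
    exact ⟨max R 1, by positivity, hR.trans (ball_subset_ball (le_max_left _ _))⟩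
  obtain ⟨C₀, _, hcut⟩ := exists_cutoff n
  obtain ⟨χ, hχ, hχc, -, -, -, hχ1, -⟩ := hcut R (R+1) hR0 (by linarith)
  have hF' : Sm (fun x => F x * χ x) := hF.mul hχ
  have e0 : ∀ x ∈ ball (0 : E n) R, F x * χ x = F x := fun x hx => by
    rw [hχ1 x (ball_subset_closedBall hx), mul_one]
  have e1 := ibp (b := b) hh hF' hη.c1 hc
  have e2 := ibp (b := b) hh hη hF'.c1 hχc.mul_left
  have e3 : ∫ x, Lop b h (fun x => F x * χ x) x * η x = ∫ x, Lop b h η x * (F x * χ x) := by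
    have : ∀ x, bf (am b h x) (fderiv ℝ η x) (fderiv ℝ (fun x => F x * χ x) x) = bf (am b h x) (fderiv ℝ (fun x => F x * χ x) x) (fderiv ℝ η x) :=
      fun x => bf_comm (am_symm hh x) _ _
    simp only [this] at e2
    linarith
  have e4 : ∀ x, Lop b h (fun x => F x * χ x) x * η x = Lop b h F x * η x := by
    intro x
    by_cases hx : x ∈ tsupport η
    · rw [Lop_congr isOpen_ball e0 x (hR hx)]
    · rw [zero_of_nmem_tsupport hx]; simp
  have e5 : ∀ x, Lop b h η x * (F x * χ x) = F x * Lop b h η x := by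
    intro x
    by_cases hx : x ∈ tsupport η
    · rw [e0 x (hR hx), mul_comm]
    · rw [Lop_zero_of_nmem hx]; simp
  simpa only [e4, e5] using e3

/-- Caccioppoli inequality in non-divergence form -/
lemma cacc2 {n : ℕ} {b : ℝ} (hb : 0 ≤ b) {h f η : E n → ℝ} (hh : Sm h) (hf : Sm f) (hη : Sm η) (hc : HasCompactSupport η) (h0 : ∀ x, 0 ≤ η x)
    (hp : ∀ x ∈ tsupport η, (Matrix.of (Hf h x)).PosSemidef) :
    ∫ x, η x * ‖fderiv ℝ f x‖ ^ 2 ≤ (1/2) * (∫ x, f x ^ 2 * Lop b h η x) - ∫ x, η x * (f x * Lop b h f x) := by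
  have e1 := Lop_symm (b := b) hh (hf.mul hf) hη hc
  have cf' : Continuous (fderiv ℝ f) := hf.c1.continuous_fderiv one_ne_zero
  have cb : Continuous (fun x => bf (am b h x) (fderiv ℝ f x) (fderiv ℝ f x)) := 
    continuous_bf (fun i j => (am_sm hh i j).continuous) cf' cf'
  have i1 : Integrable (fun x => η x * (f x * Lop b h f x)) volume := 
    (hη.continuous.mul (hf.continuous.mul (Lop_cont hh hf))).integrable_of_hasCompactSupport hc.mul_right
  have i2 : Integrable (fun x => η x * bf (am b h x) (fderiv ℝ f x) (fderiv ℝ f x)) volume := 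
    (hη.continuous.mul cb).integrable_of_hasCompactSupport hc.mul_right
  have i3 : Integrable (fun x => η x * ‖fderiv ℝ f x‖ ^ 2) volume := 
    (hη.continuous.mul (cf'.norm.pow 2)).integrable_of_hasCompactSupport hc.mul_right
  have e2 : ∫ x, Lop b h (fun x => f x * f x) x * η x = 2 * (∫ x, η x * (f x * Lop b h f x)) + 2 * ∫ x, η x * bf (am b h x) (fderiv ℝ f x) (fderiv ℝ f x) := by
    rw [← integral_const_mul, ← integral_const_mul, ← integral_add (i1.const_mul 2) (i2.const_mul 2)]
    refine integral_congr_ae (Eventually.of_forall fun x => ?_)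
    change Lop b h (fun x => f x * f x) x * η x = _
    rw [Lop_sq hf]; ring
  have e3 : ∫ x, η x * ‖fderiv ℝ f x‖ ^ 2 ≤ ∫ x, η x * bf (am b h x) (fderiv ℝ f x) (fderiv ℝ f x) := by
    refine integral_mono i3 i2 fun x => ?_
    by_cases hx : x ∈ tsupport η
    · exact mul_le_mul_of_nonneg_left (bf_am_lower hb (hp x hx) _) (h0 x)
    · simp [zero_of_nmem_tsupport hx]
  have e4 : ∫ x, f x ^ 2 * Lop b h η x = ∫ x, f x * f x * Lop b h η x := by simp only [sq]
  rw [e4]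
  change ∫ x, Lop b h (fun x => f x * f x) x * η x = _ at e1
  linarith

end EK


namespace EK

/-- mollification -/
noncomputable def T {n : ℕ} (φ f : E n → ℝ) (x : E n) : ℝ := ∫ y, f y * φ (x - y)

lemma T_eq_conv {n : ℕ} (φ f : E n → ℝ) : T φ f = convolution f φ (ContinuousLinearMap.mul ℝ ℝ) volume := by
  ext x; simp [T, convolution_def]

lemma T_eq {n : ℕ} (φ f : E n → ℝ) (x : E n) : T φ f x = ∫ z, φ z * f (x - z) := by
  unfold T
  rw [← integral_sub_left_eq_self (fun z => φ z * f (x - z)) volume x]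
  simp [mul_comm]

lemma T_sm {n : ℕ} {φ f : E n → ℝ} (hφ : Sm φ) (hc : HasCompactSupport φ) (hf : Continuous f) : Sm (T φ f) := by
  rw [T_eq_conv]
  exact hc.contDiff_convolution_right _ (hf.locallyIntegrable) hφ

lemma pd_T {n : ℕ} {φ f : E n → ℝ} (hφ : Sm φ) (hc : HasCompactSupport φ) (hf : Continuous f) (i : Fin n) : 
    pd i (T φ f) = T (pd i φ) f := by
  ext x
  rw [T_eq_conv, T_eq_conv]
  have := hc.hasFDerivAt_convolution_right (ContinuousLinearMap.mul ℝ ℝ) (hf.locallyIntegrable (μ := volume)) hφ.c1 x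
  unfold pd
  rw [this.fderiv, convolution_precompR_apply _ (hf.locallyIntegrable) (hc.fderiv (𝕜 := ℝ)) (hφ.c1.continuous_fderiv one_ne_zero)]

lemma refl_sm {n : ℕ} {φ : E n → ℝ} (hφ : Sm φ) (x : E n) : Sm (fun y => φ (x - y)) := 
  hφ.comp (contDiff_const.sub contDiff_id)

lemma refl_cs {n : ℕ} {φ : E n → ℝ} (hc : HasCompactSupport φ) (x : E n) : HasCompactSupport (fun y => φ (x - y)) := 
  hc.comp_homeomorph (Homeomorph.subLeft x)

lemma fderiv_refl {n : ℕ} {φ : E n → ℝ} (hφ : Sm φ) (x y : E n) : fderiv ℝ (fun y => φ (x - y)) y = - fderiv ℝ φ (x - y) := by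
  have h1 : HasFDerivAt (fun y : E n => x - y) (-(ContinuousLinearMap.id ℝ (E n))) y := by
    simpa using (hasFDerivAt_id y).const_sub x
  have h2 := ((hφ.diff (x - y)).hasFDerivAt.comp y h1).fderiv
  change fderiv ℝ (fun y => φ (x - y)) y = _ at h2
  rw [h2]; ext v; simp

lemma T_pd {n : ℕ} {φ f : E n → ℝ} (hφ : Sm φ) (hc : HasCompactSupport φ) (hf : Sm f) (i : Fin n) : 
    T (pd i φ) f = T φ (pd i f) := by
  ext x
  have h := ibp1 hf.c1 (refl_sm hφ x).c1 (refl_cs hc x) i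
  unfold T
  have e1 : ∀ y, pd i (fun y => φ (x - y)) y = - pd i φ (x - y) := by
    intro y; unfold pd; rw [fderiv_refl hφ]; rfl
  simp only [e1, mul_neg, integral_neg] at h
  linarith

lemma cs_pd {n : ℕ} {φ : E n → ℝ} (hc : HasCompactSupport φ) (i : Fin n) : HasCompactSupport (pd i φ) := 
  (hc.fderiv (𝕜:=ℝ)).mono (by intro x hx; simp only [Function.mem_support, pd] at hx ⊢; contrapose! hx; simp [hx])

lemma tsupport_pd {n : ℕ} {φ : E n → ℝ} (i : Fin n) : tsupport (pd i φ) ⊆ tsupport φ := 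
  tsupport_fderiv_apply_subset ℝ (e i)

lemma T_int {n : ℕ} {φ f : E n → ℝ} (hφ : Continuous φ) (hc : HasCompactSupport φ) (hf : Continuous f) (x : E n) : 
    Integrable (fun y => f y * φ (x - y)) volume := 
  (hf.mul (hφ.comp (continuous_const.sub continuous_id))).integrable_of_hasCompactSupport (refl_cs hc x).mul_left

lemma int_prod {n : ℕ} {Y : Type*} [TopologicalSpace Y] [T2Space Y] [MeasurableSpace Y] [BorelSpace Y] [SecondCountableTopology Y]
    (ν : Measure Y) [IsFiniteMeasureOnCompacts ν] [SFinite ν] {G : E n × Y → ℝ} (hG : Continuous G) {s k : Set Y} (hk : IsCompact k) (hs : s ⊆ k) :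
    Integrable G ((volume.restrict (ball (0 : E n) 1)).prod (ν.restrict s)) := by
  rw [Measure.prod_restrict]
  have : IntegrableOn G (closedBall 0 1 ×ˢ k) ((volume : Measure (E n)).prod ν) := 
    hG.continuousOn.integrableOn_compact ((isCompact_closedBall _ _).prod hk)
  exact this.mono_set (Set.prod_mono ball_subset_closedBall hs)

lemma shift_le {n : ℕ} {f : E n → ℝ} (hf : Continuous f) (h0 : ∀ x, 0 ≤ f x) {z : E n} (hz : ‖z‖ ≤ 1) : 
    ∫ x in ball (0 : E n) 1, f (x - z) ≤ ∫ x in ball (0 : E n) 2, f x := by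
  have h1 : ∫ x in ball (0 : E n) 1, f (x - z) = ∫ x in ball (-z) 1, f x := by
    rw [← integral_indicator measurableSet_ball, ← integral_indicator measurableSet_ball,
      ← integral_sub_right_eq_self (fun x => (ball (-z) 1).indicator f x) z]
    congr 1; ext x
    simp [indicator, mem_ball, dist_eq_norm]
  rw [h1]
  refine setIntegral_mono_set ?_ (ae_of_all _ h0) (ae_of_all _ ?_)
  · exact (hf.continuousOn.integrableOn_compact (isCompact_closedBall (0:E n) 2)).mono_set ball_subset_closedBall
  · intro x hx
    have hx' : ‖x + z‖ < 1 := by simpa [dist_eq_norm] using (show x ∈ ball (-z) 1 from hx)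
    change x ∈ ball (0 : E n) 2
    rw [mem_ball_zero_iff]
    have := norm_sub_le (x + z) z
    rw [add_sub_cancel_right] at this; linarith

/-- mollifier -/
structure Moll {n : ℕ} (δ : ℝ) (φ : E n → ℝ) : Prop where
  sm : Sm φ
  cs : HasCompactSupport φ
  supp : tsupport φ ⊆ closedBall 0 δ
  nonneg : ∀ x, 0 ≤ φ x
  int : ∫ x, φ x = 1

lemma exists_moll (n : ℕ) {δ : ℝ} (hδ : 0 < δ) : ∃ φ : E n → ℝ, Moll δ φ := by
  let f : ContDiffBump (0 : E n) := ⟨δ/2, δ, by linarith, by linarith⟩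
  exact ⟨f.normed volume, f.contDiff_normed, f.hasCompactSupport_normed, by rw [f.tsupport_normed_eq], f.nonneg_normed, f.integral_normed⟩

lemma moll_jensen {n : ℕ} {δ : ℝ} {φ G : E n → ℝ} (hφ : Moll δ φ) (hG : Continuous G) : 
    (∫ z, φ z * G z) ^ 2 ≤ ∫ z, φ z * G z ^ 2 := by
  set m := ∫ z, φ z * G z with hm
  have i1 : ∀ F : E n → ℝ, Continuous F → Integrable (fun z => φ z * F z) volume := fun F hF => 
    (hφ.sm.continuous.mul hF).integrable_of_hasCompactSupport hφ.cs.mul_right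
  have h0 : 0 ≤ ∫ z, φ z * (G z - m) ^ 2 := integral_nonneg fun z => mul_nonneg (hφ.nonneg z) (sq_nonneg _)
  have h1 : ∫ z, φ z * (G z - m) ^ 2 = (∫ z, φ z * G z ^ 2) - 2 * m * m + m ^ 2 := by
    have : ∀ z, φ z * (G z - m) ^ 2 = φ z * G z ^ 2 - (2 * m) * (φ z * G z) + m ^ 2 * φ z := fun t => by ring
    simp only [this]
    have j : Integrable φ volume := hφ.sm.continuous.integrable_of_hasCompactSupport hφ.cs
    have j2 : Integrable (fun z => φ z * G z ^ 2) volume := i1 _ (hG.pow 2)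
    have j1 : Integrable (fun z => (2 * m) * (φ z * G z)) volume := (i1 _ hG).const_mul _
    have j12 : Integrable (fun z => φ z * G z ^ 2 - (2 * m) * (φ z * G z)) volume := j2.sub j1
    rw [integral_add j12 (j.const_mul _), integral_sub j2 j1,
      integral_const_mul, integral_const_mul, hφ.int, ← hm]
    ring
  nlinarith

lemma T_sq {n : ℕ} {δ S : ℝ} {φ : E n → ℝ} {G : E n × E n → ℝ} (hφ : Moll δ φ) (hG : Continuous G) 
    (hS : ∀ z ∈ closedBall (0 : E n) δ, ∫ x in ball (0 : E n) 1, G (x, z) ^ 2 ≤ S) : 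
    ∫ x in ball (0 : E n) 1, (∫ z, φ z * G (x, z)) ^ 2 ≤ S := by
  have hzero : ∀ z, z ∉ closedBall (0 : E n) δ → φ z = 0 := fun z hz => zero_of_nmem_tsupport fun h => hz (hφ.supp h)
  have hcont : Continuous (fun p : E n × E n => φ p.2 * G p ^ 2) := (hφ.sm.continuous.comp continuous_snd).mul (hG.pow 2)
  have e0 : ∀ F : E n → ℝ, ∫ z, φ z * F z = ∫ z in closedBall (0 : E n) δ, φ z * F z := by
    intro F
    rw [setIntegral_eq_integral_of_forall_compl_eq_zero]
    intro z hz; rw [hzero z hz, zero_mul]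
  have hi := int_prod (volume : Measure (E n)) hcont (isCompact_closedBall (0 : E n) δ) subset_rfl
  have step : ∫ x in ball (0 : E n) 1, (∫ z, φ z * G (x, z)) ^ 2 ≤ ∫ x in ball (0 : E n) 1, ∫ z in closedBall (0 : E n) δ, φ z * G (x, z) ^ 2 := by
    refine integral_mono_of_nonneg (ae_of_all _ fun x => sq_nonneg _) hi.integral_prod_left (ae_of_all _ fun x => ?_)
    have := moll_jensen hφ (G := fun z => G (x, z)) (by fun_prop)
    refine this.trans (le_of_eq (e0 _))
  refine step.trans ?_
  rw [integral_integral_swap (f := fun x z => φ z * G (x, z) ^ 2) hi]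
  have : ∫ z in closedBall (0 : E n) δ, φ z * S = S := by
    rw [← e0, integral_mul_const, hφ.int, one_mul]
  rw [← this]
  refine setIntegral_mono_on hi.integral_prod_right ?_ measurableSet_closedBall fun z hz => ?_
  · exact ((hφ.sm.continuous.mul continuous_const).continuousOn.integrableOn_compact (isCompact_closedBall _ _))
  · change ∫ x in ball (0 : E n) 1, φ z * G (x, z) ^ 2 ≤ _
    rw [integral_const_mul]
    exact mul_le_mul_of_nonneg_left (hS z hz) (hφ.nonneg z)

lemma T_L2 {n : ℕ} {δ : ℝ} {φ F : E n → ℝ} (hφ : Moll δ φ) (hδ : δ ≤ 1) (hF : Continuous F) : 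
    ∫ x in ball (0 : E n) 1, T φ F x ^ 2 ≤ ∫ x in ball (0 : E n) 2, F x ^ 2 := by
  simp only [T_eq]
  refine T_sq (G := fun p => F (p.1 - p.2)) hφ (by fun_prop) fun z hz => ?_
  exact shift_le (f := fun x => F x ^ 2) (hF.pow 2) (fun x => sq_nonneg _) ((mem_closedBall_zero_iff.1 hz).trans hδ)

lemma T_diff {n : ℕ} {δ : ℝ} {φ F : E n → ℝ} (hφ : Moll δ φ) (hδ0 : 0 ≤ δ) (hδ : δ ≤ 1) (hF : ContDiff ℝ 1 F) : 
    ∫ x in ball (0 : E n) 1, (F x - T φ F x) ^ 2 ≤ δ ^ 2 * ∫ x in ball (0 : E n) 2, ‖fderiv ℝ F x‖ ^ 2 := by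
  have cF := hF.continuous
  have cF' : Continuous (fderiv ℝ F) := hF.continuous_fderiv one_ne_zero
  have e1 : ∀ x, F x - T φ F x = ∫ z, φ z * (F x - F (x - z)) := by
    intro x
    simp only [mul_sub]
    rw [integral_sub, integral_mul_const, hφ.int, one_mul, T_eq]
    · exact (hφ.sm.continuous.mul continuous_const).integrable_of_hasCompactSupport hφ.cs.mul_right
    · exact (hφ.sm.continuous.mul (by fun_prop)).integrable_of_hasCompactSupport hφ.cs.mul_right
  simp only [e1]
  refine T_sq (G := fun p => F p.1 - F (p.1 - p.2)) hφ (by fun_prop) fun z hz => ?_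
  have hz' := mem_closedBall_zero_iff.1 hz
  set K : E n × ℝ → ℝ := fun p => ‖fderiv ℝ F (p.1 - z + p.2 • z)‖ ^ 2 with hK
  have hKc : Continuous K := by fun_prop
  have hi := int_prod (volume : Measure ℝ) hKc (isCompact_Icc (a := (0:ℝ)) (b := 1)) Ioc_subset_Icc_self
  have step : ∫ x in ball (0 : E n) 1, (F x - F (x - z)) ^ 2 ≤ ∫ x in ball (0 : E n) 1, ‖z‖ ^ 2 * ∫ t in Ioc (0:ℝ) 1, K (x, t) := by
    refine integral_mono_of_nonneg (ae_of_all _ fun x => sq_nonneg _) (hi.integral_prod_left.const_mul _) (ae_of_all _ fun x => ?_)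
    have := segment_sq_le hF x (x - z)
    rw [sub_sub_cancel, intervalIntegral.integral_of_le (by norm_num)] at this
    exact this
  refine step.trans ?_
  rw [integral_const_mul, integral_integral_swap (f := fun x t => K (x, t)) hi]
  have hnn : 0 ≤ ∫ x in ball (0 : E n) 2, ‖fderiv ℝ F x‖ ^ 2 := integral_nonneg fun x => by positivity
  have h3 : ∫ t in Ioc (0:ℝ) 1, ∫ x in ball (0 : E n) 1, K (x, t) ≤ ∫ t in Ioc (0:ℝ) 1, ∫ x in ball (0 : E n) 2, ‖fderiv ℝ F x‖ ^ 2 := by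
    refine setIntegral_mono_on hi.integral_prod_right (integrableOn_const (by simp)) measurableSet_Ioc fun t ht => ?_
    have h4 := shift_le (f := fun x => ‖fderiv ℝ F x‖ ^ 2) (by fun_prop) (fun x => by positivity) (z := (1 - t) • z) ?_
    · refine le_trans (le_of_eq ?_) h4
      refine integral_congr_ae (ae_of_all _ fun x => ?_)
      simp only [hK]
      congr 4; rw [sub_smul, one_smul]; abel
    · rw [norm_smul, Real.norm_of_nonneg (by linarith [ht.2])]
      have := ht.1
      have := norm_nonneg z
      nlinarith
  have h5 : ∫ t in Ioc (0:ℝ) 1, ∫ x in ball (0 : E n) 2, ‖fderiv ℝ F x‖ ^ 2 = ∫ x in ball (0 : E n) 2, ‖fderiv ℝ F x‖ ^ 2 := by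
    rw [setIntegral_const]; simp
  rw [h5] at h3
  gcongr

end EK


namespace EK

/-- gradient component minus its affine model -/
noncomputable def gk {n : ℕ} (h : E n → ℝ) (A : Fin n → Fin n → ℝ) (k : Fin n) (x : E n) : ℝ := pd k h x - ∑ i, A k i * x i

lemma gk_sm {n : ℕ} {h : E n → ℝ} (hh : Sm h) (A : Fin n → Fin n → ℝ) (k : Fin n) : Sm (gk h A k) := 
  (hh.pd k).sub (lin_sm _)

lemma pd_gk {n : ℕ} {h : E n → ℝ} (hh : Sm h) (A : Fin n → Fin n → ℝ) (k i : Fin n) (x : E n) : 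
    pd i (gk h A k) x = Hf h x k i - A k i := by
  have h1 : fderiv ℝ (gk h A k) x = _ := (((hh.pd k).diff x).hasFDerivAt.fun_sub ((lin_sm (A k)).diff x).hasFDerivAt).fderiv
  unfold pd at h1 ⊢
  rw [h1]
  have h2 := pd_lin (A k) i x
  unfold pd at h2
  rw [Hf_symm hh]
  simp only [sub_apply, h2]; rfl

lemma norm_fderiv_sq {n : ℕ} (f : E n → ℝ) (x : E n) : ‖fderiv ℝ f x‖ ^ 2 = ∑ i, pd i f x ^ 2 := norm_sq_dual _

lemma sum_gk {n : ℕ} {h : E n → ℝ} (hh : Sm h) (A : Fin n → Fin n → ℝ) (x : E n) : 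
    ∑ k, ‖fderiv ℝ (gk h A k) x‖ ^ 2 = dv h A x := by
  unfold dv
  refine Finset.sum_congr rfl fun k _ => ?_
  rw [norm_fderiv_sq]
  simp only [pd_gk hh]

lemma gk_le {n : ℕ} {h : E n → ℝ} (hh : Sm h) (A : Fin n → Fin n → ℝ) (k : Fin n) (x : E n) : 
    ‖fderiv ℝ (gk h A k) x‖ ^ 2 ≤ dv h A x := by
  rw [← sum_gk hh]
  exact Finset.single_le_sum (f := fun k => ‖fderiv ℝ (gk h A k) x‖ ^ 2) (fun _ _ => by positivity) (Finset.mem_univ k)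

lemma Lop_affine {n : ℕ} {b : ℝ} {h : E n → ℝ} (c : Fin n → ℝ) (c0 : ℝ) (x : E n) : Lop b h (fun x => c0 + ∑ i, c i * x i) x = 0 := by
  rw [Lop_eq]
  have : ∀ j, pd j (fun x : E n => c0 + ∑ i, c i * x i) = fun _ => c j := by
    intro j; ext y
    rw [pd_add contDiff_const (lin_sm c), pd_lin]; simp [pd]
  simp only [this]
  simp [pd]

lemma Lop_gk {n : ℕ} {R b : ℝ} {h : E n → ℝ} (hs : Sol R b h) (A : Fin n → Fin n → ℝ) (k : Fin n) : 
    ∀ x ∈ ball (0 : E n) R, Lop b h (gk h A k) x = 0 := by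
  intro x hx
  have h1 : gk h A k = fun x => pd k h x + (0 + ∑ i, (- A k i) * x i) := by
    ext y; unfold gk; simp [sub_eq_add_neg]
  rw [h1, Lop_add (hs.sm.pd k) (contDiff_const.add (lin_sm _)), Lop_affine, add_zero]
  exact hs.lin (e k) x hx

lemma cof_lip (n : ℕ) : ∃ C ≥ 0, ∀ A B : Fin n → Fin n → ℝ, (∀ i j, |A i j| ≤ 1) → (∀ i j, |B i j| ≤ 1) → 
    ∀ i j, |cof i j A - cof i j B| ≤ C * ‖A - B‖ := by
  have : ∀ i j : Fin n, ∃ C, ∀ A ∈ closedBall (0 : Fin n → Fin n → ℝ) 1, ‖fderiv ℝ (cof i j) A‖ ≤ C := fun i j =>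
    (isCompact_closedBall _ _).exists_bound_of_continuousOn ((cof_contDiff i j).continuous_fderiv (by simp)).continuousOn
  choose C hC using this
  refine ⟨∑ i, ∑ j, |C i j|, by positivity, fun A B hA hB i j => ?_⟩
  have h1 := (convex_closedBall (0 : Fin n → Fin n → ℝ) 1).norm_image_sub_le_of_norm_fderiv_le (𝕜 := ℝ) (f := cof i j)
    (fun x _ => (cof_contDiff i j).differentiable (by simp) x) (hC i j) (x := B) (y := A)
    (by simpa using norm_le_one hB) (by simpa using norm_le_one hA)
  have h2 : |C i j| ≤ ∑ j, |C i j| := Finset.single_le_sum (f := fun j => |C i j|) (fun _ _ => abs_nonneg _) (Finset.mem_univ j)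
  have h3 : ∑ j, |C i j| ≤ ∑ i, ∑ j, |C i j| := Finset.single_le_sum (f := fun i => ∑ j, |C i j|) (fun _ _ => by positivity) (Finset.mem_univ i)
  rw [Real.norm_eq_abs] at h1
  refine h1.trans ?_
  gcongr
  linarith [le_abs_self (C i j)]

lemma entry_sq_le {n : ℕ} (h : E n → ℝ) (A : Fin n → Fin n → ℝ) (x : E n) (i j : Fin n) : (Hf h x i j - A i j) ^ 2 ≤ dv h A x := by
  unfold dv
  refine le_trans ?_ (Finset.single_le_sum (f := fun i => ∑ j, (Hf h x i j - A i j) ^ 2) (fun _ _ => by positivity) (Finset.mem_univ i))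
  exact Finset.single_le_sum (f := fun j => (Hf h x i j - A i j) ^ 2) (fun _ _ => by positivity) (Finset.mem_univ j)

lemma norm_le_dv {n : ℕ} (h : E n → ℝ) (A : Fin n → Fin n → ℝ) (x : E n) : ‖Hf h x - A‖ ≤ √(dv h A x) := by
  refine mat_norm_le (Real.sqrt_nonneg _) fun i j => ?_
  refine Real.abs_le_sqrt ?_
  exact entry_sq_le h A x i j

lemma Lop_T {n : ℕ} {b : ℝ} {A : Fin n → Fin n → ℝ} (hA : ∀ i j, A i j = A j i) {ψ g : E n → ℝ} (hψ : Sm ψ) (hc : HasCompactSupport ψ)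
    (hg : Sm g) (x : E n) : Lop b (hq A) (T ψ g) x = ∫ y, Lop b (hq A) g y * ψ (x - y) := by
  have e1 : ∀ i j, pd i (pd j (T ψ g)) = T ψ (pd i (pd j g)) := by
    intro i j
    rw [pd_T hψ hc hg.continuous, T_pd hψ hc hg, pd_T hψ hc (hg.pd j).continuous, T_pd hψ hc (hg.pd j)]
  have e2 : ∀ y i j, am b (hq A) y i j = am b (hq A) x i j := by
    intro y i j; rw [am_apply, am_apply, Hf_hq hA, Hf_hq hA]
  have hi : ∀ i j, Integrable (fun y => am b (hq A) x i j * (pd i (pd j g) y * ψ (x - y))) volume := fun i j => 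
    (T_int hψ.continuous hc ((hg.pd j).pd i).continuous x).const_mul _
  simp only [Lop_eq, e1, e2 _ _ _, Finset.sum_mul, mul_assoc]
  rw [integral_finsetSum _ fun i _ => integrable_finsetSum _ fun j _ => hi i j]
  refine Finset.sum_congr rfl fun i _ => ?_
  rw [integral_finsetSum _ fun j _ => hi i j]
  refine Finset.sum_congr rfl fun j _ => ?_
  rw [integral_const_mul]; rfl

lemma dual_e_le {n : ℕ} (ξ : E n →L[ℝ] ℝ) (i : Fin n) : |ξ (e i)| ≤ ‖ξ‖ := by
  have h := ξ.le_opNorm (e i)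
  have h2 : ‖(e i : E n)‖ = 1 := by simp [e]
  rw [h2, mul_one] at h
  exact h

/-- the mollified function almost solves the constant coefficient equation -/
lemma L0T (n : ℕ) {b : ℝ} (hb : 0 ≤ b) : ∃ C > 0, ∀ (h : E n → ℝ) (A : Fin n → Fin n → ℝ), Sol 2 b h → (Matrix.of A).PosSemidef → trF A ≤ 1 → 
    ∀ (k : Fin n) (δ P : ℝ) (ψ : E n → ℝ), δ < 1 → Sm ψ → HasCompactSupport ψ → tsupport ψ ⊆ closedBall 0 δ → (∀ x, ‖fderiv ℝ ψ x‖ ≤ P) → 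
    ∀ x ∈ ball (0 : E n) 1, |Lop b (hq A) (T ψ (gk h A k)) x| ≤ C * P * En h A := by
  obtain ⟨C, hC, hlip⟩ := cof_lip n
  refine ⟨n * (n * (b * C)) + 1, by positivity, fun h A hs hA htr k δ P ψ hδ hψ hc hsupp hP x hx => ?_⟩
  have hP0 : 0 ≤ P := (norm_nonneg _).trans (hP 0)
  have hsym := psd_sym hA
  set g := gk h A k with hg
  have hgs : Sm g := gk_sm hs.sm A k
  have cg' : Continuous (fderiv ℝ g) := hgs.c1.continuous_fderiv one_ne_zero
  set Ψ : E n → ℝ := fun y => ψ (x - y) with hΨ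
  have hΨs : Sm Ψ := refl_sm hψ x
  have hΨc : HasCompactSupport Ψ := refl_cs hc x
  have cΨ' : Continuous (fderiv ℝ Ψ) := hΨs.c1.continuous_fderiv one_ne_zero
  have hout : ∀ y, y ∉ ball (0 : E n) 2 → y ∉ tsupport Ψ := by
    intro y hy hyt
    have h1 : x - y ∈ tsupport ψ := by
      have := tsupport_comp_subset_preimage ψ (f := fun y => x - y) (by fun_prop)
      exact this hyt
    have h2 := mem_closedBall_zero_iff.1 (hsupp h1)
    rw [mem_ball_zero_iff] at hx hy
    apply hy
    have := norm_sub_le x (x - y)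
    rw [sub_sub_cancel] at this; linarith
  rw [Lop_T hsym hψ hc hgs]
  have e1 := ibp (b := b) hs.sm hgs hΨs.c1 hΨc
  have e2 := ibp (b := b) (hq_sm A) hgs hΨs.c1 hΨc
  have e3 : ∫ y, Lop b h g y * Ψ y = 0 := by
    have : ∀ y, Lop b h g y * Ψ y = 0 := by
      intro y
      by_cases hy : y ∈ ball (0 : E n) 2
      · rw [Lop_gk hs A k y hy, zero_mul]
      · rw [zero_of_nmem_tsupport (hout y hy), mul_zero]
    simp [this]
  rw [e3, neg_zero] at e1
  have hb1 : ∀ (h : E n → ℝ), Sm h → Integrable (fun y => bf (am b h y) (fderiv ℝ g y) (fderiv ℝ Ψ y)) volume := by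
    intro h hh
    refine (continuous_bf (fun i j => (am_sm hh i j).continuous) cg' cΨ').integrable_of_hasCompactSupport ?_
    refine (hΨc.fderiv (𝕜 := ℝ)).mono ?_
    intro y hy
    simp only [Function.mem_support] at hy ⊢
    contrapose! hy; rw [hy]; exact bf_zero_right _ _
  have e4 : ∫ y, Lop b (hq A) g y * Ψ y = ∫ y, (bf (am b h y) (fderiv ℝ g y) (fderiv ℝ Ψ y) - bf (am b (hq A) y) (fderiv ℝ g y) (fderiv ℝ Ψ y)) := by
    rw [integral_sub (hb1 h hs.sm) (hb1 _ (hq_sm A)), e1, e2]; ring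
  have hpt : ∀ y ∈ ball (0 : E n) 2, ‖bf (am b h y) (fderiv ℝ g y) (fderiv ℝ Ψ y) - bf (am b (hq A) y) (fderiv ℝ g y) (fderiv ℝ Ψ y)‖ ≤ 
      (n * (n * (b * C)) + 1) * P * dv h A y := by
    intro y hy
    have hD := dv_nonneg h A y
    have q1 : ∀ i, |fderiv ℝ g y (e i)| ≤ √(dv h A y) := fun i => 
      (dual_e_le _ i).trans (Real.le_sqrt_of_sq_le (gk_le hs.sm A k y))
    have q2 : ∀ j, |fderiv ℝ Ψ y (e j)| ≤ P := by
      intro j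
      refine (dual_e_le _ j).trans ?_
      rw [hΨ, fderiv_refl hψ, norm_neg]; exact hP _
    have q3 : ∀ i j, |am b h y i j - am b (hq A) y i j| ≤ b * (C * √(dv h A y)) := by
      intro i j
      rw [am_apply, am_apply, add_sub_add_left_eq_sub, ← mul_sub, abs_mul, abs_of_nonneg hb, Hf_hq hsym]
      refine mul_le_mul_of_nonneg_left ?_ hb
      refine (hlip _ _ (psd_entry (hs.psd y hy) (hs.tr_le hb y hy)) (psd_entry hA htr) i j).trans ?_
      exact mul_le_mul_of_nonneg_left (norm_le_dv h A y) hC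
    have q4 : bf (am b h y) (fderiv ℝ g y) (fderiv ℝ Ψ y) - bf (am b (hq A) y) (fderiv ℝ g y) (fderiv ℝ Ψ y) = 
        ∑ i, ∑ j, (am b h y i j - am b (hq A) y i j) * fderiv ℝ g y (e i) * fderiv ℝ Ψ y (e j) := by
      simp only [bf, ← Finset.sum_sub_distrib]
      refine Finset.sum_congr rfl fun i _ => Finset.sum_congr rfl fun j _ => by ring
    have q5 : ∀ i j, ‖(am b h y i j - am b (hq A) y i j) * fderiv ℝ g y (e i) * fderiv ℝ Ψ y (e j)‖ ≤ b * C * P * dv h A y := by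
      intro i j
      rw [norm_mul, norm_mul]
      calc _ ≤ (b * (C * √(dv h A y))) * √(dv h A y) * P := by
            gcongr
            · exact q3 i j
            · exact q1 i
            · exact q2 j
        _ = b * C * P * (√(dv h A y) * √(dv h A y)) := by ring
        _ = _ := by rw [Real.mul_self_sqrt hD]
    rw [q4]
    calc _ ≤ ∑ i : Fin n, ∑ j : Fin n, b * C * P * dv h A y := 
          (norm_sum_le _ _).trans (Finset.sum_le_sum fun i _ => (norm_sum_le _ _).trans (Finset.sum_le_sum fun j _ => q5 i j))
      _ = n * (n * (b * C)) * P * dv h A y := by simp; ring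
      _ ≤ _ := by gcongr; linarith
  rw [show (∫ y, Lop b (hq A) g y * ψ (x - y)) = ∫ y, Lop b (hq A) g y * Ψ y from rfl, e4, 
    ← setIntegral_eq_integral_of_forall_compl_eq_zero (s := ball (0 : E n) 2)]
  · rw [← Real.norm_eq_abs, En, ← integral_const_mul]
    refine norm_integral_le_of_norm_le ?_ ?_
    · exact (((dv_cont hs.sm A).const_mul _).continuousOn.integrableOn_compact (isCompact_closedBall (0:E n) 2)).mono_set ball_subset_closedBall
    · exact (ae_restrict_iff' measurableSet_ball).2 (ae_of_all _ hpt)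
  · intro y hy
    have : fderiv ℝ Ψ y = 0 := by
      by_contra h1
      exact hout y hy (support_fderiv_subset ℝ h1)
    simp [this, bf_zero_right]

end EK


namespace EK

lemma bdd_of_cs {n : ℕ} {F : Type*} [NormedAddCommGroup F] {f : E n → F} (hf : Continuous f) (hc : HasCompactSupport f) : ∃ K ≥ 0, ∀ x, ‖f x‖ ≤ K := by
  obtain ⟨K, hK⟩ := hc.exists_bound_of_continuous hf
  exact ⟨|K|, abs_nonneg _, fun x => (hK x).trans (le_abs_self _)⟩

lemma Lop_bdd {n : ℕ} {b : ℝ} (hb : 0 ≤ b) {η : E n → ℝ} (hη : Sm η) (hc : HasCompactSupport η) : ∃ K > 0, ∀ (h : E n → ℝ) (x : E n), 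
    (Matrix.of (Hf h x)).PosSemidef → trF (Hf h x) ≤ 1 → |Lop b h η x| ≤ K := by
  obtain ⟨Λ, hΛ, ham⟩ := am_bdd n b hb
  have : ∀ i j : Fin n, ∃ K ≥ 0, ∀ x, ‖pd i (pd j η) x‖ ≤ K := fun i j => 
    bdd_of_cs ((hη.pd j).pd i).continuous (cs_pd (cs_pd hc j) i)
  choose K hK0 hK using this
  refine ⟨1 + ∑ i, ∑ j, Λ * K i j, ?_, fun h x hp ht => ?_⟩
  · have : 0 ≤ ∑ i, ∑ j, Λ * K i j := Finset.sum_nonneg fun i _ => Finset.sum_nonneg fun j _ => mul_nonneg hΛ.le (hK0 i j)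
    linarith
  · rw [Lop_eq]
    have h1 : |∑ i, ∑ j, am b h x i j * pd i (pd j η) x| ≤ ∑ i, ∑ j, Λ * K i j := by
      refine (Finset.abs_sum_le_sum_abs _ _).trans (Finset.sum_le_sum fun i _ => ?_)
      refine (Finset.abs_sum_le_sum_abs _ _).trans (Finset.sum_le_sum fun j _ => ?_)
      rw [abs_mul]
      exact mul_le_mul (ham h x hp ht i j) (hK i j x) (abs_nonneg _) hΛ.le
    linarith

lemma intOn {n : ℕ} {f : E n → ℝ} (hf : Continuous f) (r : ℝ) : IntegrableOn f (ball (0 : E n) r) := 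
  (hf.continuousOn.integrableOn_compact (isCompact_closedBall (0:E n) r)).mono_set ball_subset_closedBall

lemma setInt_mono {n : ℕ} {f : E n → ℝ} (hf : Continuous f) (h0 : ∀ x, 0 ≤ f x) {r s : ℝ} (hrs : r ≤ s) : 
    ∫ x in ball (0 : E n) r, f x ≤ ∫ x in ball (0 : E n) s, f x := 
  setIntegral_mono_set (intOn hf s) (ae_of_all _ h0) (HasSubset.Subset.eventuallyLE (ball_subset_ball hrs))

lemma cacc_L2 (n : ℕ) {b : ℝ} (hb : 0 ≤ b) : ∃ C > 0, ∀ (A : Fin n → Fin n → ℝ), (Matrix.of A).PosSemidef → trF A ≤ 1 → 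
    ∀ (y : E n → ℝ) (S : ℝ), Sm y → (∀ x ∈ ball (0 : E n) 1, |Lop b (hq A) y x| ≤ S) → 
    ∫ x in ball (0 : E n) (1/2), ‖fderiv ℝ y x‖ ^ 2 ≤ C * ((∫ x in ball (0 : E n) 1, y x ^ 2) + S ^ 2) := by
  obtain ⟨C₀, _, hcut⟩ := exists_cutoff n
  obtain ⟨η, hη, hηc, hηs, hη0, hη1, hηe, -⟩ := hcut (1/2) 1 (by norm_num) (by norm_num)
  obtain ⟨K, hK, hLη⟩ := Lop_bdd hb hη hηc
  set V := volume.real (ball (0 : E n) 1) with hV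
  have hV0 : 0 ≤ V := measureReal_nonneg
  refine ⟨K + 1 + V, by positivity, fun A hA htr y S hy hS => ?_⟩
  have hsym := psd_sym hA
  have cy' : Continuous (fderiv ℝ y) := hy.c1.continuous_fderiv one_ne_zero
  have hout : ∀ x, x ∉ ball (0 : E n) 1 → x ∉ tsupport η := fun x hx h => hx (hηs h)
  have e1 := cacc2 (b := b) hb (hq_sm A) hy hη hηc hη0 (fun x _ => by rw [Hf_hq hsym]; exact hA)
  have e2 : ∫ x in ball (0 : E n) (1/2), ‖fderiv ℝ y x‖ ^ 2 ≤ ∫ x, η x * ‖fderiv ℝ y x‖ ^ 2 := by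
    have : ∫ x in ball (0 : E n) (1/2), ‖fderiv ℝ y x‖ ^ 2 = ∫ x in ball (0 : E n) (1/2), η x * ‖fderiv ℝ y x‖ ^ 2 := by
      refine setIntegral_congr_fun measurableSet_ball fun x hx => ?_
      rw [hηe x (ball_subset_closedBall hx), one_mul]
    rw [this]
    exact setIntegral_le_integral ((hη.continuous.mul (cy'.norm.pow 2)).integrable_of_hasCompactSupport hηc.mul_right) 
      (ae_of_all _ fun x => mul_nonneg (hη0 x) (by positivity))
  have e3 : ∫ x, y x ^ 2 * Lop b (hq A) η x ≤ K * ∫ x in ball (0 : E n) 1, y x ^ 2 := by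
    rw [← setIntegral_eq_integral_of_forall_compl_eq_zero (s := ball (0 : E n) 1) 
      (fun x hx => by rw [Lop_zero_of_nmem (hout x hx), mul_zero]), ← integral_const_mul]
    refine setIntegral_mono_on (intOn ((hy.continuous.pow 2).mul (Lop_cont (hq_sm A) hη)) 1) 
      (intOn (continuous_const.mul (hy.continuous.pow 2)) 1) measurableSet_ball fun x _ => ?_
    have h1 := hLη (hq A) x (by rw [Hf_hq hsym]; exact hA) (by rw [Hf_hq hsym]; exact htr)
    have h2 := (le_abs_self _).trans h1
    rw [mul_comm]
    exact mul_le_mul_of_nonneg_right h2 (sq_nonneg _)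
  have e4 : -∫ x, η x * (y x * Lop b (hq A) y x) ≤ (1/2) * (∫ x in ball (0 : E n) 1, y x ^ 2) + (1/2) * (V * S ^ 2) := by
    rw [← setIntegral_eq_integral_of_forall_compl_eq_zero (s := ball (0 : E n) 1) 
      (fun x hx => by rw [zero_of_nmem_tsupport (hout x hx), zero_mul]), ← integral_neg, ← integral_const_mul]
    have h3 : (1/2) * (V * S ^ 2) = ∫ x in ball (0 : E n) 1, (1/2) * S ^ 2 := by
      rw [setIntegral_const, smul_eq_mul, ← hV]; ring
    have i1 : IntegrableOn (fun _ : E n => (1/2) * S ^ 2) (ball (0 : E n) 1) := integrableOn_const measure_ball_lt_top.ne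
    have i2 : IntegrableOn (fun x : E n => (1/2) * y x ^ 2) (ball (0 : E n) 1) := intOn (continuous_const.mul (hy.continuous.pow 2)) 1
    rw [h3, ← integral_add i2 i1]
    refine setIntegral_mono_on (intOn (hη.continuous.mul (hy.continuous.mul (Lop_cont (hq_sm A) hy))).neg 1) 
      (i2.add i1) measurableSet_ball fun x hx => ?_
    have h1 := abs_le.1 (hS x hx)
    have h5 : (Lop b (hq A) y x) ^ 2 ≤ S ^ 2 := sq_le_sq' h1.1 h1.2
    have h6 := hη0 x
    have h7 := hη1 x
    have h8 : -(y x * Lop b (hq A) y x) ≤ (1/2) * y x ^ 2 + (1/2) * S ^ 2 := by nlinarith [sq_nonneg (y x + Lop b (hq A) y x)]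
    have h9 : 0 ≤ (1/2) * y x ^ 2 + (1/2) * S ^ 2 := by positivity
    nlinarith
  have hI : 0 ≤ ∫ x in ball (0 : E n) 1, y x ^ 2 := integral_nonneg fun x => sq_nonneg _
  have hS2 := sq_nonneg S
  have hp1 : 0 ≤ V * (∫ x in ball (0 : E n) 1, y x ^ 2) := by positivity
  have hp2 : 0 ≤ K * (∫ x in ball (0 : E n) 1, y x ^ 2) := by positivity
  have hp3 : 0 ≤ K * S ^ 2 := by positivity
  have hp4 : 0 ≤ V * S ^ 2 := by positivity
  nlinarith

lemma sup_L2 (n : ℕ) (hn : 2 ≤ n) {b : ℝ} (hb : 0 ≤ b) : ∃ C > 0, ∀ (A : Fin n → Fin n → ℝ), (Matrix.of A).PosSemidef → trF A ≤ 1 → 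
    ∀ (w : E n → ℝ) (S : ℝ), Sm w → 0 < S → (∀ x ∈ ball (0 : E n) 1, |Lop b (hq A) w x| ≤ S) → 
    ∀ x ∈ ball (0 : E n) (1/4), |w x| ≤ C * √((∫ x in ball (0 : E n) (1/2), w x ^ 2) + S ^ 2) := by
  obtain ⟨Λ, hΛ, hell⟩ := ell_exists' n b hb
  obtain ⟨C, hC, hmos⟩ := moser n hn Λ
  set V := volume.real (ball (0 : E n) (1/2)) with hV
  have hV0 : 0 ≤ V := measureReal_nonneg
  refine ⟨C * √(8 * (1 + V)), by positivity, fun A hA htr => ?_⟩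
  have hsym := psd_sym hA
  have hE : Ell Λ (am b (hq A)) := hell _ (hq_sm A) fun x _ => by rw [Hf_hq hsym]; exact ⟨hA, htr⟩
  suffices H : ∀ (w : E n → ℝ) (S : ℝ), Sm w → 0 < S → (∀ x ∈ ball (0 : E n) 1, |Lop b (hq A) w x| ≤ S) → 
    ∀ x ∈ ball (0 : E n) (1/4), w x ≤ C * √(8 * (1 + V)) * √((∫ x in ball (0 : E n) (1/2), w x ^ 2) + S ^ 2) by
    intro w S hw hS hL x hx
    have h1 := H w S hw hS hL x hx
    have h2 := H (fun x => (-1) * w x) S (contDiff_const.mul hw) hS (fun x hx => by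
      rw [Lop_smul _ hw, abs_mul]; simpa using hL x hx) x hx
    have h3 : ∀ x, ((-1) * w x) ^ 2 = w x ^ 2 := fun x => by ring
    simp only [h3] at h2
    exact abs_le.2 ⟨by linarith, h1⟩
  intro w S hw hS hL x hx
  set I : Fin n → Fin n → ℝ := fun i j => if i = j then 1 else 0 with hI
  have hIs : ∀ i j, I i j = I j i := by intro i j; simp [hI, eq_comm]
  have hqI : ∀ x : E n, hq I x = (1/2) * ‖x‖ ^ 2 := by
    intro x; unfold hq; rw [← sum_sq_norm]; simp [hI, sq]
  set W : E n → ℝ := fun x => w x + S * hq I x with hW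
  have hWs : Sm W := hw.add (contDiff_const.mul (hq_sm I))
  have hLI : ∀ x, 1 ≤ Lop b (hq A) (hq I) x := by
    intro x
    have h1 : Lop b (hq A) (hq I) x = ∑ i, am b (hq A) x i i := by
      rw [Lop_eq]
      refine Finset.sum_congr rfl fun i _ => ?_
      have : ∀ j, pd i (pd j (hq I)) x = I i j := fun j => by
        have := congrFun (congrFun (Hf_hq hIs x) i) j
        exact this
      simp only [this]; simp [hI]
    have h2 : ∀ i, 1 ≤ am b (hq A) x i i := by
      intro i
      have := am_quad (b := b) hb (h := hq A) (x := x) (by rw [Hf_hq hsym]; exact hA) (Pi.single i 1)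
      simpa [Pi.single_apply] using this
    rw [h1]
    have i0 : Fin n := ⟨0, by omega⟩
    refine (h2 i0).trans ?_
    exact Finset.single_le_sum (f := fun i => am b (hq A) x i i) (fun i _ => by linarith [h2 i]) (Finset.mem_univ i0)
  have hWsub : WSub (am b (hq A)) W := by
    refine WSub_of_Lop (hq_sm A) hWs fun x hx => ?_
    have h1 := (abs_le.1 (hL x hx)).1
    have h2 := hLI x
    rw [hW, Lop_add hw (contDiff_const.mul (hq_sm I)), Lop_smul _ (hq_sm I)]
    nlinarith
  have hm := hmos _ hE _ (kappa_contDiff hWs.c1 hS) (fun x => kappa_pos hS _) (WSub.kappa hE hWs.c1 hWsub hS) x hx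
  have hle : w x ≤ W x + √(S ^ 2 + W x ^ 2) := by
    have h1 : 0 ≤ hq I x := by rw [hqI]; positivity
    have h2 := Real.sqrt_nonneg (S ^ 2 + W x ^ 2)
    have h3 : w x ≤ W x := by simp only [hW]; nlinarith
    linarith
  refine hle.trans (hm.trans ?_)
  rw [mul_assoc]
  refine mul_le_mul_of_nonneg_left ?_ hC.le
  rw [← Real.sqrt_eq_rpow, ← Real.sqrt_mul (by positivity)]
  refine Real.sqrt_le_sqrt ?_
  have i1 : IntegrableOn (fun _ : E n => 8 * S ^ 2) (ball (0 : E n) (1/2)) := integrableOn_const measure_ball_lt_top.ne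
  have i2 : IntegrableOn (fun x : E n => 8 * w x ^ 2) (ball (0 : E n) (1/2)) := intOn (continuous_const.mul (hw.continuous.pow 2)) _
  have h4 : ∫ x in ball (0 : E n) (1/2), (W x + √(S ^ 2 + W x ^ 2)) ^ 2 ≤ ∫ x in ball (0 : E n) (1/2), (8 * w x ^ 2 + 8 * S ^ 2) := by
    refine setIntegral_mono_on (intOn ((kappa_contDiff hWs.c1 hS).continuous.pow 2) _) (i2.add i1) measurableSet_ball fun x hx => ?_
    have h1 := kappa_pos hS (W x)
    have h2 := kappa_le hS (W x)
    have h3 : hq I x ≤ 1/2 := by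
      rw [hqI]
      rw [mem_ball_zero_iff] at hx
      nlinarith [norm_nonneg x]
    have h5 : max (W x) 0 ≤ |w x| + S / 2 := by
      refine max_le ?_ (by positivity)
      simp only [hW]
      nlinarith [le_abs_self (w x)]
    have h6 : W x + √(S ^ 2 + W x ^ 2) ≤ 2 * (|w x| + S) := by linarith
    calc (W x + √(S ^ 2 + W x ^ 2)) ^ 2 ≤ (2 * (|w x| + S)) ^ 2 := by gcongr
      _ ≤ 8 * |w x| ^ 2 + 8 * S ^ 2 := by nlinarith [sq_nonneg (|w x| - S)]
      _ = _ := by rw [sq_abs]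
  refine h4.trans ?_
  rw [integral_add i2 i1, integral_const_mul, setIntegral_const, smul_eq_mul, ← hV]
  have h7 : 0 ≤ ∫ x in ball (0 : E n) (1/2), w x ^ 2 := integral_nonneg fun x => sq_nonneg _
  have h8 : 0 ≤ V * ∫ x in ball (0 : E n) (1/2), w x ^ 2 := by positivity
  nlinarith [sq_nonneg S]

lemma pd_le_fderiv {n : ℕ} (f : E n → ℝ) (x : E n) (i : Fin n) : pd i f x ^ 2 ≤ ‖fderiv ℝ f x‖ ^ 2 := by
  rw [norm_fderiv_sq]
  exact Finset.single_le_sum (f := fun i => pd i f x ^ 2) (fun _ _ => by positivity) (Finset.mem_univ i)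

lemma fderiv_int_le {n : ℕ} {h : E n → ℝ} (hh : Sm h) (A : Fin n → Fin n → ℝ) (k : Fin n) : 
    ∫ x in ball (0 : E n) 2, ‖fderiv ℝ (gk h A k) x‖ ^ 2 ≤ En h A := 
  setIntegral_mono_on (intOn (((gk_sm hh A k).c1.continuous_fderiv one_ne_zero).norm.pow 2) 2) (intOn (dv_cont hh A) 2) measurableSet_ball 
    fun x _ => gk_le hh A k x

lemma D2q (n : ℕ) (hn : 2 ≤ n) {b : ℝ} (hb : 0 ≤ b) : ∃ C > 0, ∀ (δ : ℝ) (φ : E n → ℝ), δ < 1 → Moll δ φ → ∃ ε > 0, 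
    ∀ (h : E n → ℝ) (A : Fin n → Fin n → ℝ), Sol 2 b h → (Matrix.of A).PosSemidef → trF A ≤ 1 → 0 < En h A → En h A ≤ ε →
    ∀ k s t : Fin n, ∀ x ∈ ball (0 : E n) (1/4), |pd s (pd t (T φ (gk h A k))) x| ≤ C * √(En h A) := by
  obtain ⟨C0, hC0, hL0⟩ := L0T n hb
  obtain ⟨C1, hC1, hcacc⟩ := cacc_L2 n hb
  obtain ⟨C2, hC2, hsup⟩ := sup_L2 n hn hb
  refine ⟨C2 * √(C1 * 2 + 1), by positivity, fun δ φ hδ hφ => ?_⟩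
  have hP1 : ∀ t : Fin n, ∃ K ≥ 0, ∀ x, ‖fderiv ℝ (pd t φ) x‖ ≤ K := fun t => 
    bdd_of_cs ((hφ.sm.pd t).c1.continuous_fderiv one_ne_zero) ((cs_pd hφ.cs t).fderiv (𝕜 := ℝ))
  have hP2 : ∀ s t : Fin n, ∃ K ≥ 0, ∀ x, ‖fderiv ℝ (pd s (pd t φ)) x‖ ≤ K := fun s t => 
    bdd_of_cs (((hφ.sm.pd t).pd s).c1.continuous_fderiv one_ne_zero) ((cs_pd (cs_pd hφ.cs t) s).fderiv (𝕜 := ℝ))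
  choose P1 hP10 hP1 using hP1
  choose P2 hP20 hP2 using hP2
  set P := (∑ t, P1 t) + ∑ s, ∑ t, P2 s t with hP
  have hs1 : ∀ t, P1 t ≤ ∑ t, P1 t := fun t => Finset.single_le_sum (fun i _ => hP10 i) (Finset.mem_univ t)
  have hs2 : ∀ s t, P2 s t ≤ ∑ s, ∑ t, P2 s t := fun s t => 
    (Finset.single_le_sum (fun i _ => hP20 s i) (Finset.mem_univ t)).trans 
      (Finset.single_le_sum (f := fun s => ∑ t, P2 s t) (fun i _ => Finset.sum_nonneg fun j _ => hP20 i j) (Finset.mem_univ s))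
  have hs10 : 0 ≤ ∑ t, P1 t := Finset.sum_nonneg fun t _ => hP10 t
  have hs20 : 0 ≤ ∑ s, ∑ t, P2 s t := Finset.sum_nonneg fun s _ => Finset.sum_nonneg fun t _ => hP20 s t
  have hP0 : 0 ≤ P := add_nonneg hs10 hs20
  refine ⟨(1 / (C0 * P + 1)) ^ 2, by positivity, fun h A hs hA htr hE0 hE k s t => ?_⟩
  have hSp : 0 < √(En h A) := Real.sqrt_pos.2 hE0
  have hSS : √(En h A) ^ 2 = En h A := Real.sq_sqrt hE0.le
  have hsm : C0 * P * En h A ≤ √(En h A) := by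
    have h1 : √(En h A) ≤ 1 / (C0 * P + 1) := Real.sqrt_le_iff.2 ⟨by positivity, hE⟩
    rw [le_div_iff₀ (by positivity)] at h1
    have h2 : C0 * P * √(En h A) ≤ 1 := by nlinarith
    calc C0 * P * En h A = (C0 * P * √(En h A)) * √(En h A) := by rw [mul_assoc _ (√_), ← sq, hSS]
      _ ≤ 1 * √(En h A) := by gcongr
      _ = _ := one_mul _
  have hgs := gk_sm hs.sm A k
  have hqs : Sm (T φ (gk h A k)) := T_sm hφ.sm hφ.cs hgs.continuous
  have ey : pd t (T φ (gk h A k)) = T (pd t φ) (gk h A k) := pd_T hφ.sm hφ.cs hgs.continuous t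
  have ey' : pd t (T φ (gk h A k)) = T φ (pd t (gk h A k)) := by rw [ey, T_pd hφ.sm hφ.cs hgs]
  have ew : pd s (pd t (T φ (gk h A k))) = T (pd s (pd t φ)) (gk h A k) := by 
    rw [ey, pd_T (hφ.sm.pd t) (cs_pd hφ.cs t) hgs.continuous]
  have hy : ∀ x ∈ ball (0 : E n) 1, |Lop b (hq A) (pd t (T φ (gk h A k))) x| ≤ √(En h A) := by
    intro x hx
    rw [ey]
    refine (hL0 h A hs hA htr k δ P _ hδ (hφ.sm.pd t) (cs_pd hφ.cs t) ((tsupport_pd t).trans hφ.supp) (fun x => (hP1 t x).trans ?_) x hx).trans hsm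
    linarith [hs1 t]
  have hw : ∀ x ∈ ball (0 : E n) 1, |Lop b (hq A) (pd s (pd t (T φ (gk h A k)))) x| ≤ √(En h A) := by
    intro x hx
    rw [ew]
    refine (hL0 h A hs hA htr k δ P _ hδ ((hφ.sm.pd t).pd s) (cs_pd (cs_pd hφ.cs t) s) ((tsupport_pd s).trans ((tsupport_pd t).trans hφ.supp)) 
      (fun x => (hP2 s t x).trans ?_) x hx).trans hsm
    linarith [hs2 s t]
  have hys : Sm (pd t (T φ (gk h A k))) := hqs.pd t
  have b1 : ∫ x in ball (0 : E n) 1, pd t (T φ (gk h A k)) x ^ 2 ≤ En h A := by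
    rw [ey']
    refine (T_L2 hφ hδ.le (hgs.pd t).continuous).trans (le_trans ?_ (fderiv_int_le hs.sm A k))
    exact setIntegral_mono_on (intOn ((hgs.pd t).continuous.pow 2) 2) (intOn ((hgs.c1.continuous_fderiv one_ne_zero).norm.pow 2) 2) measurableSet_ball
      fun x _ => pd_le_fderiv _ x t
  have b2 := hcacc A hA htr _ _ hys hy
  have b3 : ∫ x in ball (0 : E n) (1/2), pd s (pd t (T φ (gk h A k))) x ^ 2 ≤ C1 * 2 * En h A := by
    refine le_trans ?_ (b2.trans ?_)
    · exact setIntegral_mono_on (intOn ((hys.pd s).continuous.pow 2) _) (intOn ((hys.c1.continuous_fderiv one_ne_zero).norm.pow 2) _) measurableSet_ball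
        fun x _ => pd_le_fderiv _ x s
    · rw [hSS, mul_assoc]; gcongr; linarith
  intro x hx
  refine (hsup A hA htr _ _ (hys.pd s) hSp hw x hx).trans ?_
  rw [mul_assoc, ← Real.sqrt_mul (by positivity)]
  gcongr
  rw [hSS]; linarith

end EK


namespace EK

lemma caccS (n : ℕ) {b : ℝ} (hb : 0 ≤ b) : ∃ C > 0, ∀ (h : E n → ℝ), Sol 4 b h → ∀ (A : Fin n → Fin n → ℝ) (k : Fin n) (c : ℝ),
    ∫ x in ball (0 : E n) 2, ‖fderiv ℝ (gk h A k) x‖ ^ 2 ≤ C * ∫ x in ball (0 : E n) 4, (gk h A k x - c) ^ 2 := by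
  obtain ⟨C₀, _, hcut⟩ := exists_cutoff n
  obtain ⟨η, hη, hηc, hηs, hη0, hη1, hηe, -⟩ := hcut 2 4 (by norm_num) (by norm_num)
  obtain ⟨K, hK, hLη⟩ := Lop_bdd hb hη hηc
  refine ⟨K, hK, fun h hs A k c => ?_⟩
  have hg := gk_sm hs.sm A k
  set y : E n → ℝ := fun x => gk h A k x + (-c + ∑ i : Fin n, (0:ℝ) * x i) with hy
  have ysm : Sm y := hg.add (contDiff_const.add (lin_sm _))
  have hy1 : ∀ x, y x = gk h A k x - c := fun x => by simp [hy]; ring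
  have hy2 : y = fun x => gk h A k x - c := funext hy1
  have hyd : ∀ x, fderiv ℝ y x = fderiv ℝ (gk h A k) x := fun x => by rw [hy2, fderiv_sub_const]
  have cy' : Continuous (fderiv ℝ y) := ysm.c1.continuous_fderiv one_ne_zero
  have hout : ∀ x, x ∉ ball (0 : E n) 4 → x ∉ tsupport η := fun x hx h => hx (hηs h)
  have hL : ∀ x ∈ ball (0 : E n) 4, Lop b h y x = 0 := fun x hx => by
    rw [hy, Lop_add hg (contDiff_const.add (lin_sm _)), Lop_gk hs A k x hx, Lop_affine (fun _ => 0) (-c) x, add_zero]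
  have e1 := cacc2 (b := b) hb hs.sm ysm hη hηc hη0 (fun x hx => hs.psd x (hηs hx))
  have e0 : ∫ x, η x * (y x * Lop b h y x) = 0 := by
    refine integral_eq_zero_of_ae (ae_of_all _ fun x => ?_)
    by_cases hx : x ∈ ball (0 : E n) 4
    · simp [hL x hx]
    · simp [zero_of_nmem_tsupport (hout x hx)]
  have e2 : ∫ x in ball (0 : E n) 2, ‖fderiv ℝ y x‖ ^ 2 ≤ ∫ x, η x * ‖fderiv ℝ y x‖ ^ 2 := by
    have : ∫ x in ball (0 : E n) 2, ‖fderiv ℝ y x‖ ^ 2 = ∫ x in ball (0 : E n) 2, η x * ‖fderiv ℝ y x‖ ^ 2 := by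
      refine setIntegral_congr_fun measurableSet_ball fun x hx => ?_
      rw [hηe x (ball_subset_closedBall hx), one_mul]
    rw [this]
    exact setIntegral_le_integral ((hη.continuous.mul (cy'.norm.pow 2)).integrable_of_hasCompactSupport hηc.mul_right) 
      (ae_of_all _ fun x => mul_nonneg (hη0 x) (by positivity))
  have e3 : ∫ x, y x ^ 2 * Lop b h η x ≤ K * ∫ x in ball (0 : E n) 4, y x ^ 2 := by
    rw [← setIntegral_eq_integral_of_forall_compl_eq_zero (s := ball (0 : E n) 4) 
      (fun x hx => by rw [Lop_zero_of_nmem (hout x hx), mul_zero]), ← integral_const_mul]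
    refine setIntegral_mono_on (intOn ((ysm.continuous.pow 2).mul (Lop_cont hs.sm hη)) 4) 
      (intOn (continuous_const.mul (ysm.continuous.pow 2)) 4) measurableSet_ball fun x hx => ?_
    have h2 := (le_abs_self _).trans (hLη h x (hs.psd x hx) (hs.tr_le hb x hx))
    rw [mul_comm]
    exact mul_le_mul_of_nonneg_right h2 (sq_nonneg _)
  have hI : 0 ≤ K * ∫ x in ball (0 : E n) 4, y x ^ 2 := mul_nonneg hK.le (integral_nonneg fun x => sq_nonneg _)
  simp only [hyd, hy1] at e0 e1 e2 e3 hI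
  linarith

lemma fderiv_le_of_pd {n : ℕ} {f : E n → ℝ} {x : E n} {S : ℝ} (hS : 0 ≤ S) (h : ∀ i, |pd i f x| ≤ S) : ‖fderiv ℝ f x‖ ≤ n * S := by
  have h1 : ‖fderiv ℝ f x‖ ^ 2 ≤ (n * S) ^ 2 := by
    rw [norm_fderiv_sq]
    have : ∑ i, pd i f x ^ 2 ≤ ∑ i : Fin n, S ^ 2 := Finset.sum_le_sum fun i _ => sq_le_sq' (abs_le.1 (h i)).1 (abs_le.1 (h i)).2
    refine this.trans ?_
    simp only [Finset.sum_const, Finset.card_univ, Fintype.card_fin, nsmul_eq_mul, mul_pow]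
    refine mul_le_mul_of_nonneg_right ?_ (sq_nonneg S)
    exact_mod_cast Nat.le_self_pow (by norm_num) n
  exact (sq_le_sq₀ (norm_nonneg _) (by positivity)).1 h1

lemma taylor {n : ℕ} {q : E n → ℝ} (hq : Sm q) {S r : ℝ} (hS : 0 ≤ S) (h : ∀ s t : Fin n, ∀ x ∈ ball (0 : E n) r, |pd s (pd t q) x| ≤ S) : 
    ∀ x ∈ ball (0 : E n) r, |q x - (q 0 + ∑ i, pd i q 0 * x i)| ≤ n ^ 2 * S * ‖x‖ ^ 2 := by
  intro x hx
  have hxr : ‖x‖ < r := mem_ball_zero_iff.1 hx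
  have hr : 0 < r := (norm_nonneg x).trans_lt hxr
  have h1 : ∀ t : Fin n, ∀ y ∈ ball (0 : E n) r, |pd t q y - pd t q 0| ≤ n * S * ‖y‖ := by
    intro t y hy
    have := (convex_ball (0 : E n) r).norm_image_sub_le_of_norm_fderiv_le (f := pd t q) (C := n * S) (𝕜 := ℝ)
      (fun z _ => (hq.pd t).diff z) (fun z hz => fderiv_le_of_pd hS fun i => h i t z hz) (mem_ball_self hr) hy
    simpa using this
  set f : E n → ℝ := fun x => q x - ∑ i, pd i q 0 * x i with hf
  have fsm : Sm f := hq.sub (lin_sm _)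
  have hpf : ∀ i y, pd i f y = pd i q y - pd i q 0 := by
    intro i y
    have h1 : fderiv ℝ f y = _ := ((hq.diff y).hasFDerivAt.fun_sub ((lin_sm (fun i => pd i q 0)).diff y).hasFDerivAt).fderiv
    have h2 := pd_lin (fun i => pd i q 0) i y
    unfold pd at h1 h2 ⊢
    rw [h1, ← h2]; rfl
  have h2 := (convex_closedBall (0 : E n) ‖x‖).norm_image_sub_le_of_norm_fderiv_le (f := f) (C := n * (n * S * ‖x‖)) (𝕜 := ℝ)
      (fun z _ => fsm.diff z) (fun z hz => fderiv_le_of_pd (by positivity) fun i => by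
        rw [hpf]
        have hz' := mem_closedBall_zero_iff.1 hz
        refine (h1 i z (mem_ball_zero_iff.2 (hz'.trans_lt hxr))).trans ?_
        gcongr) (mem_closedBall_self (norm_nonneg x)) (y := x) (by simp)
  have h3 : f x - f 0 = q x - (q 0 + ∑ i, pd i q 0 * x i) := by simp [hf]; ring
  rw [h3, Real.norm_eq_abs, sub_zero] at h2
  refine h2.trans (le_of_eq ?_)
  ring

lemma avg_int {n : ℕ} {δ : ℝ} {φ G : E n → ℝ} (hφ : Moll δ φ) (hG : Continuous G) : Integrable (fun z => φ z * G z) volume := 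
  (hφ.sm.continuous.mul hG).integrable_of_hasCompactSupport hφ.cs.mul_right

lemma avg_psd {n : ℕ} {b δ : ℝ} (hb : 0 ≤ b) {φ h : E n → ℝ} (hφ : Moll δ φ) (hδ : δ < 1) (hs : Sol 2 b h) :
    (Matrix.of (fun k i => ∫ z, φ z * Hf h (0 - z) k i)).PosSemidef ∧ trF (fun k i => ∫ z, φ z * Hf h (0 - z) k i) ≤ 1 := by
  have hzero : ∀ z, z ∉ closedBall (0 : E n) δ → φ z = 0 := fun z hz => zero_of_nmem_tsupport fun h => hz (hφ.supp h)
  have hin : ∀ z ∈ closedBall (0 : E n) δ, 0 - z ∈ ball (0 : E n) 2 := fun z hz => by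
    have := mem_closedBall_zero_iff.1 hz
    rw [mem_ball_zero_iff, zero_sub, norm_neg]; linarith
  have hc : ∀ k i, Continuous (fun z => Hf h (0 - z) k i) := fun k i =>
    (((hs.sm.pd i).pd k).continuous).comp (by fun_prop)
  constructor
  · refine psd_of (fun i j => ?_) (fun v => ?_)
    · simp only [Hf_symm hs.sm _ i j]
    · have : ∑ i, ∑ j, (∫ z, φ z * Hf h (0 - z) i j) * v i * v j = ∫ z, φ z * ∑ i, ∑ j, Hf h (0 - z) i j * v i * v j := by
        simp only [Finset.mul_sum]
        rw [integral_finsetSum _ fun i _ => integrable_finsetSum _ fun j _ => avg_int hφ (((hc i j).mul_const _).mul_const _)]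
        refine Finset.sum_congr rfl fun i _ => ?_
        rw [integral_finsetSum _ fun j _ => avg_int hφ (((hc i j).mul_const _).mul_const _)]
        refine Finset.sum_congr rfl fun j _ => ?_
        rw [← integral_mul_const, ← integral_mul_const]
        refine integral_congr_ae (ae_of_all _ fun z => ?_)
        simp only; ring
      rw [this]
      refine integral_nonneg fun z => ?_
      by_cases hz : z ∈ closedBall (0 : E n) δ
      · exact mul_nonneg (hφ.nonneg z) (psd_nonneg (hs.psd _ (hin z hz)) v)
      · simp [hzero z hz]
  · have : trF (fun k i => ∫ z, φ z * Hf h (0 - z) k i) = ∫ z, φ z * trF (Hf h (0 - z)) := by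
      simp only [trF, Finset.mul_sum]
      rw [integral_finsetSum _ fun i _ => avg_int hφ (hc i i)]
    rw [this, ← hφ.int]
    have i1 : Continuous (fun z => trF (Hf h (0 - z))) := by
      unfold trF; exact continuous_finsetSum _ fun i _ => hc i i
    refine integral_mono (avg_int hφ i1) (hφ.sm.continuous.integrable_of_hasCompactSupport hφ.cs) fun z => ?_
    by_cases hz : z ∈ closedBall (0 : E n) δ
    · have := hs.tr_le hb _ (hin z hz)
      have := mul_le_mul_of_nonneg_left this (hφ.nonneg z)
      simpa using this
    · simp [hzero z hz]

lemma avg_eq {n : ℕ} {δ : ℝ} {φ h : E n → ℝ} (hφ : Moll δ φ) (hh : Sm h) (A : Fin n → Fin n → ℝ) (k i : Fin n) :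
    A k i + pd i (T φ (gk h A k)) 0 = ∫ z, φ z * Hf h (0 - z) k i := by
  have hc : Continuous (fun z => Hf h (0 - z) k i) := (((hh.pd i).pd k).continuous).comp (by fun_prop)
  rw [pd_T hφ.sm hφ.cs (gk_sm hh A k).continuous, T_pd hφ.sm hφ.cs (gk_sm hh A k), T_eq]
  have : ∀ z, φ z * pd i (gk h A k) (0 - z) = φ z * Hf h (0 - z) k i - A k i * φ z := by
    intro z; rw [pd_gk hh]; ring
  simp only [this]
  rw [integral_sub (avg_int hφ hc) ((hφ.sm.continuous.integrable_of_hasCompactSupport hφ.cs).const_mul _), integral_const_mul, hφ.int]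
  ring

lemma gk_tr {n : ℕ} {h : E n → ℝ} (hh : Sm h) (A : Fin n → Fin n → ℝ) (k : Fin n) {r : ℝ} (hr : 0 < r) (x : E n) : 
    gk (tr 0 r h) A k x = r⁻¹ * gk h A k (r • x) := by
  have h1 : pd k (tr 0 r h) x = r⁻¹ * pd k h (r • x) := by
    have := congrFun (dd_resc hh (r^2)⁻¹ r 0 (e k)) x
    rw [zero_add] at this
    rw [pd_eq_dd, pd_eq_dd]
    refine (Eq.trans ?_ this).trans ?_
    · rfl
    · congr 1; field_simp
  unfold gk
  rw [h1, mul_sub, Finset.mul_sum]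
  congr 1
  refine Finset.sum_congr rfl fun i _ => ?_
  simp; field_simp

end EK


namespace EK

lemma int_scale {n : ℕ} (f : E n → ℝ) {r : ℝ} (hr : 0 < r) (R : ℝ) : 
    ∫ x in ball (0 : E n) R, f (r • x) = (r ^ n)⁻¹ * ∫ x in ball (0 : E n) (r * R), f x := by
  rw [Measure.setIntegral_comp_smul_of_pos volume f _ hr, _root_.smul_ball hr.ne']
  simp [abs_of_pos hr]

lemma En_tr_le {n : ℕ} {h : E n → ℝ} (hh : Sm h) (A : Fin n → Fin n → ℝ) {r : ℝ} (hr : 0 < r) (hr1 : r ≤ 1) : 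
    En (tr 0 r h) A ≤ (r ^ n)⁻¹ * En h A := by
  have h1 : ∀ x, dv (tr 0 r h) A x = dv h A (r • x) := fun x => by
    unfold dv; rw [Hf_tr hh 0 hr.ne' x, zero_add]
  unfold En
  simp only [h1]
  rw [int_scale (dv h A) hr]
  refine mul_le_mul_of_nonneg_left ?_ (by positivity)
  exact setInt_mono (dv_cont hh A) (dv_nonneg h A) (by linarith)

lemma En_nonneg {n : ℕ} (h : E n → ℝ) (A : Fin n → Fin n → ℝ) : 0 ≤ En h A := integral_nonneg fun x => dv_nonneg h A x

lemma exists_rho {Q α : ℝ} (hQ : 0 ≤ Q) (h1 : α < 1) : ∃ ρ : ℝ, 0 < ρ ∧ ρ ≤ 1/32 ∧ Q * ρ ^ 2 ≤ (1/2) * ρ ^ (2 * α) := by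
  have ht : Tendsto (fun ρ : ℝ => Q * ρ ^ (2 - 2 * α)) (𝓝[>] 0) (𝓝 (Q * 0)) := by
    refine (Tendsto.mono_left ?_ nhdsWithin_le_nhds).const_mul Q
    have := (Real.continuousAt_rpow_const (0:ℝ) (2 - 2 * α) (Or.inr (by linarith))).tendsto
    rwa [Real.zero_rpow (by linarith)] at this
  rw [mul_zero] at ht
  have e1 := ht.eventually (eventually_le_nhds (show (0:ℝ) < 1/2 by norm_num))
  have e2 : ∀ᶠ ρ : ℝ in 𝓝[>] 0, ρ ≤ 1/32 := nhdsWithin_le_nhds (eventually_le_nhds (by norm_num))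
  obtain ⟨ρ, ⟨h1, h2⟩, h3⟩ := ((e1.and e2).and self_mem_nhdsWithin).exists
  have h3 : 0 < ρ := h3
  refine ⟨ρ, h3, h2, ?_⟩
  have h4 : ρ ^ 2 = ρ ^ (2 - 2 * α) * ρ ^ (2 * α) := by
    rw [← Real.rpow_add h3]; norm_num
  rw [h4, ← mul_assoc]
  exact mul_le_mul_of_nonneg_right h1 (by positivity)

lemma decay (n : ℕ) (hn : 2 ≤ n) {b α : ℝ} (hb : 0 ≤ b) (hα : α < 1) : ∃ ρ : ℝ, 0 < ρ ∧ ρ ≤ 1/32 ∧ ∃ ε > 0, 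
    ∀ (h : E n → ℝ) (A : Fin n → Fin n → ℝ), Sol 2 b h → (Matrix.of A).PosSemidef → trF A ≤ 1 → En h A ≤ ε → 
    ∃ A' : Fin n → Fin n → ℝ, (Matrix.of A').PosSemidef ∧ trF A' ≤ 1 ∧ En (tr 0 ρ h) A' ≤ ρ ^ (2 * α) * En h A := by
  obtain ⟨C1, hC1, hcacc⟩ := caccS n hb
  obtain ⟨C2, hC2, hD2⟩ := D2q n hn hb
  set V := volume.real (ball (0 : E n) 4) with hV
  have hV0 : 0 ≤ V := measureReal_nonneg
  obtain ⟨ρ, hρ, hρ32, hρQ⟩ := exists_rho (Q := n * C1 * (512 * (n ^ 2 * C2) ^ 2 * V)) (by positivity) hα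
  set P : ℝ := n * C1 * (2 * (ρ ^ 2 * ρ ^ n)⁻¹) with hP
  have hP0 : 0 ≤ P := by positivity
  have hc0 : 0 < (1/2) * ρ ^ (2 * α) := by positivity
  set δ : ℝ := min (1/2) ((1/2) * ρ ^ (2 * α) / (P + 1)) with hδ
  have hδ0 : 0 < δ := by rw [hδ]; positivity
  have hδ1 : δ ≤ 1/2 := min_le_left _ _
  have hδ2 : δ ≤ (1/2) * ρ ^ (2 * α) / (P + 1) := min_le_right _ _
  have hδP : P * δ ^ 2 ≤ (1/2) * ρ ^ (2 * α) := by
    rw [le_div_iff₀ (by positivity)] at hδ2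
    nlinarith [mul_nonneg hP0 hδ0.le]
  obtain ⟨φ, hφ⟩ := exists_moll n hδ0
  obtain ⟨ε, hε, hD⟩ := hD2 δ φ (by linarith) hφ
  refine ⟨ρ, hρ, hρ32, ε, hε, fun h A hs hA htr hE => ?_⟩
  have hh := hs.sm
  rcases (En_nonneg h A).eq_or_lt with h0 | hpos
  · refine ⟨A, hA, htr, ?_⟩
    have := En_tr_le hh A hρ (by linarith)
    rw [← h0] at this ⊢
    simpa using this
  have hD := hD h A hs hA htr hpos hE
  set En0 := En h A with hEn0
  set q : Fin n → E n → ℝ := fun k => T φ (gk h A k) with hqd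
  set A' : Fin n → Fin n → ℝ := fun k i => A k i + pd i (q k) 0 with hA'
  have hA'2 : A' = fun k i => ∫ z, φ z * Hf h (0 - z) k i := by
    ext k i; exact avg_eq hφ hh A k i
  have hps := avg_psd hb hφ (by linarith) hs
  rw [← hA'2] at hps
  refine ⟨A', hps.1, hps.2, ?_⟩
  have hs' : Sol 4 b (tr 0 ρ h) := hs.tr 0 hρ (by rw [norm_zero]; linarith)
  have qsm : ∀ k, Sm (q k) := fun k => T_sm hφ.sm hφ.cs (gk_sm hh A k).continuous
  have gc : ∀ k, Continuous (gk h A k) := fun k => (gk_sm hh A k).continuous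
  -- the main estimate
  have main : ∀ k, ∫ x in ball (0 : E n) 4, (gk (tr 0 ρ h) A' k x - ρ⁻¹ * q k 0) ^ 2 ≤ 
      En0 * (2 * (ρ ^ 2 * ρ ^ n)⁻¹ * δ ^ 2 + 512 * (n ^ 2 * C2) ^ 2 * V * ρ ^ 2) := by
    intro k
    have t1 : ∀ x ∈ ball (0 : E n) 4, (gk (tr 0 ρ h) A' k x - ρ⁻¹ * q k 0) ^ 2 ≤ 
        2 * (ρ ^ 2)⁻¹ * (gk h A k (ρ • x) - q k (ρ • x)) ^ 2 + 512 * (n ^ 2 * C2) ^ 2 * En0 * ρ ^ 2 := by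
      intro x hx
      have hx4 : ‖x‖ < 4 := mem_ball_zero_iff.1 hx
      have hnx : ‖ρ • x‖ ≤ 4 * ρ := by
        rw [norm_smul, Real.norm_eq_abs, abs_of_pos hρ]; nlinarith
      have hmem : ρ • x ∈ ball (0 : E n) (1/4) := by
        rw [mem_ball_zero_iff, norm_smul, Real.norm_eq_abs, abs_of_pos hρ]; nlinarith
      have ty := taylor (qsm k) (by positivity) (fun s t y hy => hD k s t y hy) (ρ • x) hmem
      set y := ρ • x with hy
      have e1 : gk h A' k y = gk h A k y - ∑ i, pd i (q k) 0 * y i := by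
        simp only [gk, hA', add_mul, Finset.sum_add_distrib]; ring
      have e2 : gk (tr 0 ρ h) A' k x - ρ⁻¹ * q k 0 = ρ⁻¹ * ((gk h A k y - q k y) + (q k y - (q k 0 + ∑ i, pd i (q k) 0 * y i))) := by
        rw [gk_tr hh A' k hρ, ← hy, e1]; ring
      have e3 : (q k y - (q k 0 + ∑ i, pd i (q k) 0 * y i)) ^ 2 ≤ 256 * (n ^ 2 * C2) ^ 2 * En0 * ρ ^ 4 := by
        have h5 : |q k y - (q k 0 + ∑ i, pd i (q k) 0 * y i)| ≤ n ^ 2 * (C2 * √En0) * (4 * ρ) ^ 2 := by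
          refine ty.trans ?_
          gcongr
        have h6 := sq_le_sq' (abs_le.1 h5).1 (abs_le.1 h5).2
        refine h6.trans (le_of_eq ?_)
        have h7 : √En0 ^ 2 = En0 := Real.sq_sqrt hpos.le
        rw [show (n ^ 2 * (C2 * √En0) * (4 * ρ) ^ 2) ^ 2 = 256 * (n ^ 2 * C2) ^ 2 * √En0 ^ 2 * ρ ^ 4 by ring, h7]
      rw [e2, mul_pow, inv_pow]
      generalize q k y - (q k 0 + ∑ i, pd i (q k) 0 * y i) = w at e3 ⊢
      generalize gk h A k y - q k y = u
      have e4 : (u + w) ^ 2 ≤ 2 * u ^ 2 + 2 * (256 * (n ^ 2 * C2) ^ 2 * En0 * ρ ^ 4) := by nlinarith [sq_nonneg (u - w)]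
      have e5 := mul_le_mul_of_nonneg_left e4 (show 0 ≤ (ρ ^ 2)⁻¹ by positivity)
      refine e5.trans (le_of_eq ?_)
      field_simp
      ring
    have cq : Continuous (fun x : E n => (gk h A k (ρ • x) - q k (ρ • x)) ^ 2) := by
      have := (gc k); have := (qsm k).continuous
      fun_prop
    have i1 : IntegrableOn (fun x : E n => 2 * (ρ ^ 2)⁻¹ * (gk h A k (ρ • x) - q k (ρ • x)) ^ 2) (ball (0 : E n) 4) :=
      intOn (continuous_const.mul cq) 4
    have i2 : IntegrableOn (fun x : E n => 512 * (n ^ 2 * C2) ^ 2 * En0 * ρ ^ 2) (ball (0 : E n) 4) := 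
      integrableOn_const measure_ball_lt_top.ne
    have t2 := setIntegral_mono_on (intOn (((gk_sm hs'.sm A' k).continuous.sub continuous_const).pow 2) 4) (i1.add i2) measurableSet_ball t1
    refine t2.trans ?_
    have t3 : ∫ x in ball (0 : E n) 4, (gk h A k (ρ • x) - q k (ρ • x)) ^ 2 ≤ (ρ ^ n)⁻¹ * (δ ^ 2 * En0) := by
      rw [int_scale (fun y => (gk h A k y - q k y) ^ 2) hρ]
      refine mul_le_mul_of_nonneg_left ?_ (by positivity)
      refine (setInt_mono (((gc k).sub (qsm k).continuous).pow 2) (fun x => sq_nonneg _) (show ρ * 4 ≤ 1 by linarith)).trans ?_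
      refine (T_diff hφ hδ0.le (by linarith) (gk_sm hh A k).c1).trans ?_
      exact mul_le_mul_of_nonneg_left (fderiv_int_le hh A k) (by positivity)
    have t4 : ∫ x in ball (0 : E n) 4, (2 * (ρ ^ 2)⁻¹ * (gk h A k (ρ • x) - q k (ρ • x)) ^ 2 + 512 * (n ^ 2 * C2) ^ 2 * En0 * ρ ^ 2) = 
        2 * (ρ ^ 2)⁻¹ * (∫ x in ball (0 : E n) 4, (gk h A k (ρ • x) - q k (ρ • x)) ^ 2) + V * (512 * (n ^ 2 * C2) ^ 2 * En0 * ρ ^ 2) := by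
      rw [integral_add i1 i2, integral_const_mul, setIntegral_const, smul_eq_mul]
    have t5 := mul_le_mul_of_nonneg_left t3 (show 0 ≤ 2 * (ρ ^ 2)⁻¹ by positivity)
    refine (le_of_eq t4).trans ?_
    refine (add_le_add_left t5 _).trans (le_of_eq ?_)
    rw [mul_inv]; ring
  have s1 : En (tr 0 ρ h) A' = ∑ k, ∫ x in ball (0 : E n) 2, ‖fderiv ℝ (gk (tr 0 ρ h) A' k) x‖ ^ 2 := by
    unfold En
    simp only [← sum_gk hs'.sm A']
    exact integral_finsetSum _ fun k _ => intOn (((gk_sm hs'.sm A' k).c1.continuous_fderiv one_ne_zero).norm.pow 2) 2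
  rw [s1]
  have s2 : ∑ k, ∫ x in ball (0 : E n) 2, ‖fderiv ℝ (gk (tr 0 ρ h) A' k) x‖ ^ 2 ≤ 
      ∑ k : Fin n, C1 * (En0 * (2 * (ρ ^ 2 * ρ ^ n)⁻¹ * δ ^ 2 + 512 * (n ^ 2 * C2) ^ 2 * V * ρ ^ 2)) := 
    Finset.sum_le_sum fun k _ => (hcacc _ hs' A' k (ρ⁻¹ * q k 0)).trans (mul_le_mul_of_nonneg_left (main k) hC1.le)
  refine s2.trans ?_
  simp only [Finset.sum_const, Finset.card_univ, Fintype.card_fin, nsmul_eq_mul]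
  have s3 : n * (C1 * (En0 * (2 * (ρ ^ 2 * ρ ^ n)⁻¹ * δ ^ 2 + 512 * (n ^ 2 * C2) ^ 2 * V * ρ ^ 2))) = 
      (P * δ ^ 2 + n * C1 * (512 * (n ^ 2 * C2) ^ 2 * V) * ρ ^ 2) * En0 := by rw [hP]; ring
  rw [s3]
  refine mul_le_mul_of_nonneg_right ?_ hpos.le
  linarith

end EK


namespace EK

lemma iter (n : ℕ) (hn : 2 ≤ n) {b α : ℝ} (hb : 0 ≤ b) (hα0 : 0 < α) (hα : α < 1) : ∃ ρ : ℝ, 0 < ρ ∧ ρ ≤ 1/32 ∧ ∃ ε > 0, 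
    ∀ (h : E n → ℝ) (A : Fin n → Fin n → ℝ), Sol 2 b h → (Matrix.of A).PosSemidef → trF A ≤ 1 → En h A ≤ ε → 
    ∃ B : ℕ → Fin n → Fin n → ℝ, ∀ k, En (tr 0 (ρ ^ k) h) (B k) ≤ ((ρ ^ α) ^ k) ^ 2 * ε := by
  obtain ⟨ρ, hρ, hρ1, ε, hε, hd⟩ := decay n hn hb hα
  refine ⟨ρ, hρ, hρ1, ε, hε, fun h A hs hA ht hE => ?_⟩
  have hσ0 : 0 < ρ ^ α := by positivity
  have hσ1 : ρ ^ α ≤ 1 := Real.rpow_le_one hρ.le (by linarith) hα0.le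
  have hσ2 : ρ ^ (2 * α) = (ρ ^ α) ^ 2 := by rw [mul_comm, Real.rpow_mul hρ.le]; norm_num
  have key : ∀ k, ∃ B : Fin n → Fin n → ℝ, (Matrix.of B).PosSemidef ∧ trF B ≤ 1 ∧ En (tr 0 (ρ ^ k) h) B ≤ ((ρ ^ α) ^ k) ^ 2 * ε := by
    intro k
    induction k with
    | zero => 
      refine ⟨A, hA, ht, ?_⟩
      have : tr 0 (ρ ^ 0) h = h := by ext x; simp [tr]
      rw [this]; simpa using hE
    | succ k ih =>
      obtain ⟨B, hB, hBt, hBE⟩ := ih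
      have hk1 : ρ ^ k ≤ 1 := pow_le_one₀ hρ.le (by linarith)
      have hle : ((ρ ^ α) ^ k) ^ 2 * ε ≤ ε := by
        have : ((ρ ^ α) ^ k) ^ 2 ≤ 1 := pow_le_one₀ (by positivity) (pow_le_one₀ hσ0.le hσ1)
        nlinarith
      obtain ⟨B', hB', hBt', hBE'⟩ := hd (tr 0 (ρ ^ k) h) B (hs.tr 0 (by positivity) (by rw [norm_zero]; linarith)) hB hBt (hBE.trans hle)
      refine ⟨B', hB', hBt', ?_⟩
      rw [tr_tr, hσ2, ← pow_succ] at hBE'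
      refine hBE'.trans ?_
      refine (mul_le_mul_of_nonneg_left hBE (by positivity)).trans (le_of_eq ?_)
      ring
  choose B hB using key
  exact ⟨B, fun k => (hB k).2.2⟩

/-- comparison of two reference matrices -/
lemma En_comp {n : ℕ} {h : E n → ℝ} (hh : Sm h) (A B : Fin n → Fin n → ℝ) (i j : Fin n) : 
    volume.real (ball (0 : E n) 2) * (A i j - B i j) ^ 2 ≤ 2 * (En h A + En h B) := by
  have h1 : ∫ x in ball (0 : E n) 2, (A i j - B i j) ^ 2 = volume.real (ball (0 : E n) 2) * (A i j - B i j) ^ 2 := by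
    rw [setIntegral_const, smul_eq_mul]
  unfold En
  rw [← h1, ← integral_add (intOn (dv_cont hh A) 2) (intOn (dv_cont hh B) 2), ← integral_const_mul]
  refine setIntegral_mono_on (integrableOn_const measure_ball_lt_top.ne) (intOn (continuous_const.mul ((dv_cont hh A).add (dv_cont hh B))) 2) measurableSet_ball fun x _ => ?_
  have h2 := entry_sq_le h A x i j
  have h3 := entry_sq_le h B x i j
  nlinarith [sq_nonneg ((Hf h x i j - A i j) + (Hf h x i j - B i j))]

lemma En_change {n : ℕ} {h : E n → ℝ} (hh : Sm h) (A B : Fin n → Fin n → ℝ) {t : ℝ} (ht : ∀ i j, |A i j - B i j| ≤ t) : 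
    En h B ≤ 2 * En h A + 2 * (n ^ 2 * t ^ 2) * volume.real (ball (0 : E n) 2) := by
  have i1 : IntegrableOn (fun x => 2 * dv h A x) (ball (0 : E n) 2) := intOn (continuous_const.mul (dv_cont hh A)) 2
  have i2 : IntegrableOn (fun _ : E n => 2 * (n ^ 2 * t ^ 2)) (ball (0 : E n) 2) := integrableOn_const measure_ball_lt_top.ne
  have h1 : 2 * En h A + 2 * (n ^ 2 * t ^ 2) * volume.real (ball (0 : E n) 2) = ∫ x in ball (0 : E n) 2, (2 * dv h A x + 2 * (n ^ 2 * t ^ 2)) := by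
    rw [integral_add i1 i2, integral_const_mul, setIntegral_const, smul_eq_mul]; unfold En; ring
  rw [h1]
  unfold En
  refine setIntegral_mono_on (intOn (dv_cont hh B) 2) (i1.add i2) measurableSet_ball fun x _ => ?_
  have h2 : ∑ i : Fin n, ∑ j : Fin n, (2 * (Hf h x i j - A i j) ^ 2 + 2 * t ^ 2) = 2 * dv h A x + 2 * (n ^ 2 * t ^ 2) := by
    simp only [Finset.sum_add_distrib, ← Finset.mul_sum, dv]
    simp; ring
  refine le_trans ?_ (le_of_eq h2)
  unfold dv
  refine Finset.sum_le_sum fun i _ => Finset.sum_le_sum fun j _ => ?_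
  have h3 := sq_le_sq' (abs_le.1 (ht i j)).1 (abs_le.1 (ht i j)).2
  nlinarith [sq_nonneg ((Hf h x i j - A i j) - (A i j - B i j))]

lemma Hf_cont {n : ℕ} {h : E n → ℝ} (hh : Sm h) (i j : Fin n) : Continuous (fun x => Hf h x i j) := ((hh.pd j).pd i).continuous

lemma dv_tr {n : ℕ} {h : E n → ℝ} (hh : Sm h) (A : Fin n → Fin n → ℝ) {r : ℝ} (hr : 0 < r) (x : E n) : 
    dv (tr 0 r h) A x = dv h A (r • x) := by
  unfold dv; rw [Hf_tr hh 0 hr.ne' x, zero_add]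

/-- the energies with respect to the value at the centre go to zero -/
lemma En_tendsto {n : ℕ} {h : E n → ℝ} (hh : Sm h) {ρ : ℝ} (hρ : 0 < ρ) (hρ1 : ρ < 1) : 
    Tendsto (fun k : ℕ => En (tr 0 (ρ ^ k) h) (Hf h 0)) atTop (𝓝 0) := by
  have hd := dv_cont hh (Hf h 0)
  have h00 : dv h (Hf h 0) 0 = 0 := by simp [dv]
  rw [Metric.tendsto_atTop]
  intro ε hε
  set V := volume.real (ball (0 : E n) 2) with hV
  have hV0 : 0 ≤ V := measureReal_nonneg
  have := hd.tendsto 0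
  rw [h00] at this
  obtain ⟨d, hd0, hdd⟩ := Metric.mem_nhds_iff.1 (this (eventually_lt_nhds (show 0 < ε / (2 * (V + 1)) by positivity)))
  obtain ⟨N, hN⟩ := exists_pow_lt_of_lt_one (show 0 < d / 2 by positivity) hρ1
  refine ⟨N, fun k hk => ?_⟩
  rw [Real.dist_eq, sub_zero, abs_of_nonneg (En_nonneg _ _)]
  have h1 : En (tr 0 (ρ ^ k) h) (Hf h 0) ≤ ∫ x in ball (0 : E n) 2, ε / (2 * (V + 1)) := by
    unfold En
    refine setIntegral_mono_on (intOn (dv_cont (tr_sm hh 0 _) _) 2) (integrableOn_const measure_ball_lt_top.ne) measurableSet_ball fun x hx => ?_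
    rw [dv_tr hh _ (by positivity)]
    have hk' : ρ ^ k ≤ ρ ^ N := pow_le_pow_of_le_one hρ.le hρ1.le hk
    have hp : 0 < ρ ^ k := by positivity
    have hm : ρ ^ k • x ∈ ball (0 : E n) d := by
      rw [mem_ball_zero_iff] at hx ⊢
      rw [norm_smul, Real.norm_eq_abs, abs_of_pos hp]
      nlinarith [norm_nonneg x]
    exact le_of_lt (hdd hm)
  refine h1.trans_lt ?_
  rw [setIntegral_const, smul_eq_mul, ← hV, ← mul_div_assoc, div_lt_iff₀ (by positivity)]
  nlinarith

lemma iter_pt (n : ℕ) (hn : 2 ≤ n) {b α : ℝ} (hb : 0 ≤ b) (hα0 : 0 < α) (hα : α < 1) : ∃ ε > 0, ∃ C > 0,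
    ∀ (h : E n → ℝ) (A : Fin n → Fin n → ℝ), Sol 2 b h → (Matrix.of A).PosSemidef → trF A ≤ 1 → En h A ≤ ε → 
    ∀ s, 0 < s → s ≤ 1 → En (tr 0 s h) (Hf h 0) ≤ C * (s ^ α) ^ 2 := by
  obtain ⟨ρ, hρ, hρ1, ε, hε, hit⟩ := iter n hn hb hα0 hα
  set V := volume.real (ball (0 : E n) 2) with hV
  have hV0 : 0 < V := by
    rw [hV, measureReal_def]; exact ENNReal.toReal_pos (measure_ball_pos _ _ (by norm_num)).ne' measure_ball_lt_top.ne
  set σ := ρ ^ α with hσ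
  have hσ0 : 0 < σ := by positivity
  have hσ1 : σ < 1 := Real.rpow_lt_one hρ.le (by linarith) hα0
  set D := √(2 * ((ρ ^ n)⁻¹ * ε + ε) / V) with hD
  have hD0 : 0 ≤ D := Real.sqrt_nonneg _
  set D' := D / (1 - σ) with hD'
  have hD'0 : 0 ≤ D' := div_nonneg hD0 (by linarith)
  set C3 := 2 * ε + 2 * (n ^ 2 * D' ^ 2) * V with hC3
  have hC30 : 0 < C3 := by positivity
  refine ⟨ε, hε, (ρ ^ n)⁻¹ * C3 * (σ ^ 2)⁻¹, by positivity, fun h A hs hA ht hE s hs0 hs1 => ?_⟩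
  obtain ⟨B, hB⟩ := hit h A hs hA ht hE
  have hh := hs.sm
  have step : ∀ i j k, dist (B k i j) (B (k+1) i j) ≤ D * σ ^ k := by
    intro i j k
    have e1 := En_comp (tr_sm hh 0 (ρ ^ (k+1))) (B k) (B (k+1)) i j
    have e2 := En_tr_le (tr_sm hh 0 (ρ ^ k)) (B k) hρ (by linarith)
    rw [tr_tr, ← pow_succ] at e2
    have e3 := mul_le_mul_of_nonneg_left (hB k) (show 0 ≤ (ρ ^ n)⁻¹ by positivity)
    have e4 := hB (k+1)
    have e5 : (σ ^ (k+1)) ^ 2 * ε ≤ (σ ^ k) ^ 2 * ε := by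
      refine mul_le_mul_of_nonneg_right ?_ hε.le
      have : σ ^ (k+1) ≤ σ ^ k := pow_le_pow_of_le_one hσ0.le hσ1.le (by omega)
      gcongr
    have e6 : V * (B k i j - B (k+1) i j) ^ 2 ≤ 2 * ((ρ ^ n)⁻¹ * ε + ε) * (σ ^ k) ^ 2 := by nlinarith
    rw [Real.dist_eq]
    refine abs_le_of_sq_le_sq ?_ (by positivity)
    rw [mul_pow, hD, Real.sq_sqrt (by positivity), div_mul_eq_mul_div, le_div_iff₀ hV0]
    linarith
  have lim : ∀ i j, Tendsto (fun k => B k i j) atTop (𝓝 (Hf h 0 i j)) := by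
    intro i j
    have t1 := En_tendsto hh hρ (by linarith)
    have t2 : Tendsto (fun k : ℕ => (σ ^ k) ^ 2 * ε) atTop (𝓝 0) := by
      have := ((tendsto_pow_atTop_nhds_zero_of_lt_one hσ0.le hσ1).pow 2).mul_const ε
      simpa using this
    have t3 : Tendsto (fun k : ℕ => 2 * ((σ ^ k) ^ 2 * ε + En (tr 0 (ρ ^ k) h) (Hf h 0)) / V) atTop (𝓝 0) := by
      have := ((t2.add t1).const_mul 2).div_const V
      simpa using this
    have t4 : Tendsto (fun k : ℕ => (B k i j - Hf h 0 i j) ^ 2) atTop (𝓝 0) := by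
      refine squeeze_zero (fun k => sq_nonneg _) (fun k => ?_) t3
      have e1 := En_comp (tr_sm hh 0 (ρ ^ k)) (B k) (Hf h 0) i j
      have e2 := hB k
      rw [le_div_iff₀ hV0]
      linarith
    have t5 := t4.sqrt
    rw [Real.sqrt_zero] at t5
    rw [tendsto_iff_dist_tendsto_zero]
    simpa [Real.sqrt_sq_eq_abs, Real.dist_eq] using t5
  have pt : ∀ k, En (tr 0 (ρ ^ k) h) (Hf h 0) ≤ C3 * (σ ^ k) ^ 2 := by
    intro k
    have e1 : ∀ i j, |B k i j - Hf h 0 i j| ≤ D' * σ ^ k := by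
      intro i j
      have := dist_le_of_le_geometric_of_tendsto σ D hσ1 (step i j) (lim i j) k
      rw [Real.dist_eq] at this
      refine this.trans (le_of_eq ?_)
      rw [hD']; ring
    have e2 := En_change (tr_sm hh 0 (ρ ^ k)) (B k) (Hf h 0) e1
    have e3 := hB k
    rw [← hV] at e2
    refine e2.trans ?_
    rw [hC3]
    nlinarith
  obtain ⟨k, hk1, hk2⟩ := exists_nat_pow_near_of_lt_one hs0 hs1 hρ (by linarith)
  have hp : 0 < ρ ^ k := by positivity
  have e1 := En_tr_le (tr_sm hh 0 (ρ ^ k)) (Hf h 0) (r := s / ρ ^ k) (by positivity) ((div_le_one hp).2 hk2)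
  rw [tr_tr, mul_div_cancel₀ _ hp.ne'] at e1
  have e2 : ((s / ρ ^ k) ^ n)⁻¹ ≤ (ρ ^ n)⁻¹ := by
    refine inv_anti₀ (by positivity) ?_
    refine pow_le_pow_left₀ hρ.le ?_ n
    rw [le_div_iff₀ hp, ← pow_succ']; exact hk1.le
  have e3 : σ ^ k ≤ σ⁻¹ * s ^ α := by
    have : σ ^ (k+1) ≤ s ^ α := by
      have h5 := Real.rpow_le_rpow (by positivity) hk1.le hα0.le
      refine le_trans (le_of_eq ?_) h5
      rw [hσ, ← Real.rpow_natCast, ← Real.rpow_mul hρ.le, ← Real.rpow_natCast, ← Real.rpow_mul hρ.le, mul_comm]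
    rw [pow_succ] at this
    rw [inv_mul_eq_div, le_div_iff₀ hσ0]; exact this
  have e4 : (σ ^ k) ^ 2 ≤ (σ⁻¹ * s ^ α) ^ 2 := by gcongr
  calc En (tr 0 s h) (Hf h 0) ≤ (ρ ^ n)⁻¹ * (C3 * (σ⁻¹ * s ^ α) ^ 2) := by
        refine e1.trans ?_
        refine mul_le_mul e2 ((pt k).trans ?_) (En_nonneg _ _) (by positivity)
        exact mul_le_mul_of_nonneg_left e4 hC30.le
    _ = _ := by rw [mul_pow, inv_pow]; ring

end EK


namespace EK

lemma En_bdd {n : ℕ} {b R : ℝ} (hb : 0 ≤ b) {h : E n → ℝ} (hs : Sol R b h) {s : ℝ} (hs0 : 0 < s) (hR : s * 2 ≤ R) (h0 : 0 < R) : 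
    En (tr 0 s h) (Hf h 0) ≤ volume.real (ball (0 : E n) 2) * (n ^ 2 * 2 ^ 2) := by
  have h1 : ∫ x in ball (0 : E n) 2, ((n:ℝ) ^ 2 * 2 ^ 2) = volume.real (ball (0 : E n) 2) * (n ^ 2 * 2 ^ 2) := by
    rw [setIntegral_const, smul_eq_mul]
  rw [← h1]
  unfold En
  refine setIntegral_mono_on (intOn (dv_cont (tr_sm hs.sm 0 _) _) 2) (integrableOn_const measure_ball_lt_top.ne) measurableSet_ball fun x hx => ?_
  rw [dv_tr hs.sm _ hs0]
  have hm : s • x ∈ ball (0 : E n) R := by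
    rw [mem_ball_zero_iff] at hx ⊢
    rw [norm_smul, Real.norm_eq_abs, abs_of_pos hs0]
    nlinarith [norm_nonneg x]
  refine dv_le fun i j => ?_
  have e1 := abs_le.1 (psd_entry (hs.psd _ hm) (hs.tr_le hb _ hm) i j)
  have e2 := abs_le.1 (psd_entry (hs.psd _ (mem_ball_self h0)) (hs.tr_le hb _ (mem_ball_self h0)) i j)
  rw [abs_le]; constructor <;> linarith [e1.1, e1.2, e2.1, e2.2]

lemma pt_U (n : ℕ) (hn : 2 ≤ n) {b α Km : ℝ} (hb : 0 ≤ b) (hKm : 0 ≤ Km) (hα0 : 0 < α) (hα : α < 1) : ∃ C > 0,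
    ∀ K, 0 ≤ K → K ≤ Km → ∀ (h U : E n → ℝ), SolU b K h U → 
    ∀ s, 0 < s → s ≤ 1 → En (tr 0 s h) (Hf h 0) ≤ C * (s ^ α) ^ 2 := by
  obtain ⟨ε, hε, C, hC, hpt⟩ := iter_pt n hn hb hα0 hα
  obtain ⟨r0, hr0, hG⟩ := part_G n hn hb hKm hε
  set V := volume.real (ball (0 : E n) 2) with hV
  have hV0 : 0 ≤ V := measureReal_nonneg
  refine ⟨(C + V * (n ^ 2 * 2 ^ 2)) * ((r0 ^ α) ^ 2)⁻¹, by positivity, fun K hK hKK h U hU s hs0 hs1 => ?_⟩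
  obtain ⟨r, hr, hr1, A, hA, ht, hE⟩ := hG K hK hKK h U hU
  have hrp : 0 < r := hr0.trans_le hr
  have hs := hU.sol
  by_cases hsr : s ≤ r
  · have e1 := hpt (tr 0 r h) A (hs.tr 0 hrp (by rw [norm_zero]; linarith)) hA ht hE (s / r) (by positivity) ((div_le_one hrp).2 hsr)
    rw [tr_tr, mul_div_cancel₀ _ hrp.ne', Hf_tr hs.sm 0 hrp.ne', smul_zero, add_zero, Real.div_rpow hs0.le hrp.le, div_pow] at e1
    have e2 : ((r ^ α) ^ 2)⁻¹ ≤ ((r0 ^ α) ^ 2)⁻¹ := by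
      refine inv_anti₀ (by positivity) ?_
      gcongr
    calc _ ≤ _ := e1
      _ = C * ((r ^ α) ^ 2)⁻¹ * (s ^ α) ^ 2 := by rw [div_eq_mul_inv]; ring
      _ ≤ _ := by
        gcongr
        nlinarith [mul_nonneg hV0 (show (0:ℝ) ≤ n ^ 2 * 2 ^ 2 by positivity)]
  · push Not at hsr
    have e1 := En_bdd hb hs hs0 (by linarith) (by norm_num)
    have e2 : 1 ≤ ((r0 ^ α) ^ 2)⁻¹ * (s ^ α) ^ 2 := by
      rw [inv_mul_eq_div, one_le_div (by positivity)]
      have : r0 ≤ s := by linarith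
      gcongr
    have e3 := mul_le_mul_of_nonneg_left e2 (show 0 ≤ C + V * (n ^ 2 * 2 ^ 2) by positivity)
    linarith

lemma pt_S (n : ℕ) (hn : 2 ≤ n) {b α : ℝ} (hb : 0 ≤ b) (hα0 : 0 < α) (hα : α < 1) : ∃ C > 0,
    ∀ (h : E n → ℝ), Sol 4 b h → ∀ s, 0 < s → s ≤ 1 → En (tr 0 s h) (Hf h 0) ≤ C * (s ^ α) ^ 2 := by
  obtain ⟨C, hC, h1⟩ := pt_U n hn (b := b) (Km := 16 * n ^ 2 * b) hb (by positivity) hα0 hα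
  obtain ⟨C', hC', h2⟩ := pt_U n hn (b := 0) (Km := 16 * n ^ 2 * b) le_rfl (by positivity) hα0 hα
  refine ⟨C + C', by positivity, fun h hs s hs0 hs1 => ?_⟩
  obtain ⟨b', K, U, hb', hK, hKK, _, hU⟩ := solU_exists (by omega) hb hs
  have hp : 0 ≤ (s ^ α) ^ 2 := by positivity
  rcases hb' with rfl | rfl
  · have := h1 K hK hKK h U hU s hs0 hs1
    nlinarith
  · have := h2 K hK hKK h U hU s hs0 hs1
    nlinarith

lemma holder (n : ℕ) (hn : 2 ≤ n) {b α : ℝ} (hb : 0 ≤ b) (hα0 : 0 < α) (hα : α < 1) : ∃ C > 0,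
    ∀ (h : E n → ℝ), Sol (3/4) b h → ∀ x ∈ ball (0 : E n) (1/2), ∀ y ∈ ball (0 : E n) (1/2), ∀ i j, 
      |Hf h x i j - Hf h y i j| ≤ C * ‖x - y‖ ^ α := by
  obtain ⟨C, hC, hpt⟩ := pt_S n hn hb hα0 hα
  set V := volume.real (ball (0 : E n) 1) with hV
  have hV0 : 0 < V := by
    rw [hV, measureReal_def]; exact ENNReal.toReal_pos (measure_ball_pos _ _ (by norm_num)).ne' measure_ball_lt_top.ne
  refine ⟨(2 + √(4 * C / V)) * 16 ^ α, by positivity, fun h hs x hx y hy i j => ?_⟩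
  have hh := hs.sm
  have hS0 : 0 ≤ √(4 * C / V) := Real.sqrt_nonneg _
  rcases eq_or_ne x y with rfl | hxy
  · simp only [sub_self, abs_zero]; positivity
  set r := ‖x - y‖ with hr
  have hr0 : 0 < r := norm_pos_iff.2 (sub_ne_zero.2 hxy)
  have h16 : (16 * r) ^ α = 16 ^ α * r ^ α := Real.mul_rpow (by norm_num) hr0.le
  rw [mul_assoc, ← h16]
  have hbnd : ∀ z ∈ ball (0 : E n) (1/2), |Hf h z i j| ≤ 1 := fun z hz => by
    have hz' : z ∈ ball (0 : E n) (3/4) := ball_subset_ball (by norm_num) hz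
    exact psd_entry (hs.psd z hz') (hs.tr_le hb z hz') i j
  by_cases hr1 : 16 * r ≤ 1
  · -- small distance
    have hz : ∀ z ∈ ball (0 : E n) (1/2), ∫ u in ball (0 : E n) 2, (Hf h (z + r • u) i j - Hf h z i j) ^ 2 ≤ C * ((16 * r) ^ α) ^ 2 := by
      intro z hz
      have hz1 : ‖z‖ < 1/2 := mem_ball_zero_iff.1 hz
      have hs' : Sol 4 b (tr z (1/16) h) := hs.tr z (by norm_num) (by linarith)
      have e1 := hpt _ hs' (16 * r) (by positivity) hr1
      rw [Hf_tr hh z (by norm_num), smul_zero, add_zero] at e1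
      refine le_trans ?_ e1
      unfold En
      have hc := Hf_cont hh i j
      refine setIntegral_mono_on (intOn (by fun_prop) 2) (intOn (dv_cont (tr_sm hs'.sm 0 _) _) 2) measurableSet_ball fun u _ => ?_
      rw [dv_tr hs'.sm _ (by positivity)]
      have e2 := entry_sq_le (tr z (1/16) h) (Hf h z) ((16 * r) • u) i j
      rw [Hf_tr hh z (by norm_num), smul_smul, show (1/16 : ℝ) * (16 * r) = r by ring] at e2
      exact e2
    have hc := Hf_cont hh i j
    have k1 := hz x hx
    have k2 := hz y hy
    have cx : Continuous (fun u : E n => (Hf h (x + r • u) i j - Hf h x i j) ^ 2) := by fun_prop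
    have cy : Continuous (fun u : E n => (Hf h (y + r • u) i j - Hf h y i j) ^ 2) := by fun_prop
    have k3 := (setInt_mono cx (fun _ => sq_nonneg _) (show (1:ℝ) ≤ 2 by norm_num)).trans k1
    set w : E n := r⁻¹ • (y - x) with hw
    have hw1 : ‖w‖ ≤ 1 := by
      rw [hw, norm_smul, norm_inv, Real.norm_eq_abs, abs_of_pos hr0, norm_sub_rev, ← hr, inv_mul_cancel₀ hr0.ne']
    have k4 := (shift_le cy (fun _ => sq_nonneg _) hw1).trans k2
    have hyx : ∀ u : E n, y + r • (u - w) = x + r • u := by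
      intro u; rw [hw, smul_sub, smul_smul, mul_inv_cancel₀ hr0.ne', one_smul]; abel
    simp only [hyx] at k4
    have cy' : Continuous (fun u : E n => (Hf h (x + r • u) i j - Hf h y i j) ^ 2) := by fun_prop
    have k5 : V * (Hf h x i j - Hf h y i j) ^ 2 ≤ 2 * ((∫ u in ball (0 : E n) 1, (Hf h (x + r • u) i j - Hf h x i j) ^ 2) + ∫ u in ball (0 : E n) 1, (Hf h (x + r • u) i j - Hf h y i j) ^ 2) := by
      rw [← integral_add (intOn cx 1) (intOn cy' 1), ← integral_const_mul]
      have : V * (Hf h x i j - Hf h y i j) ^ 2 = ∫ u in ball (0 : E n) 1, (Hf h x i j - Hf h y i j) ^ 2 := by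
        rw [setIntegral_const, smul_eq_mul]
      rw [this]
      refine setIntegral_mono_on (integrableOn_const measure_ball_lt_top.ne) (intOn (continuous_const.mul (cx.add cy')) 1) measurableSet_ball fun u _ => ?_
      nlinarith [sq_nonneg ((Hf h (x + r • u) i j - Hf h x i j) + (Hf h (x + r • u) i j - Hf h y i j))]
    have k6 : |Hf h x i j - Hf h y i j| ≤ √(4 * C / V) * (16 * r) ^ α := by
      refine abs_le_of_sq_le_sq ?_ (by positivity)
      rw [mul_pow, Real.sq_sqrt (by positivity), div_mul_eq_mul_div, le_div_iff₀ hV0]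
      linarith
    have : 0 ≤ (16 * r) ^ α := by positivity
    linarith
  · push Not at hr1
    have e1 := abs_le.1 (hbnd x hx)
    have e2 := abs_le.1 (hbnd y hy)
    have e3 : |Hf h x i j - Hf h y i j| ≤ 2 := by rw [abs_le]; constructor <;> linarith [e1.1, e1.2, e2.1, e2.2]
    have e4 : 1 ≤ (16 * r) ^ α := Real.one_le_rpow hr1.le hα0.le
    nlinarith

end EK


namespace EK

lemma holder_all (n : ℕ) {b α : ℝ} (hb : 0 ≤ b) (hα0 : 0 < α) (hα : α < 1) : ∃ C > 0,
    ∀ (h : E n → ℝ), Sol (3/4) b h → ∀ x ∈ ball (0 : E n) (1/2), ∀ y ∈ ball (0 : E n) (1/2), ∀ i j, 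
      |Hf h x i j - Hf h y i j| ≤ C * ‖x - y‖ ^ α := by
  rcases Nat.lt_or_ge n 2 with hn | hn
  · refine ⟨1, one_pos, fun h hs x hx y hy i j => ?_⟩
    have hn1 : n = 0 ∨ n = 1 := by omega
    rcases hn1 with rfl | rfl
    · exact i.elim0
    · have key : ∀ z ∈ ball (0 : E 1) (1/2), Hf h z i j * (1 + b) = 1 := by
        intro z hz
        have e1 := hs.eq z (ball_subset_ball (by norm_num) hz)
        have hi : i = 0 := Subsingleton.elim _ _
        have hj : j = 0 := Subsingleton.elim _ _
        subst hi hj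
        simp [trF, detF] at e1
        linarith
      have e2 : Hf h x i j = Hf h y i j := by
        have := (key x hx).trans (key y hy).symm
        exact mul_right_cancel₀ (by positivity) this
      rw [e2, sub_self, abs_zero]; positivity
  · exact holder n hn hb hα0 hα

lemma ext_sm {n : ℕ} {h : E n → ℝ} (hh : ContDiffOn ℝ (⊤ : ℕ∞) h (ball 0 1)) : 
    ∃ g : E n → ℝ, Sm g ∧ ∀ x ∈ ball (0 : E n) (3/4), g x = h x := by
  obtain ⟨C₀, _, hcut⟩ := exists_cutoff n
  obtain ⟨η, hη, hηc, hηs, hη0, hη1, hηe, -⟩ := hcut (3/4) 1 (by norm_num) (by norm_num)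
  refine ⟨fun x => η x * h x, ?_, fun x hx => ?_⟩
  · refine contDiff_iff_contDiffAt.2 fun x => ?_
    by_cases hx : x ∈ tsupport η
    · exact hη.contDiffAt.mul (hh.contDiffAt (isOpen_ball.mem_nhds (hηs hx)))
    · have h0 : (fun x => η x * h x) =ᶠ[𝓝 x] fun _ => 0 := by
        filter_upwards [(isClosed_tsupport η).isOpen_compl.mem_nhds hx] with y hy
        rw [zero_of_nmem_tsupport hy, zero_mul]
      exact contDiffAt_const.congr_of_eventuallyEq h0
  · simp [hηe x (ball_subset_closedBall hx)]

lemma two_apply {n : ℕ} {g : E n → ℝ} (hg : Sm g) (x : E n) (m : Fin 2 → E n) : 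
    iteratedFDeriv ℝ 2 g x m = ∑ i, ∑ j, Hf g x i j * m 0 i * m 1 j := by
  rw [iteratedFDeriv_two_apply, ← dd_dd_eq hg, dd_dd_sum hg]

lemma two_e {n : ℕ} {g : E n → ℝ} (hg : Sm g) (x : E n) (i j : Fin n) : 
    iteratedFDeriv ℝ 2 g x ![EuclideanSpace.single i 1, EuclideanSpace.single j 1] = Hf g x i j := by
  rw [iteratedFDeriv_two_apply, ← dd_dd_eq hg]; rfl

lemma ml_norm {n : ℕ} (L : ContinuousMultilinearMap ℝ (fun _ : Fin 2 => E n) ℝ) (A : Fin n → Fin n → ℝ) {t : ℝ} (ht : 0 ≤ t)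
    (hL : ∀ m, L m = ∑ i, ∑ j, A i j * m 0 i * m 1 j) (hA : ∀ i j, |A i j| ≤ t) : ‖L‖ ≤ n ^ 2 * t := by
  refine ContinuousMultilinearMap.opNorm_le_bound (by positivity) fun m => ?_
  rw [hL, Fin.prod_univ_two, Real.norm_eq_abs]
  have hc : ∀ (v : E n) i, |v i| ≤ ‖v‖ := fun v i => by
    have := PiLp.norm_apply_le v i
    simpa using this
  have : ∀ i j, |A i j * m 0 i * m 1 j| ≤ t * (‖m 0‖ * ‖m 1‖) := by
    intro i j
    rw [abs_mul, abs_mul, mul_assoc]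
    exact mul_le_mul (hA i j) (mul_le_mul (hc _ _) (hc _ _) (abs_nonneg _) (norm_nonneg _)) (by positivity) ht
  calc |∑ i, ∑ j, A i j * m 0 i * m 1 j| ≤ ∑ i : Fin n, ∑ j : Fin n, t * (‖m 0‖ * ‖m 1‖) := 
        (Finset.abs_sum_le_sum_abs _ _).trans (Finset.sum_le_sum fun i _ => (Finset.abs_sum_le_sum_abs _ _).trans (Finset.sum_le_sum fun j _ => this i j))
    _ = _ := by simp; ring

lemma psd_of_convex {n : ℕ} {g : E n → ℝ} (hg : Sm g) {R : ℝ} (hc : ConvexOn ℝ (ball (0 : E n) R) g) : 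
    ∀ x ∈ ball (0 : E n) R, (Matrix.of (Hf g x)).PosSemidef := by
  intro x hx
  refine psd_of (Hf_symm hg x) fun v' => ?_
  set v : E n := WithLp.toLp 2 v' with hv
  have e1 := dd_dd_sum hg v v x
  have e2 : ∑ i, ∑ j, Hf g x i j * v' i * v' j = dd v (dd v g) x := e1.symm
  rw [e2]
  set l : ℝ →ᵃ[ℝ] E n := AffineMap.lineMap x (x + v) with hl
  have hlt : ∀ t, l t = x + t • v := fun t => by simp [hl, AffineMap.lineMap_apply, add_comm]
  have hco := hc.comp_affineMap l
  set S : Set ℝ := l ⁻¹' ball (0 : E n) R with hS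
  have lc : Continuous (fun t : ℝ => x + t • v) := by fun_prop
  have hSo : IsOpen S := by
    have : S = (fun t : ℝ => x + t • v) ⁻¹' ball (0 : E n) R := by ext t; simp [hS, hlt]
    rw [this]; exact isOpen_ball.preimage lc
  have h0 : (0:ℝ) ∈ S := by
    change l 0 ∈ ball (0 : E n) R
    rw [hlt, zero_smul, add_zero]; exact hx
  have hd : ∀ (f : E n → ℝ), Sm f → ∀ t, HasDerivAt (fun t : ℝ => f (x + t • v)) (dd v f (x + t • v)) t := by
    intro f hf t
    have h1 : HasDerivAt (fun t : ℝ => x + t • v) v t := by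
      simpa using ((hasDerivAt_id t).smul_const v).const_add x
    exact (hf.diff _).hasFDerivAt.comp_hasDerivAt t h1
  have hfun : (g ∘ l) = fun t => g (x + t • v) := by ext t; simp [hlt]
  rw [hfun] at hco
  have hm := hco.monotoneOn_deriv (fun t _ => (hd g hg t).differentiableAt)
  have hder : deriv (fun t : ℝ => g (x + t • v)) = fun t => dd v g (x + t • v) := funext fun t => (hd g hg t).deriv
  rw [hder] at hm
  have h2 := hm.derivWithin_nonneg (x := 0)
  rw [derivWithin_of_isOpen hSo h0, (hd _ (hg.dd v) 0).deriv] at h2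
  simpa using h2

end EK


/-- Proposition 5.5: interior `C^{2,α}` estimate for the constant coefficient equation
`Δh + b·det(D²h) = 1`. Let `B` be the open unit ball in `ℝⁿ`, `b ≥ 0`, `α ∈ (0,1)`, `M > 0`.
There is `C > 0` depending only on `n, b, α, M` such that every smooth convex `h : B → ℝ`
satisfying the equation on `B` with `‖h‖_{C^{1,α}(B)} ≤ M` satisfies
`‖h‖_{C^{2,α}(B_{1/2})} ≤ C`. -/
theorem statement14 (n : ℕ) (b α M : ℝ) (hb : 0 ≤ b)
    (hα : α ∈ Set.Ioo (0 : ℝ) 1) (hM : 0 < M) :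
    ∃ C > 0, ∀ h : EuclideanSpace ℝ (Fin n) → ℝ,
      ContDiffOn ℝ (⊤ : ℕ∞) h (Metric.ball 0 1) →
      ConvexOn ℝ (Metric.ball 0 1) h →
      (∀ x ∈ Metric.ball (0 : EuclideanSpace ℝ (Fin n)) 1,
        (Hess n h x).trace + b * (Hess n h x).det = 1) →
      (∀ x ∈ Metric.ball (0 : EuclideanSpace ℝ (Fin n)) 1,
        |h x| ≤ M ∧ ‖fderiv ℝ h x‖ ≤ M) →
      (∀ x ∈ Metric.ball (0 : EuclideanSpace ℝ (Fin n)) 1,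
        ∀ y ∈ Metric.ball (0 : EuclideanSpace ℝ (Fin n)) 1,
        ‖fderiv ℝ h x - fderiv ℝ h y‖ ≤ M * ‖x - y‖ ^ α) →
      (∀ x ∈ Metric.ball (0 : EuclideanSpace ℝ (Fin n)) (1 / 2),
        |h x| ≤ C ∧ ‖fderiv ℝ h x‖ ≤ C ∧ ‖iteratedFDeriv ℝ 2 h x‖ ≤ C) ∧
      (∀ x ∈ Metric.ball (0 : EuclideanSpace ℝ (Fin n)) (1 / 2),
        ∀ y ∈ Metric.ball (0 : EuclideanSpace ℝ (Fin n)) (1 / 2),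
        ‖iteratedFDeriv ℝ 2 h x - iteratedFDeriv ℝ 2 h y‖ ≤ C * ‖x - y‖ ^ α) := by
  obtain ⟨C0, hC0, hhol⟩ := EK.holder_all n hb hα.1 hα.2
  refine ⟨M + n ^ 2 + n ^ 2 * C0, by positivity, fun h hsm hcv heq hbd _ => ?_⟩
  obtain ⟨g, hg, hgh⟩ := EK.ext_sm hsm
  have hsub : ball (0 : EuclideanSpace ℝ (Fin n)) (3/4) ⊆ ball 0 1 := ball_subset_ball (by norm_num)
  have hsub2 : ball (0 : EuclideanSpace ℝ (Fin n)) (1/2) ⊆ ball 0 (3/4) := ball_subset_ball (by norm_num)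
  have hit : ∀ x ∈ ball (0 : EuclideanSpace ℝ (Fin n)) (3/4), iteratedFDeriv ℝ 2 h x = iteratedFDeriv ℝ 2 g x := by
    intro x hx
    have h1 : h =ᶠ[𝓝 x] g := by
      filter_upwards [isOpen_ball.mem_nhds hx] with y hy using (hgh y hy).symm
    exact (h1.iteratedFDeriv ℝ 2).eq_of_nhds
  have hHess : ∀ x ∈ ball (0 : EuclideanSpace ℝ (Fin n)) (3/4), Hess n h x = Matrix.of (EK.Hf g x) := by
    intro x hx
    ext i j
    rw [Hess, Matrix.of_apply, Matrix.of_apply, hit x hx, EK.two_e hg]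
  have hcg : ConvexOn ℝ (ball (0 : EuclideanSpace ℝ (Fin n)) (3/4)) g := 
    (hcv.subset hsub (convex_ball _ _)).congr fun x hx => (hgh x hx).symm
  have hs : EK.Sol (3/4) b g := ⟨hg, EK.psd_of_convex hg hcg, fun x hx => by
    have := heq x (hsub hx)
    rw [hHess x hx] at this
    exact this⟩
  have hn0 : (0:ℝ) ≤ (n:ℝ) ^ 2 := by positivity
  have hnC : (0:ℝ) ≤ (n:ℝ) ^ 2 * C0 := by positivity
  refine ⟨fun x hx => ⟨?_, ?_, ?_⟩, fun x hx y hy => ?_⟩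
  · have := (hbd x (hsub (hsub2 hx))).1
    linarith
  · have := (hbd x (hsub (hsub2 hx))).2
    linarith
  · have h1 := EK.ml_norm (iteratedFDeriv ℝ 2 g x) (EK.Hf g x) zero_le_one (EK.two_apply hg x) 
      (EK.psd_entry (hs.psd x (hsub2 hx)) (hs.tr_le hb x (hsub2 hx)))
    rw [hit x (hsub2 hx)]
    linarith
  · have h1 := EK.ml_norm (iteratedFDeriv ℝ 2 g x - iteratedFDeriv ℝ 2 g y) (fun i j => EK.Hf g x i j - EK.Hf g y i j) 
      (t := C0 * ‖x - y‖ ^ α) (by positivity) (fun m => by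
        rw [ContinuousMultilinearMap.sub_apply, EK.two_apply hg x, EK.two_apply hg y]
        simp only [sub_mul, Finset.sum_sub_distrib]) (hhol g hs x hx y hy)
    rw [hit x (hsub2 hx), hit y (hsub2 hy)]
    refine h1.trans ?_
    have h2 : 0 ≤ ‖x - y‖ ^ α := by positivity
    nlinarith [mul_nonneg hn0 h2]
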